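/- arXiv:0802.0118 — 2 statements merged into one kernel-verified Lean document; each statement's English description precedes it below -/
import Mathlib

section
/- Let 1 = G₀ ⊴ G₁ ⊴ G₂ ⊴ ⋯ ⊴ G_{r-1} ⊴ G_r = G be a normal series in a group G such that each factor group G_i/G_{i-1} is either finite, free of finite rank, or polycyclic. If φ : G → G is a homomorphism such that φ(G_i) ≤ G_i for 1 ≤ i ≤ r, then φ has property 𝔓. -/
/-- An endomorphism `φ` of `G` has property 𝔓 if for every `g ∈ G` there is a
finite-index normal subgroup `N` such that for all `i ≥ 0`, `φ^i(g) ∈ N ↔ φ^i(g) = 1`. -/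
def PropertyP {G : Type*} [Group G] (φ : G →* G) : Prop :=
  ∀ g : G, ∃ N : Subgroup G, N.Normal ∧ N.FiniteIndex ∧
    ∀ i : ℕ, ((⇑φ)^[i] g ∈ N ↔ (⇑φ)^[i] g = 1)

/-- A group is polycyclic if it has a subnormal series with cyclic factors. -/
def IsPolycyclic (G : Type*) [Group G] : Prop :=
  ∃ (m : ℕ) (H : Fin (m + 1) → Subgroup G),
    H 0 = ⊥ ∧ H (Fin.last m) = ⊤ ∧
    ∀ i : Fin m, H i.castSucc ≤ H i.succ ∧
      ∃ hn : ((H i.castSucc).subgroupOf (H i.succ)).Normal,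
        haveI := hn
        IsCyclic ((H i.succ) ⧸ (H i.castSucc).subgroupOf (H i.succ))

/-- `K ⊴ H` and the factor group `H/K` is finite, free of finite rank, or polycyclic. -/
def NiceFactor {G : Type*} [Group G] (K H : Subgroup G) : Prop :=
  K ≤ H ∧ ∃ hn : (K.subgroupOf H).Normal,
    haveI := hn
    Finite (H ⧸ K.subgroupOf H) ∨
      (∃ n : ℕ, Nonempty ((H ⧸ K.subgroupOf H) ≃* FreeGroup (Fin n))) ∨
      IsPolycyclic (H ⧸ K.subgroupOf H)

section PolynomialMaps

open MvPolynomial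

variable {σ K : Type*} [Field K]

/-- `h` only involves monomials of degree less than `d`. -/
def DegreeBelow (h : MvPolynomial σ K) (d : ℕ) : Prop :=
  ∀ m, coeff m h ≠ 0 → m.degree < d

/-- `h` is the monomial of exponent `γ` plus terms of lower total degree. -/
def LeadsWith (h : MvPolynomial σ K) (γ : σ →₀ ℕ) : Prop :=
  DegreeBelow (h - monomial γ 1) γ.degree

theorem exists_coeff_ne_zero_of_mul {h k : MvPolynomial σ K} {m : σ →₀ ℕ}
    (hm : coeff m (h * k) ≠ 0) : ∃ a b, a + b = m ∧ coeff a h ≠ 0 ∧ coeff b k ≠ 0 := by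
  classical
  rw [coeff_mul] at hm
  obtain ⟨⟨a, b⟩, hab, hne⟩ := Finset.exists_ne_zero_of_sum_ne_zero hm
  exact ⟨a, b, by simpa using hab, left_ne_zero_of_mul hne, right_ne_zero_of_mul hne⟩

theorem DegreeBelow.add {h k : MvPolynomial σ K} {d : ℕ} (hh : DegreeBelow h d)
    (hk : DegreeBelow k d) : DegreeBelow (h + k) d := by
  intro m hm
  by_cases h0 : coeff m h = 0
  · exact hk m (by simpa [h0] using hm)
  · exact hh m h0

theorem LeadsWith.degree_le {h : MvPolynomial σ K} {γ : σ →₀ ℕ} (hh : LeadsWith h γ)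
    {m : σ →₀ ℕ} (hm : coeff m h ≠ 0) : m.degree ≤ γ.degree := by
  classical
  by_cases hmγ : m = γ
  · rw [hmγ]
  · refine (hh m ?_).le
    simpa [coeff_monomial, Ne.symm hmγ] using hm

theorem LeadsWith.coeff_eq {h : MvPolynomial σ K} {γ m : σ →₀ ℕ} (hh : LeadsWith h γ)
    (hm : γ.degree ≤ m.degree) : coeff m h = coeff m (monomial γ (1 : K)) := by
  by_contra hne
  exact (hh m (by simpa [sub_eq_zero] using hne)).not_ge hm

theorem LeadsWith.mul {h k : MvPolynomial σ K} {γ δ : σ →₀ ℕ} (hh : LeadsWith h γ)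
    (hk : LeadsWith k δ) : LeadsWith (h * k) (γ + δ) := by
  classical
  have key : h * k - monomial (γ + δ) 1 =
      (h - monomial γ 1) * k + monomial γ 1 * (k - monomial δ 1) := by
    rw [mul_sub, monomial_mul, mul_one]; ring
  unfold LeadsWith
  rw [key, map_add]
  refine DegreeBelow.add ?_ ?_
  · intro m hm
    obtain ⟨a, b, rfl, ha, hb⟩ := exists_coeff_ne_zero_of_mul hm
    rw [map_add]
    exact add_lt_add_of_lt_of_le (hh a ha) (hk.degree_le hb)
  · intro m hm
    obtain ⟨a, b, rfl, ha, hb⟩ := exists_coeff_ne_zero_of_mul hm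
    have : γ = a := by
      by_contra hne
      simp [coeff_monomial, hne] at ha
    rw [map_add, this]
    exact add_lt_add_of_le_of_lt le_rfl (hk b hb)

theorem LeadsWith.one : LeadsWith (1 : MvPolynomial σ K) 0 := by
  intro m hm
  simp at hm

theorem LeadsWith.pow {h : MvPolynomial σ K} {γ : σ →₀ ℕ} (hh : LeadsWith h γ) (n : ℕ) :
    LeadsWith (h ^ n) (n • γ) := by
  induction n with
  | zero => simpa using LeadsWith.one
  | succ n ih => rw [pow_succ, succ_nsmul]; exact ih.mul hh

theorem LeadsWith.X (i : σ) : LeadsWith (X i : MvPolynomial σ K) (Finsupp.single i 1) := by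
  intro m hm
  simp [MvPolynomial.X] at hm

theorem LeadsWith.prod {ι : Type*} (s : Finset ι) {h : ι → MvPolynomial σ K}
    {γ : ι → σ →₀ ℕ} (hh : ∀ i, LeadsWith (h i) (γ i)) :
    LeadsWith (∏ i ∈ s, h i) (∑ i ∈ s, γ i) := by
  classical
  induction s using Finset.induction_on with
  | empty => simpa using LeadsWith.one
  | insert a s ha ih => rw [Finset.prod_insert ha, Finset.sum_insert ha]; exact (hh a).mul ih

variable [Fintype σ]

/-- The products of powers of `X i ^ Q - f i` and of `X i` (to exponents below `Q`); they form
a basis of the polynomial ring when the `f i` have degree less than `Q`. -/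
noncomputable def mixedMonomial (f : σ → MvPolynomial σ K) (Q : ℕ) (γ : σ →₀ ℕ) :
    MvPolynomial σ K :=
  ∏ i, (X i ^ Q - f i) ^ (γ i / Q) * X i ^ (γ i % Q)

variable {f : σ → MvPolynomial σ K} {Q : ℕ}

theorem leadsWith_mixedMonomial (hf : ∀ i, (f i).totalDegree < Q) (γ : σ →₀ ℕ) :
    LeadsWith (mixedMonomial f Q γ) γ := by
  classical
  have hγ : γ = ∑ i, ((γ i / Q) • Finsupp.single i Q + (γ i % Q) • Finsupp.single i 1) := by
    ext j
    simp [Finsupp.single_apply, Finset.sum_add_distrib, Nat.div_add_mod']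
  conv => arg 2; rw [hγ]
  refine LeadsWith.prod _ fun i => (LeadsWith.pow ?_ _).mul ((LeadsWith.X i).pow _)
  intro m hm
  have : coeff m (f i) ≠ 0 := by
    have h1 : (MvPolynomial.X i ^ Q - f i - monomial (Finsupp.single i Q) 1) = - f i := by
      rw [X_pow_eq_monomial]; ring
    simpa [h1] using hm
  have h2 := le_totalDegree (mem_support_iff.2 this)
  rw [Finsupp.degree_single]
  exact lt_of_le_of_lt h2 (hf i)

theorem mem_span_mixedMonomial (hf : ∀ i, (f i).totalDegree < Q) (h : MvPolynomial σ K) :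
    h ∈ Submodule.span K (Set.range (mixedMonomial f Q)) := by
  have main : ∀ d (h : MvPolynomial σ K), DegreeBelow h d →
      h ∈ Submodule.span K (Set.range (mixedMonomial f Q)) := by
    intro d
    induction d with
    | zero =>
      intro h hh
      have : h = 0 := by
        ext m
        by_contra hne
        exact absurd (hh m hne) (by simp)
      rw [this]; exact zero_mem _
    | succ d ih =>
      intro h hh
      rw [h.as_sum]
      refine Submodule.sum_mem _ fun γ hγ => ?_
      have : monomial γ (coeff γ h) = coeff γ h •
          (mixedMonomial f Q γ - (mixedMonomial f Q γ - monomial γ 1)) := by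
        simp [smul_monomial]
      rw [this]
      refine Submodule.smul_mem _ _ (Submodule.sub_mem _ (Submodule.subset_span ⟨γ, rfl⟩)
        (ih _ fun m hm => ?_))
      have h1 := leadsWith_mixedMonomial hf γ m hm
      have h2 := hh γ (mem_support_iff.1 hγ)
      omega
  refine main (h.totalDegree + 1) h fun m hm => ?_
  exact Nat.lt_succ_of_le (le_totalDegree (mem_support_iff.2 hm))

theorem mul_mixedMonomial (hQ : 0 < Q) (i : σ) (γ : σ →₀ ℕ) :
    (X i ^ Q - f i) * mixedMonomial f Q γ = mixedMonomial f Q (γ + Finsupp.single i Q) := by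
  classical
  unfold mixedMonomial
  rw [← Finset.mul_prod_erase _ _ (Finset.mem_univ i),
    ← Finset.mul_prod_erase (a := i) _ (fun j => _ * _) (Finset.mem_univ i)]
  rw [Finset.prod_congr rfl (g := fun j => (MvPolynomial.X j ^ Q - f j) ^ (γ j / Q) *
    MvPolynomial.X j ^ (γ j % Q)) (s₁ := Finset.univ.erase i)
    (f := fun j => (MvPolynomial.X j ^ Q - f j) ^ ((γ + Finsupp.single i Q) j / Q) *
    MvPolynomial.X j ^ ((γ + Finsupp.single i Q) j % Q))]
  · simp [Nat.add_div_right _ hQ, pow_succ]; ring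
  · intro j hj
    simp [(Finset.ne_of_mem_erase hj).symm]

/-- The ideal generated by the `X i ^ Q - f i` contains no nonzero polynomial of degree less
than `Q`. -/
theorem eq_zero_of_mem_span_of_totalDegree_lt (hf : ∀ i, (f i).totalDegree < Q)
    {h : MvPolynomial σ K} (hI : h ∈ Ideal.span (Set.range fun i => X i ^ Q - f i))
    (hh : h.totalDegree < Q) : h = 0 := by
  classical
  have hQ : 0 < Q := by omega
  have hspan : h ∈ Submodule.span K (mixedMonomial f Q '' {γ | ∃ i, Q ≤ γ i}) := by
    obtain ⟨c, rfl⟩ := Ideal.mem_span_range_iff_exists_fun.1 hI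
    refine Submodule.sum_mem _ fun i _ => ?_
    have := mem_span_mixedMonomial hf (c i)
    generalize c i = a at this
    induction this using Submodule.span_induction with
    | mem x hx =>
      obtain ⟨γ, rfl⟩ := hx
      rw [mul_comm, mul_mixedMonomial hQ]
      exact Submodule.subset_span ⟨_, ⟨i, by simp⟩, rfl⟩
    | zero => simp
    | add x y _ _ hx hy => rw [add_mul]; exact add_mem hx hy
    | smul a x _ hx => rw [smul_mul_assoc]; exact Submodule.smul_mem _ _ hx
  obtain ⟨c, hc, rfl⟩ := (Finsupp.mem_span_image_iff_linearCombination K).1 hspan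
  by_cases hc0 : c = 0
  · simp [hc0]
  exfalso
  obtain ⟨γ, hγ, hmax⟩ := c.support.exists_max_image (fun γ => γ.degree)
    (Finsupp.support_nonempty_iff.2 hc0)
  obtain ⟨i, hi⟩ := hc hγ
  have hcoeff : coeff γ (Finsupp.linearCombination K (mixedMonomial f Q) c) = c γ := by
    rw [Finsupp.linearCombination_apply, Finsupp.sum, coeff_sum,
      Finset.sum_eq_single_of_mem γ hγ]
    · rw [coeff_smul, (leadsWith_mixedMonomial hf γ).coeff_eq le_rfl]; simp
    · intro δ hδ hne
      rw [coeff_smul, (leadsWith_mixedMonomial hf δ).coeff_eq (hmax δ hδ), coeff_monomial,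
        if_neg hne, smul_zero]
  have h1 : γ.degree ≤ _ := le_totalDegree
    (mem_support_iff.2 (hcoeff.symm ▸ Finsupp.mem_support_iff.1 hγ))
  have h2 : γ i ≤ γ.degree := Finsupp.le_degree i γ
  omega

theorem pow_eq_zero_of_sum_eq_zero {A K ι : Type*} [CommRing A] [Field K] [Algebra K A] {x : A}
    (hx : IsNilpotent x) {s : Finset ι} {c : ι → K} {E : ι → ℕ} {a : ι} (ha : a ∈ s)
    (hca : c a ≠ 0) (hE : ∀ b ∈ s, b ≠ a → E a < E b)
    (hsum : ∑ b ∈ s, algebraMap K A (c b) * x ^ E b = 0) : x ^ E a = 0 := by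
  classical
  rw [← Finset.add_sum_erase _ _ ha] at hsum
  have h1 : ∑ b ∈ s.erase a, algebraMap K A (c b) * x ^ E b =
      x ^ E a * (x * ∑ b ∈ s.erase a, algebraMap K A (c b) * x ^ (E b - E a - 1)) := by
    rw [Finset.mul_sum, Finset.mul_sum]
    refine Finset.sum_congr rfl fun b hb => ?_
    have := hE b (Finset.mem_of_mem_erase hb) (Finset.ne_of_mem_erase hb)
    conv_lhs => rw [show E b = E a + (1 + (E b - E a - 1)) by omega]
    rw [pow_add, pow_add]; ring
  rw [h1, mul_comm, ← mul_add] at hsum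
  have hu : IsUnit (algebraMap K A (c a) +
      x * ∑ b ∈ s.erase a, algebraMap K A (c b) * x ^ (E b - E a - 1)) :=
    IsNilpotent.isUnit_add_left_of_commute ((Commute.all _ _).isNilpotent_mul_right hx)
      ((isUnit_iff_ne_zero.2 hca).map _) (Commute.all _ _)
  exact (hu.mul_left_eq_zero).1 hsum

theorem eq_of_sum_mul_pow_eq {q : ℕ} :
    ∀ {n : ℕ} {α β : Fin n → ℕ}, (∀ j, α j < q) → (∀ j, β j < q) →
      ∑ j, α j * q ^ (j : ℕ) = ∑ j, β j * q ^ (j : ℕ) → α = β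
  | 0, _, _, _, _, _ => Subsingleton.elim _ _
  | n + 1, α, β, hα, hβ, h => by
    have key : ∀ γ : Fin (n + 1) → ℕ, ∑ j, γ j * q ^ (j : ℕ) =
        γ 0 + q * ∑ j : Fin n, γ j.succ * q ^ (j : ℕ) := fun γ => by
      rw [Fin.sum_univ_succ, Finset.mul_sum]
      simp only [Fin.val_zero, pow_zero, mul_one, Fin.val_succ, pow_succ]
      congr 1
      exact Finset.sum_congr rfl fun _ _ => by ring
    rw [key, key] at h
    have h0 : α 0 = β 0 := by
      have := congrArg (· % q) h
      simpa [Nat.add_mul_mod_self_left, Nat.mod_eq_of_lt (hα 0), Nat.mod_eq_of_lt (hβ 0)]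
        using this
    have h1 : (fun j : Fin n => α j.succ) = fun j => β j.succ := by
      refine eq_of_sum_mul_pow_eq (fun j => hα _) (fun j => hβ _) ?_
      rw [h0] at h
      exact Nat.eq_of_mul_eq_mul_left ((Nat.zero_le _).trans_lt (hβ 0)) (Nat.add_left_cancel h)
    funext j
    refine Fin.cases h0 (fun j => congrFun h1 j) j

/-- Quasi-fixed points of a polynomial self-map `Φ` over `ZMod p` are not contained in a
hypersurface `P = 0` unless a suitable iterate of `Φ` maps into it. -/
theorem exists_quasiFixedPoint {σ : Type} [Fintype σ] {p : ℕ} [Fact p.Prime]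
    (Φ : MvPolynomial σ (ZMod p) →ₐ[ZMod p] MvPolynomial σ (ZMod p))
    (P : MvPolynomial σ (ZMod p)) (hP : (⇑Φ)^[Fintype.card σ] P ≠ 0) :
    ∃ (L : Type) (_ : Field L) (_ : Finite L) (a : MvPolynomial σ (ZMod p) →+* L)
      (f : L →+* L), (∀ r, a (Φ r) = f (a r)) ∧ a P ≠ 0 := by
  classical
  set n := Fintype.card σ with hn
  have hdep : ¬ AlgebraicIndependent (ZMod p) fun j : Fin (n + 1) => (⇑Φ)^[j] P := by
    intro h
    have := h.cardinalMk_le_trdeg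
    rw [MvPolynomial.trdeg_of_isDomain] at this
    simp at this
    omega
  rw [algebraicIndependent_iff] at hdep
  push Not at hdep
  obtain ⟨H, hH, hH0⟩ := hdep
  set D := (⇑Φ)^[n] P with hD
  set d := H.totalDegree with hd
  obtain ⟨m, hm⟩ : ∃ m, d + (D ^ d).totalDegree + ∑ i, (Φ (X i)).totalDegree < p ^ m :=
    ⟨_, Nat.lt_pow_self (Fact.out : p.Prime).one_lt⟩
  have hQ : 0 < p ^ m := by omega
  have hdeg : ∀ i, (Φ (X i)).totalDegree < p ^ m := fun i => by
    have := Finset.single_le_sum (f := fun i => (Φ (X i)).totalDegree)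
      (fun _ _ => Nat.zero_le _) (Finset.mem_univ i)
    lia
  set I := Ideal.span (Set.range fun i => X i ^ (p ^ m) - Φ (X i)) with hI
  have hπ : ∀ r, Ideal.Quotient.mk I (Φ r) = Ideal.Quotient.mk I r ^ (p ^ m) := by
    have : (Ideal.Quotient.mk I).comp Φ.toRingHom =
        (Ideal.Quotient.mk I).comp (iterateFrobenius (MvPolynomial σ (ZMod p)) p m) := by
      refine MvPolynomial.ringHom_ext (fun c => ?_) fun i => ?_
      · have : Φ (C c) = C c := Φ.commutes c
        simp [iterateFrobenius_def, this, ← map_pow, ZMod.pow_card_pow]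
      · simp only [RingHom.comp_apply, iterateFrobenius_def]
        have hmem : X i ^ p ^ m - Φ (X i) ∈ I := Ideal.subset_span ⟨i, rfl⟩
        exact (Ideal.Quotient.eq.2 hmem).symm
    intro r
    simpa [iterateFrobenius_def] using RingHom.congr_fun this r
  have hπ' : ∀ j, Ideal.Quotient.mk I ((⇑Φ)^[j] P) =
      Ideal.Quotient.mk I P ^ ((p ^ m) ^ j) := by
    intro j
    induction j with
    | zero => simp
    | succ j ih => rw [Function.iterate_succ_apply', hπ, ih, ← pow_mul, pow_succ]
  by_contra! hcon
  have hmax : ∀ M : Ideal (MvPolynomial σ (ZMod p)), M.IsMaximal → I ≤ M → P ∈ M := by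
    intro M hM hIM
    let : Field (MvPolynomial σ (ZMod p) ⧸ M) := Ideal.Quotient.field M
    have : Module.Finite (ZMod p) (MvPolynomial σ (ZMod p) ⧸ M) :=
      finite_of_finite_type_of_isJacobsonRing _ _
    have : CharP (MvPolynomial σ (ZMod p) ⧸ M) p :=
      charP_of_injective_algebraMap' (ZMod p) p
    have := hcon (MvPolynomial σ (ZMod p) ⧸ M) inferInstance
      (Module.finite_of_finite (ZMod p)) (Ideal.Quotient.mk M) (iterateFrobenius _ p m) fun r => by
        rw [iterateFrobenius_def, ← map_pow]
        exact Ideal.Quotient.eq.2 (hIM (Ideal.Quotient.eq.1 ((hπ r).trans (map_pow _ _ _).symm)))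
    exact Ideal.Quotient.eq_zero_iff_mem.1 this
  have hnil : IsNilpotent (Ideal.Quotient.mk I P) := by
    have : P ∈ I.radical := by
      rw [Ideal.radical_eq_jacobson, Ideal.jacobson, Submodule.mem_sInf]
      exact fun M hM => hmax M hM.2 hM.1
    obtain ⟨k, hk⟩ := this
    exact ⟨k, by rw [← map_pow]; exact Ideal.Quotient.eq_zero_iff_mem.2 hk⟩
  set x := Ideal.Quotient.mk I P with hx
  let E : (Fin (n + 1) →₀ ℕ) → ℕ := fun α => ∑ j, α j * (p ^ m) ^ (j : ℕ)
  have hαd : ∀ α ∈ H.support, ∑ j, α j ≤ d := fun α hα => by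
    have := le_totalDegree hα
    rwa [Finsupp.sum_fintype _ _ fun _ => rfl] at this
  obtain ⟨α, hα, hmin⟩ := H.support.exists_min_image E (support_nonempty.2 hH0)
  have hlt : ∀ β ∈ H.support, ∀ j, β j < p ^ m := fun β hβ j => by
    have := Finset.single_le_sum (f := fun i => β i)
      (fun _ _ => Nat.zero_le _) (Finset.mem_univ j)
    have := hαd β hβ
    lia
  have hxα : x ^ E α = 0 := by
    refine pow_eq_zero_of_sum_eq_zero (K := ZMod p) (c := fun β => coeff β H) hnil hα
      (mem_support_iff.1 hα)
      (fun β hβ hne => lt_of_le_of_ne (hmin β hβ) fun h => hne.symm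
        (DFunLike.coe_injective (eq_of_sum_mul_pow_eq (hlt α hα) (hlt β hβ) h))) ?_
    have h0 := congrArg (Ideal.Quotient.mk I) hH
    rw [map_zero, aeval_def, eval₂_eq', map_sum] at h0
    rw [← h0]
    refine Finset.sum_congr rfl fun β _ => ?_
    rw [map_mul, map_prod]
    congr 1
    rw [← Finset.prod_pow_eq_pow_sum]
    refine Finset.prod_congr rfl fun j _ => ?_
    rw [map_pow, hπ', ← pow_mul _ _ (β j), mul_comm]
  have hEα : E α ≤ (p ^ m) ^ n * d := by
    calc E α ≤ ∑ j, α j * (p ^ m) ^ n := Finset.sum_le_sum fun j _ =>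
          Nat.mul_le_mul_left _ (Nat.pow_le_pow_right hQ (by omega))
      _ = (∑ j, α j) * (p ^ m) ^ n := (Finset.sum_mul _ _ _).symm
      _ ≤ d * (p ^ m) ^ n := Nat.mul_le_mul_right _ (hαd α hα)
      _ = _ := mul_comm _ _
  have hDI : D ^ d ∈ I := by
    rw [← Ideal.Quotient.eq_zero_iff_mem, map_pow, hD, hπ', ← pow_mul]
    exact pow_eq_zero_of_le hEα hxα
  exact hP (eq_zero_of_pow_eq_zero
    (eq_zero_of_mem_span_of_totalDegree_lt hdeg hDI (by omega)))

end PolynomialMaps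

section FreeGroups

open Matrix MatrixGroups

variable {ι : Type*} [DecidableEq ι]

/-- The value of a word at a tuple of `2 × 2` matrices, with inverses replaced by adjugates. -/
def wordMatrix {S : Type*} [CommRing S] (M : ι → Matrix (Fin 2) (Fin 2) S) (w : FreeGroup ι) :
    Matrix (Fin 2) (Fin 2) S :=
  (w.toWord.map fun x => if x.2 then M x.1 else (M x.1).adjugate).prod

/-- A `2 × 2` matrix is scalar. -/
def IsScalarMatrix {S : Type*} [CommRing S] (A : Matrix (Fin 2) (Fin 2) S) : Prop :=
  A 0 1 = 0 ∧ A 1 0 = 0 ∧ A 0 0 - A 1 1 = 0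

theorem map_wordMatrix {S T : Type*} [CommRing S] [CommRing T] (f : S →+* T)
    (M : ι → Matrix (Fin 2) (Fin 2) S) (w : FreeGroup ι) :
    f.mapMatrix (wordMatrix M w) = wordMatrix (fun i => f.mapMatrix (M i)) w := by
  rw [wordMatrix, wordMatrix, map_list_prod, List.map_map]
  congr 2
  funext x
  by_cases hx : x.2
  · simp [hx]
  · simp only [Function.comp_apply, hx]
    exact f.map_adjugate _

theorem IsScalarMatrix.smul_iff {L : Type*} [Field L] {c : L} (hc : c ≠ 0)
    {A : Matrix (Fin 2) (Fin 2) L} : IsScalarMatrix (c • A) ↔ IsScalarMatrix A := by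
  simp [IsScalarMatrix, hc, ← mul_sub]

theorem isScalarMatrix_map_iff {S T : Type*} [CommRing S] [CommRing T] {f : S →+* T}
    (hf : Function.Injective f) {A : Matrix (Fin 2) (Fin 2) S} :
    IsScalarMatrix (f.mapMatrix A) ↔ IsScalarMatrix A := by
  simp [IsScalarMatrix, ← map_sub, map_eq_zero_iff f hf]

section Field

variable {L : Type*} [Field L]

theorem mk_eq_one_iff_isScalarMatrix {g : GL (Fin 2) L} :
    ProjGenLinGroup.mk g = 1 ↔ IsScalarMatrix g.val := by
  rw [ProjGenLinGroup.mk_eq_one, GeneralLinearGroup.mem_center_iff_val_mem_range_scalar]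
  constructor
  · rintro ⟨c, hc⟩
    rw [IsScalarMatrix, ← hc]
    simp
  · rintro ⟨h1, h2, h3⟩
    refine ⟨g.val 0 0, ?_⟩
    ext i j
    fin_cases i <;> fin_cases j <;> simp [h1, h2, sub_eq_zero.1 h3]

theorem mk_eq_mk_of_smul {g h : GL (Fin 2) L} {c : L} (hc : c ≠ 0) (hgh : g.val = c • h.val) :
    ProjGenLinGroup.mk g = ProjGenLinGroup.mk h := by
  rw [eq_comm, ProjGenLinGroup.mk_eq_mk_iff]
  refine ⟨Units.mk0 c hc, ?_⟩
  ext i j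
  simp [hgh, mul_comm]

theorem exists_wordMatrix_eq_smul (g : ι → GL (Fin 2) L) (w : FreeGroup ι) :
    ∃ c : L, c ≠ 0 ∧ wordMatrix (fun i => (g i).val) w = c • (FreeGroup.lift g w).val := by
  have key : ∀ l : List (ι × Bool), ∃ c : L, c ≠ 0 ∧
      (l.map fun x => if x.2 then (g x.1).val else (g x.1).val.adjugate).prod =
        c • (FreeGroup.lift g (FreeGroup.mk l)).val := by
    intro l
    induction l with
    | nil => exact ⟨1, one_ne_zero, by simp⟩
    | cons x l ih =>
      obtain ⟨c, hc, h⟩ := ih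
      rw [FreeGroup.lift_mk] at h
      rcases x with ⟨i, _ | _⟩
      · refine ⟨(g i).val.det * c, mul_ne_zero (g i).det_ne_zero hc, ?_⟩
        have h1 : (g i).val.adjugate = (g i).val.det • ((g i)⁻¹).val := by
          rw [coe_units_inv, Matrix.inv_def, smul_smul, Ring.mul_inverse_cancel _
            (isUnit_iff_ne_zero.2 (g i).det_ne_zero), one_smul]
        simp [h, h1, smul_smul, mul_comm]
      · exact ⟨c, hc, by simp [h]⟩
  have := key w.toWord
  rwa [FreeGroup.mk_toWord] at this

/-- The projective representation of a free group given by invertible matrices. -/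
noncomputable def projRep (N : ι → Matrix (Fin 2) (Fin 2) L) (hN : ∀ i, (N i).det ≠ 0) :
    FreeGroup ι →* PGL(2, L) :=
  ProjGenLinGroup.mk.comp
    (FreeGroup.lift fun i => GeneralLinearGroup.mkOfDetNeZero (N i) (hN i))

variable {N : ι → Matrix (Fin 2) (Fin 2) L} (hN : ∀ i, (N i).det ≠ 0)

theorem projRep_eq_one_iff {w : FreeGroup ι} :
    projRep N hN w = 1 ↔ IsScalarMatrix (wordMatrix N w) := by
  obtain ⟨c, hc, h⟩ := exists_wordMatrix_eq_smul
    (fun i => GeneralLinearGroup.mkOfDetNeZero (N i) (hN i)) w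
  change wordMatrix N w = _ at h
  rw [h, IsScalarMatrix.smul_iff hc, ← mk_eq_one_iff_isScalarMatrix]
  rfl

include hN in
theorem det_wordMatrix_ne_zero (w : FreeGroup ι) : (wordMatrix N w).det ≠ 0 := by
  obtain ⟨c, hc, h⟩ := exists_wordMatrix_eq_smul
    (fun i => GeneralLinearGroup.mkOfDetNeZero (N i) (hN i)) w
  change wordMatrix N w = _ at h
  rw [h, det_smul]
  exact mul_ne_zero (pow_ne_zero _ hc) (GeneralLinearGroup.det_ne_zero _)

include hN in
theorem isScalarMatrix_wordMatrix_comp (φ : FreeGroup ι →* FreeGroup ι) (w : FreeGroup ι) :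
    IsScalarMatrix (wordMatrix (fun i => wordMatrix N (φ (FreeGroup.of i))) w) ↔
      IsScalarMatrix (wordMatrix N (φ w)) := by
  have hN' := fun i => det_wordMatrix_ne_zero hN (φ (FreeGroup.of i))
  rw [← projRep_eq_one_iff hN', ← projRep_eq_one_iff hN]
  have : projRep _ hN' = (projRep N hN).comp φ := by
    ext i
    obtain ⟨c, hc, h⟩ := exists_wordMatrix_eq_smul
      (fun i => GeneralLinearGroup.mkOfDetNeZero (N i) (hN i)) (φ (FreeGroup.of i))
    simp only [projRep, MonoidHom.comp_apply, FreeGroup.lift_apply_of]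
    exact mk_eq_mk_of_smul hc h
  rw [this, MonoidHom.comp_apply]

end Field

/-- Matrices playing ping-pong on the projective line. -/
def pingPongMatrix (i : ℕ) : Matrix (Fin 2) (Fin 2) ℤ :=
  !![9 * (2 * i + 1), -(9 * (2 * i) * (2 * i + 1) + 1); 9, -(9 * (2 * i))]

theorem det_pingPongMatrix (i : ℕ) : (pingPongMatrix i).det = 9 := by
  rw [pingPongMatrix, det_fin_two_of]; ring

theorem det_pingPongMatrix_map (i : ℕ) :
    ((Int.castRingHom ℚ).mapMatrix (pingPongMatrix i)).det ≠ 0 := by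
  rw [← RingHom.map_det, det_pingPongMatrix]; norm_num

open Classical in
theorem injective_projRep_pingPongMatrix :
    Function.Injective (projRep _ det_pingPongMatrix_map) := by
  let g : ℕ → GL (Fin 2) ℚ := fun i => GeneralLinearGroup.mkOfDetNeZero _ (det_pingPongMatrix_map i)
  let act : GL (Fin 2) ℚ →* Equiv.Perm (OnePoint ℚ) := MulAction.toPermHom _ _
  let X : ℕ → Set (OnePoint ℚ) := fun i =>
    (fun z : ℚ => (z : OnePoint ℚ)) '' {z | |z - (2 * i + 1)| ≤ 1 / 3}
  let Y : ℕ → Set (OnePoint ℚ) := fun i =>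
    (fun z : ℚ => (z : OnePoint ℚ)) '' {z | |z - 2 * i| ≤ 1 / 3}
  have hclose : ∀ {z : ℚ} {a b : ℤ}, |z - a| ≤ 1 / 3 → |z - b| ≤ 1 / 3 → a = b := by
    intro z a b ha hb
    have : |((a - b : ℤ) : ℚ)| < 1 := by
      rw [abs_le] at ha hb
      push_cast
      rw [abs_lt]
      constructor <;> linarith
    have : |a - b| < 1 := by exact_mod_cast this
    exact sub_eq_zero.1 (Int.abs_lt_one_iff.1 this)
  have hX : ∀ i, ∀ x, x ∉ Y i → act (g i) x ∈ X i := by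
    intro i x hx
    change g i • x ∈ X i
    have h00 : (g i) 0 0 = 9 * (2 * i + 1) := by simp [g, pingPongMatrix]
    have h01 : (g i) 0 1 = -(9 * (2 * i) * (2 * i + 1) + 1) := by simp [g, pingPongMatrix]
    have h10 : (g i) 1 0 = 9 := by simp [g, pingPongMatrix]
    have h11 : (g i) 1 1 = -(9 * (2 * i)) := by simp [g, pingPongMatrix]
    cases x with
    | infty =>
      rw [OnePoint.smul_infty_eq_ite, h00, h10, if_neg (by norm_num)]
      exact ⟨_, by simp, rfl⟩
    | coe z =>
      have hz : 1 / 3 < |z - 2 * i| := by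
        by_contra! h
        exact hx ⟨z, h, rfl⟩
      have hz0 : z - 2 * i ≠ 0 := by
        intro h; rw [h] at hz; norm_num at hz
      have hne : (9 : ℚ) * z + -(9 * (2 * i)) ≠ 0 := by
        intro h; apply hz0; linarith
      rw [OnePoint.smul_some_eq_ite, h00, h01, h10, h11, if_neg hne]
      refine ⟨_, ?_, rfl⟩
      have : (9 * (2 * i + 1) * z + -(9 * (2 * i) * (2 * i + 1) + 1)) / (9 * z + -(9 * (2 * i)))
          - (2 * i + 1) = -(1 / 9) * (z - 2 * i)⁻¹ := by
        obtain ⟨u, rfl⟩ : ∃ u, z = u + 2 * i := ⟨z - 2 * i, by ring⟩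
        rw [add_sub_cancel_right] at hz0 ⊢
        rw [show 9 * (u + 2 * i) + -(9 * (2 * i)) = 9 * u by ring]
        field_simp
        ring
      simp only [Set.mem_ofPred_eq]
      rw [this, abs_mul, abs_inv]
      have h3 : |z - 2 * i|⁻¹ ≤ 3 := by
        rw [inv_le_comm₀ (by positivity) (by norm_num)]
        linarith
      norm_num [abs_neg] at *
      linarith
  have hinj : Function.Injective (FreeGroup.lift fun i => act (g i)) := by
    refine FreeGroup.injective_lift_of_ping_pong (fun i => act (g i)) X Y ?_ ?_ ?_ ?_ ?_ ?_
    · exact fun i => ⟨_, (2 * i + 1 : ℚ), by simp, rfl⟩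
    · intro i j hij
      refine Set.disjoint_left.2 ?_
      rintro _ ⟨z, hz, rfl⟩ ⟨z', hz', h⟩
      obtain rfl : z' = z := by simpa using h
      have := hclose (z := z') (a := 2 * i + 1) (b := 2 * j + 1)
        (by simpa using hz) (by simpa using hz')
      omega
    · intro i j hij
      refine Set.disjoint_left.2 ?_
      rintro _ ⟨z, hz, rfl⟩ ⟨z', hz', h⟩
      obtain rfl : z' = z := by simpa using h
      have := hclose (z := z') (a := 2 * i) (b := 2 * j)
        (by simpa using hz) (by simpa using hz')
      omega
    · intro i j
      refine Set.disjoint_left.2 ?_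
      rintro _ ⟨z, hz, rfl⟩ ⟨z', hz', h⟩
      obtain rfl : z' = z := by simpa using h
      have := hclose (z := z') (a := 2 * i + 1) (b := 2 * j)
        (by simpa using hz) (by simpa using hz')
      omega
    · rintro i _ ⟨x, hx, rfl⟩
      exact hX i x hx
    · rintro i _ ⟨x, hx, rfl⟩
      by_contra h
      refine hx ?_
      have := hX i _ h
      simpa using this
  rw [injective_iff_map_eq_one]
  intro w hw
  refine (injective_iff_map_eq_one _).1 hinj w ?_
  have hlift : (FreeGroup.lift fun i => act (g i)) = act.comp (FreeGroup.lift g) := by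
    ext i; simp
  have hsc : IsScalarMatrix (FreeGroup.lift g w).val := mk_eq_one_iff_isScalarMatrix.1 hw
  rw [hlift, MonoidHom.comp_apply]
  generalize FreeGroup.lift g w = h at hsc
  obtain ⟨h1, h2, h3⟩ := hsc
  rw [sub_eq_zero] at h3
  have h0 : h.val 1 1 ≠ 0 := by
    have := h.det_ne_zero
    rw [det_fin_two, h1, h3] at this
    simpa using this
  refine Equiv.ext fun x => ?_
  change h • x = x
  cases x with
  | infty => rw [OnePoint.smul_infty_eq_ite, if_pos h2]
  | coe z =>
    rw [OnePoint.smul_some_eq_ite, h1, h2, h3, zero_mul, zero_add, if_neg h0, add_zero,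
      mul_div_cancel_left₀ _ h0]

end FreeGroups

section FreeGroupEndomorphisms

open Matrix MatrixGroups MvPolynomial

variable {ι : Type*} [DecidableEq ι]

/-- A tuple of `2 × 2` matrices whose entries are independent variables. -/
noncomputable def genericMatrix (ι K : Type*) [CommRing K] (i : ι) :
    Matrix (Fin 2) (Fin 2) (MvPolynomial (ι × Fin 2 × Fin 2) K) :=
  Matrix.of fun a b => X (i, a, b)

/-- The polynomial self-map of the space of tuples of `2 × 2` matrices induced by an endomorphism
of a free group. -/
noncomputable def genericEndomorphism (K : Type*) [CommRing K] (φ : FreeGroup ι →* FreeGroup ι) :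
    MvPolynomial (ι × Fin 2 × Fin 2) K →ₐ[K] MvPolynomial (ι × Fin 2 × Fin 2) K :=
  aeval fun x => wordMatrix (genericMatrix ι K) (φ (FreeGroup.of x.1)) x.2.1 x.2.2

section Specialization

variable {K L : Type*} [CommRing K] [Field L] (φ : FreeGroup ι →* FreeGroup ι)

theorem mapMatrix_genericMatrix_comp (e : MvPolynomial (ι × Fin 2 × Fin 2) K →+* L) (i : ι) :
    (e.comp (genericEndomorphism K φ).toRingHom).mapMatrix (genericMatrix ι K i) =
      wordMatrix (fun i => e.mapMatrix (genericMatrix ι K i)) (φ (FreeGroup.of i)) := by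
  rw [← map_wordMatrix]
  ext a b
  simp [genericMatrix, genericEndomorphism]

theorem isScalarMatrix_genericMatrix_comp (e : MvPolynomial (ι × Fin 2 × Fin 2) K →+* L)
    (he : ∀ i, (e.mapMatrix (genericMatrix ι K i)).det ≠ 0) (w : FreeGroup ι) :
    IsScalarMatrix ((e.comp (genericEndomorphism K φ).toRingHom).mapMatrix
        (wordMatrix (genericMatrix ι K) w)) ↔
      IsScalarMatrix (e.mapMatrix (wordMatrix (genericMatrix ι K) (φ w))) := by
  rw [map_wordMatrix, map_wordMatrix, ← isScalarMatrix_wordMatrix_comp he]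
  simp_rw [mapMatrix_genericMatrix_comp]

theorem exists_specialization_iterate (j : ℕ) :
    ∀ e : MvPolynomial (ι × Fin 2 × Fin 2) K →+* L,
      (∀ i, (e.mapMatrix (genericMatrix ι K i)).det ≠ 0) →
      ∃ e' : MvPolynomial (ι × Fin 2 × Fin 2) K →+* L,
        (∀ P, e' P = e ((⇑(genericEndomorphism K φ))^[j] P)) ∧
        (∀ i, (e'.mapMatrix (genericMatrix ι K i)).det ≠ 0) ∧
        ∀ w, IsScalarMatrix (e'.mapMatrix (wordMatrix (genericMatrix ι K) w)) ↔
          IsScalarMatrix (e.mapMatrix (wordMatrix (genericMatrix ι K) ((⇑φ)^[j] w))) := by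
  induction j with
  | zero => exact fun e he => ⟨e, fun _ => rfl, he, fun _ => Iff.rfl⟩
  | succ j ih =>
    intro e he
    obtain ⟨e', h1, h2, h3⟩ := ih (e.comp (genericEndomorphism K φ).toRingHom) fun i => by
      rw [mapMatrix_genericMatrix_comp]
      exact det_wordMatrix_ne_zero he _
    refine ⟨e', fun P => ?_, h2, fun w => ?_⟩
    · rw [h1, Function.iterate_succ_apply']
      rfl
    · rw [h3, isScalarMatrix_genericMatrix_comp _ _ he, Function.iterate_succ_apply']

end Specialization

theorem not_isScalarMatrix_wordMatrix_pingPongMatrix {k : ℕ} {w : FreeGroup (Fin k)} (hw : w ≠ 1) :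
    ¬ IsScalarMatrix (wordMatrix (fun i : Fin k => pingPongMatrix i) w) := by
  have h : projRep _ (fun i : Fin k => det_pingPongMatrix_map i) =
      (projRep _ det_pingPongMatrix_map).comp (FreeGroup.map Fin.val) := by
    ext i
    simp [projRep]
  rw [← isScalarMatrix_map_iff (f := Int.castRingHom ℚ) Int.cast_injective, map_wordMatrix,
    ← projRep_eq_one_iff (fun i : Fin k => det_pingPongMatrix_map i), h, MonoidHom.comp_apply,
    map_eq_one_iff _ injective_projRep_pingPongMatrix,
    map_eq_one_iff _ (FreeGroup.map_injective Fin.val_injective)]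
  exact hw

theorem exists_prime_not_isScalarMatrix {A : Matrix (Fin 2) (Fin 2) ℤ} (hA : ¬ IsScalarMatrix A) :
    ∃ p : ℕ, p.Prime ∧ 9 < p ∧ ¬ IsScalarMatrix ((Int.castRingHom (ZMod p)).mapMatrix A) := by
  obtain ⟨p, hp, hprime⟩ := Nat.exists_infinite_primes
    (10 + (A 0 1).natAbs + (A 1 0).natAbs + (A 0 0 - A 1 1).natAbs)
  refine ⟨p, hprime, by omega, fun h => hA ?_⟩
  have key : ∀ z : ℤ, z.natAbs < p → (z : ZMod p) = 0 → z = 0 := fun z hz h0 =>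
    Int.eq_zero_of_dvd_of_natAbs_lt_natAbs ((ZMod.intCast_zmod_eq_zero_iff_dvd z p).1 h0) hz
  obtain ⟨h1, h2, h3⟩ := h
  exact ⟨key _ (by omega) h1, key _ (by omega) h2, key _ (by omega) (by simpa using h3)⟩

instance finite_projGenLinGroup {L : Type*} [Field L] [Finite L] : Finite PGL(2, L) :=
  Finite.of_surjective _ ProjGenLinGroup.mk_surjective

/-- A linear form on `2 × 2` matrices vanishing at scalar matrices. -/
def scalarForm {S : Type*} [CommRing S] (t : Fin 3) (A : Matrix (Fin 2) (Fin 2) S) : S :=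
  ![A 0 1, A 1 0, A 0 0 - A 1 1] t

theorem isScalarMatrix_iff_scalarForm {S : Type*} [CommRing S] {A : Matrix (Fin 2) (Fin 2) S} :
    IsScalarMatrix A ↔ ∀ t, scalarForm t A = 0 := by
  simp [IsScalarMatrix, scalarForm, Fin.forall_fin_succ]

theorem map_scalarForm {S T : Type*} [CommRing S] [CommRing T] (f : S →+* T) (t : Fin 3)
    (A : Matrix (Fin 2) (Fin 2) S) : f (scalarForm t A) = scalarForm t (f.mapMatrix A) := by
  fin_cases t <;> simp [scalarForm]

theorem exists_finiteIndex_iterate_notMem_freeGroup {k : ℕ}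
    (φ : FreeGroup (Fin k) →* FreeGroup (Fin k)) {g : FreeGroup (Fin k)}
    (hg : ∀ i, (⇑φ)^[i] g ≠ 1) :
    ∃ N : Subgroup (FreeGroup (Fin k)), N.FiniteIndex ∧ ∀ i, (⇑φ)^[i] g ∉ N := by
  set n := Fintype.card (Fin k × Fin 2 × Fin 2) with hn
  obtain ⟨p, hprime, hp9, hns⟩ := exists_prime_not_isScalarMatrix
    (not_isScalarMatrix_wordMatrix_pingPongMatrix (hg n))
  have : Fact p.Prime := ⟨hprime⟩
  set Y := genericMatrix (Fin k) (ZMod p) with hY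
  set Φ := genericEndomorphism (ZMod p) φ with hΦ
  let e : MvPolynomial (Fin k × Fin 2 × Fin 2) (ZMod p) →+* ZMod p :=
    MvPolynomial.eval fun x => (Int.castRingHom (ZMod p)).mapMatrix (pingPongMatrix x.1) x.2.1 x.2.2
  have heY : ∀ i, e.mapMatrix (Y i) = (Int.castRingHom (ZMod p)).mapMatrix (pingPongMatrix i) := by
    intro i
    ext a b
    simp [e, hY, genericMatrix]
  have hdet : ∀ i, (e.mapMatrix (Y i)).det ≠ 0 := by
    intro i
    rw [heY, ← RingHom.map_det, det_pingPongMatrix]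
    intro h
    have := Nat.le_of_dvd (by norm_num) ((ZMod.natCast_eq_zero_iff 9 p).1 (by simpa using h))
    omega
  obtain ⟨e', he', hdet', hsc⟩ := exists_specialization_iterate φ n e hdet
  have hns' : ¬ IsScalarMatrix (e'.mapMatrix (wordMatrix Y g)) := by
    rw [hsc, map_wordMatrix]
    rw [show (fun i => e.mapMatrix (genericMatrix (Fin k) (ZMod p) i)) = _ from funext heY,
      ← map_wordMatrix]
    exact hns
  simp only [isScalarMatrix_iff_scalarForm, not_forall] at hns'
  obtain ⟨t, ht⟩ := hns'
  obtain ⟨L, _, _, a, f, haf, haP⟩ := exists_quasiFixedPoint Φ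
    ((∏ i, (Y i).det) * scalarForm t (wordMatrix Y g)) fun h0 => by
      have := he' ((∏ i, (Y i).det) * scalarForm t (wordMatrix Y g))
      rw [h0, map_zero, map_mul, map_prod, map_scalarForm] at this
      refine mul_ne_zero (Finset.prod_ne_zero_iff.2 fun i _ => ?_) ht this
      rw [RingHom.map_det]
      exact hdet' i
  rw [map_mul, map_prod, map_scalarForm] at haP
  have ha : ∀ i, (a.mapMatrix (Y i)).det ≠ 0 := fun i => by
    rw [← RingHom.map_det]
    exact Finset.prod_ne_zero_iff.1 (left_ne_zero_of_mul haP) i (Finset.mem_univ i)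
  have hker : ∀ w, projRep _ ha w = 1 ↔ IsScalarMatrix (a.mapMatrix (wordMatrix Y w)) := fun w => by
    rw [projRep_eq_one_iff, map_wordMatrix]
  have hφ : ∀ w, projRep _ ha (φ w) = 1 ↔ projRep _ ha w = 1 := fun w => by
    have hcomp : a.comp Φ.toRingHom = f.comp a := RingHom.ext haf
    rw [hker, hker, ← isScalarMatrix_genericMatrix_comp φ a ha, ← hΦ, hcomp]
    exact isScalarMatrix_map_iff f.injective
  refine ⟨(projRep _ ha).ker, Subgroup.finiteIndex_ker _, fun i => ?_⟩
  rw [MonoidHom.mem_ker]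
  induction i with
  | zero =>
    change ¬ projRep _ ha g = 1
    rw [hker, isScalarMatrix_iff_scalarForm]
    exact fun h => right_ne_zero_of_mul haP (h t)
  | succ i ih => rwa [Function.iterate_succ_apply', hφ]

end FreeGroupEndomorphisms

section FiniteIndex

variable {G : Type*} [Group G]

namespace Subgroup

theorem relIndex_ne_zero_of_surjOn {C K M H : Subgroup G} (hCM : C ≤ M) (hKH : K ≤ H)
    (hC : C.relIndex K ≠ 0) (h : ∀ x ∈ H, ∃ k ∈ K, k⁻¹ * x ∈ M) : M.relIndex H ≠ 0 := by
  have : Finite (K ⧸ C.subgroupOf K) := @finite_quotient_of_finiteIndex _ _ _ ⟨hC⟩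
  let f : K ⧸ C.subgroupOf K → H ⧸ M.subgroupOf H :=
    Quotient.map' (inclusion hKH) fun a b hab => by
      rw [QuotientGroup.leftRel_apply] at hab ⊢
      exact hCM hab
  have : Finite (H ⧸ M.subgroupOf H) := by
    refine Finite.of_surjective f fun x => ?_
    induction x using QuotientGroup.induction_on with
    | H x =>
      obtain ⟨k, hk, hx⟩ := h x x.2
      exact ⟨QuotientGroup.mk ⟨k, hk⟩, QuotientGroup.eq.2 hx⟩
  exact (finiteIndex_of_finite_quotient (H := M.subgroupOf H)).index_ne_zero

theorem relIndex_inf_right_ne_zero {N K H : Subgroup G} (hN : N.relIndex K ≠ 0)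
    (hK : K.relIndex H ≠ 0) : (N ⊓ K).relIndex H ≠ 0 :=
  relIndex_ne_zero_trans (by rwa [inf_relIndex_right]) hK

theorem mem_sup_iff_of_le_normalizer {K R : Subgroup G} (hR : R ≤ normalizer (K : Set G)) {x : G} :
    x ∈ K ⊔ R ↔ ∃ k ∈ K, ∃ r ∈ R, k * r = x := by
  rw [← SetLike.mem_coe, coe_mul_of_right_le_normalizer_left _ _ hR]
  exact Set.mem_mul

theorem mem_sup_iff_of_le_normalizer' {K R : Subgroup G} (hR : R ≤ normalizer (K : Set G)) {x : G} :
    x ∈ K ⊔ R ↔ ∃ r ∈ R, ∃ k ∈ K, r * k = x := by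
  rw [sup_comm, ← SetLike.mem_coe, coe_mul_of_left_le_normalizer_right _ _ hR]
  exact Set.mem_mul

theorem finite_monoidHom_of_fg (K P : Type*) [Group K] [Group P] [Group.FG K] [Finite P] :
    Finite (K →* P) := by
  obtain ⟨S, hS, hfin⟩ := Group.fg_iff.1 ‹Group.FG K›
  have := hfin.to_subtype
  refine Finite.of_injective (fun (f : K →* P) (s : S) => f s) fun f g hfg => ?_
  exact MonoidHom.eq_of_eqOn_dense hS fun s hs => congrFun hfg ⟨s, hs⟩

/-- A finite-index subgroup of a finitely generated group contains a characteristic one. -/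
theorem exists_characteristic_le {K : Type*} [Group K] [Group.FG K] (N : Subgroup K)
    [N.FiniteIndex] : ∃ C : Subgroup K, C.Characteristic ∧ C.FiniteIndex ∧ C ≤ N := by
  have : Finite (K ⧸ N) := finite_quotient_of_finiteIndex
  have := finite_monoidHom_of_fg K (Equiv.Perm (K ⧸ N))
  refine ⟨⨅ f : K →* Equiv.Perm (K ⧸ N), f.ker, ?_, finiteIndex_iInf fun f => finiteIndex_ker f, ?_⟩
  · refine characteristic_iff_le_comap.2 fun ϕ x hx => ?_
    rw [mem_iInf] at hx
    rw [mem_comap, mem_iInf]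
    exact fun f => hx (f.comp ϕ.toMonoidHom)
  · refine (iInf_le _ (MulAction.toPermHom K (K ⧸ N))).trans ?_
    rw [← normalCore_eq_ker]
    exact normalCore_le N

theorem exists_le_normalizer {K N : Subgroup G} (hK : K.FG) (hN : N.relIndex K ≠ 0) :
    ∃ C ≤ N ⊓ K, C.relIndex K ≠ 0 ∧ normalizer (K : Set G) ≤ normalizer (C : Set G) := by
  have := (Group.fg_iff_subgroup_fg K).2 hK
  have : (N.subgroupOf K).FiniteIndex := ⟨hN⟩
  obtain ⟨C, hC, hCfin, hCN⟩ := exists_characteristic_le (N.subgroupOf K)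
  refine ⟨C.map K.subtype, ?_, ?_, ?_⟩
  · rintro _ ⟨x, hx, rfl⟩
    exact ⟨hCN hx, x.2⟩
  · rw [relIndex, subgroupOf, comap_map_eq_self_of_injective K.subtype_injective]
    exact hCfin.index_ne_zero
  · rw [le_normalizer_iff]
    rintro t ht _ ⟨x, hx, rfl⟩
    have := characteristic_iff_le_comap.1 hC (K.normalizerMonoidHom ⟨t, ht⟩) hx
    exact ⟨_, this, rfl⟩

end Subgroup

/-- The profinite topology of `H` induces the profinite topology of `K`. -/
def InducesProfinite (K H : Subgroup G) : Prop :=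
  ∀ N : Subgroup G, N.relIndex K ≠ 0 → ∃ M : Subgroup G, M.relIndex H ≠ 0 ∧ M ⊓ K ≤ N

namespace InducesProfinite

open Subgroup

theorem refl (K : Subgroup G) : InducesProfinite K K := fun N hN => ⟨N, hN, inf_le_left⟩

theorem trans {K L H : Subgroup G} (hKL : K ≤ L) (h₁ : InducesProfinite K L)
    (h₂ : InducesProfinite L H) : InducesProfinite K H := by
  intro N hN
  obtain ⟨M, hM, hMN⟩ := h₁ N hN
  obtain ⟨M', hM', hMM'⟩ := h₂ M hM
  exact ⟨M', hM', fun x hx => hMN ⟨hMM' ⟨hx.1, hKL hx.2⟩, hx.2⟩⟩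

theorem of_relIndex_ne_zero {K H : Subgroup G} (h : K.relIndex H ≠ 0) : InducesProfinite K H :=
  fun N hN => ⟨N ⊓ K, relIndex_inf_right_ne_zero hN h, fun _ hx => hx.1.1⟩

theorem of_complement {K R : Subgroup G} (hK : K.FG) (hR : R ≤ normalizer (K : Set G))
    (hRK : R ⊓ K = ⊥) : InducesProfinite K (K ⊔ R) := by
  intro N hN
  obtain ⟨C, hCN, hC, hKC⟩ := exists_le_normalizer hK hN
  rw [le_inf_iff] at hCN
  refine ⟨C ⊔ R, relIndex_ne_zero_of_surjOn le_sup_left le_sup_left hC fun x hx => ?_, ?_⟩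
  · obtain ⟨k, hk, r, hr, rfl⟩ := (mem_sup_iff_of_le_normalizer hR).1 hx
    exact ⟨k, hk, by simpa using (le_sup_right : R ≤ C ⊔ R) hr⟩
  · rintro x ⟨hx, hxK⟩
    obtain ⟨c, hc, r, hr, rfl⟩ := (mem_sup_iff_of_le_normalizer (hR.trans hKC)).1 hx
    have hrK : r ∈ K := (mul_mem_cancel_left (hCN.2 hc)).1 hxK
    obtain rfl : r = 1 := mem_bot.1 (hRK ▸ ⟨hr, hrK⟩)
    simpa using hCN.1 hc

theorem sup_zpowers {L : Subgroup G} (hL : L.FG) {t : G} (ht : t ∈ normalizer (L : Set G)) :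
    InducesProfinite L (L ⊔ zpowers t) := by
  have hR : zpowers t ≤ normalizer (L : Set G) := zpowers_le.2 ht
  by_cases h : zpowers t ⊓ L = ⊥
  · exact of_complement hL hR h
  · obtain ⟨⟨_, ⟨n, rfl⟩, hn⟩, hx⟩ := ne_bot_iff_exists_ne_one.1 h
    have hn0 : n.natAbs ≠ 0 := by
      intro h0
      obtain rfl := Int.natAbs_eq_zero.1 h0
      exact hx (Subtype.ext (zpow_zero t))
    have : Group.FG (zpowers t) := by
      rw [zpowers_eq_closure]
      infer_instance
    let : CommGroup (zpowers t) := IsCyclic.commGroup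
    have : (powMonoidHom (α := zpowers t) n.natAbs).range.FiniteIndex :=
      finiteIndex_range_powMonoidHom_of_fg _ hn0
    have hle : (powMonoidHom (α := zpowers t) n.natAbs).range ≤ L.subgroupOf (zpowers t) := by
      rintro _ ⟨⟨_, m, rfl⟩, rfl⟩
      have hn' : t ^ n.natAbs ∈ L := by
        have : t ^ n ∈ L := hn
        cases n <;> simpa using this
      have : (t ^ n.natAbs) ^ m ∈ L := zpow_mem hn' m
      rw [mem_subgroupOf]
      simpa [← zpow_natCast, ← zpow_mul, mul_comm] using this
    refine of_relIndex_ne_zero (relIndex_ne_zero_of_surjOn (C := L) (K := zpowers t)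
      le_rfl le_sup_right (finiteIndex_of_le hle).index_ne_zero fun x hx => ?_)
    obtain ⟨r, hr, k, hk, rfl⟩ := (mem_sup_iff_of_le_normalizer' hR).1 hx
    exact ⟨r, hr, by simpa using hk⟩

end InducesProfinite

end FiniteIndex

section Extensions

variable {G : Type*} [Group G]

namespace Subgroup

theorem eq_top_of_map_mk_eq_top {N W : Subgroup G} [N.Normal] (hNW : N ≤ W)
    (h : W.map (QuotientGroup.mk' N) = ⊤) : W = ⊤ := by
  rw [← comap_map_eq_self (f := QuotientGroup.mk' N) (H := W) (by rwa [QuotientGroup.ker_mk']), h,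
    comap_top]

theorem exists_sup_closure_eq_top (N : Subgroup G) [N.Normal] [Group.FG (G ⧸ N)] :
    ∃ S : Set G, S.Finite ∧ N ⊔ closure S = ⊤ := by
  obtain ⟨S, hS, hfin⟩ := Group.fg_iff.1 ‹Group.FG (G ⧸ N)›
  refine ⟨Quotient.out '' S, hfin.image _, eq_top_of_map_mk_eq_top le_sup_left ?_⟩
  rw [map_sup, MonoidHom.map_closure, Set.image_image]
  simp [hS]

theorem exists_complement_of_mulEquiv_freeGroup {α : Type*} (N : Subgroup G) [N.Normal]
    (e : (G ⧸ N) ≃* FreeGroup α) : ∃ R : Subgroup G, R ⊓ N = ⊥ ∧ N ⊔ R = ⊤ := by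
  let s : FreeGroup α →* G := FreeGroup.lift fun a => (e.symm (FreeGroup.of a)).out
  have hs : ∀ w, (s w : G ⧸ N) = e.symm w := by
    have : (QuotientGroup.mk' N).comp s = e.symm.toMonoidHom := by
      ext a
      simp [s]
    exact DFunLike.congr_fun this
  refine ⟨s.range, ?_, eq_top_of_map_mk_eq_top le_sup_left ?_⟩
  · rw [eq_bot_iff]
    rintro _ ⟨⟨w, rfl⟩, hw⟩
    have := hs w
    rw [(QuotientGroup.eq_one_iff _).2 hw, eq_comm, map_eq_one_iff _ e.symm.injective] at this
    simp [this]
  · refine eq_top_iff.2 fun q _ => mem_map.2 ⟨s (e q), le_sup_right (a := N) ⟨_, rfl⟩, ?_⟩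
    simp [hs]

theorem map_subtype_subgroupOf {K H : Subgroup G} (hKH : K ≤ H) :
    (K.subgroupOf H).map H.subtype = K := by
  rw [subgroupOf_map_subtype, inf_of_le_left hKH]

theorem map_subtype_top (H : Subgroup G) : (⊤ : Subgroup H).map H.subtype = H := by
  rw [← MonoidHom.range_eq_map, range_subtype]

theorem exists_sup_closure_eq {K H : Subgroup G} (hKH : K ≤ H) [(K.subgroupOf H).Normal]
    [Group.FG (H ⧸ K.subgroupOf H)] : ∃ S : Set G, S.Finite ∧ K ⊔ closure S = H := by
  obtain ⟨S, hfin, hS⟩ := exists_sup_closure_eq_top (K.subgroupOf H)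
  refine ⟨H.subtype '' S, hfin.image _, ?_⟩
  rw [← MonoidHom.map_closure, ← map_subtype_subgroupOf hKH, ← map_sup, hS, map_subtype_top]

theorem fg_closure_of_finite {S : Set G} (hS : S.Finite) : (closure S).FG :=
  (fg_iff _).2 ⟨S, rfl, hS⟩

theorem FG.of_quotient {K H : Subgroup G} (hK : K.FG) (hKH : K ≤ H) [(K.subgroupOf H).Normal]
    [Group.FG (H ⧸ K.subgroupOf H)] : H.FG := by
  obtain ⟨S, hfin, rfl⟩ := exists_sup_closure_eq hKH
  exact hK.sup (fg_closure_of_finite hfin)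

end Subgroup

open Subgroup

theorem InducesProfinite.of_free_quotient {α : Type*} {K H : Subgroup G} (hK : K.FG)
    (hKH : K ≤ H) [(K.subgroupOf H).Normal] (e : (H ⧸ K.subgroupOf H) ≃* FreeGroup α) :
    InducesProfinite K H := by
  obtain ⟨R, hR, hRH⟩ := exists_complement_of_mulEquiv_freeGroup (K.subgroupOf H) e
  have hsup : K ⊔ R.map H.subtype = H := by
    conv_lhs => rw [← map_subtype_subgroupOf hKH, ← Subgroup.map_sup, hRH, map_subtype_top]
  have h := of_complement (R := R.map H.subtype) hK
    ((map_subtype_le R).trans (le_normalizer_of_normal_subgroupOf hKH)) ?_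
  · rwa [hsup] at h
  · conv_lhs => rw [← map_subtype_subgroupOf hKH, ← map_inf_eq _ _ _ H.subtype_injective, hR,
      Subgroup.map_bot]

/-- `H` is obtained from `K` by finitely many extensions by a cyclic quotient. -/
inductive PolycyclicChain (K : Subgroup G) : Subgroup G → Prop
  | refl : PolycyclicChain K K
  | step {L : Subgroup G} {t : G} : PolycyclicChain K L → t ∈ normalizer (L : Set G) →
      PolycyclicChain K (L ⊔ zpowers t)

namespace PolycyclicChain

theorem le {K H : Subgroup G} (h : PolycyclicChain K H) : K ≤ H := by
  induction h with
  | refl => exact le_rfl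
  | step _ _ ih => exact ih.trans le_sup_left

theorem fg {K H : Subgroup G} (h : PolycyclicChain K H) (hK : K.FG) : H.FG := by
  induction h with
  | refl => exact hK
  | step _ _ ih =>
    exact ih.sup ((fg_iff _).2 ⟨_, (zpowers_eq_closure _).symm, Set.finite_singleton _⟩)

theorem inducesProfinite {K H : Subgroup G} (h : PolycyclicChain K H) (hK : K.FG) :
    InducesProfinite K H := by
  induction h with
  | refl => exact .refl K
  | step h ht ih => exact ih.trans h.le (.sup_zpowers (h.fg hK) ht)

theorem map {G' : Type*} [Group G'] (f : G →* G') {K H : Subgroup G} (h : PolycyclicChain K H) :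
    PolycyclicChain (K.map f) (H.map f) := by
  induction h with
  | refl => exact .refl
  | step _ ht ih =>
    rw [Subgroup.map_sup, MonoidHom.map_zpowers]
    exact ih.step (le_normalizer_map f (mem_map_of_mem f ht))

theorem comap {G' : Type*} [Group G'] {f : G' →* G} (hf : Function.Surjective f)
    {K H : Subgroup G} (h : PolycyclicChain K H) :
    PolycyclicChain (K.comap f) (H.comap f) := by
  induction h with
  | refl => exact .refl
  | @step L t _ ht ih =>
    obtain ⟨t, rfl⟩ := hf t
    have : (L ⊔ zpowers (f t)).comap f = L.comap f ⊔ zpowers t := by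
      rw [← MonoidHom.map_zpowers, ← comap_sup_eq _ _ _ hf, comap_map_eq, sup_comm _ f.ker,
        ← sup_assoc, sup_eq_left.2 (ker_le_comap _ _)]
    rw [this]
    exact ih.step (by rwa [← comap_normalizer_eq_of_surjective _ hf])

theorem of_isPolycyclic (h : IsPolycyclic G) : PolycyclicChain (⊥ : Subgroup G) ⊤ := by
  obtain ⟨m, H, h0, hm, hH⟩ := h
  have : ∀ i, PolycyclicChain ⊥ (H i) := by
    intro i
    induction i using Fin.induction with
    | zero => rw [h0]; exact .refl
    | succ i ih =>
      obtain ⟨hle, hn, hc⟩ := hH i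
      obtain ⟨q, hq⟩ := hc.exists_generator
      obtain ⟨x, rfl⟩ := QuotientGroup.mk_surjective q
      have htop : (H i.castSucc).subgroupOf (H i.succ) ⊔ zpowers x = ⊤ := by
        refine eq_top_of_map_mk_eq_top le_sup_left ?_
        rw [Subgroup.map_sup, MonoidHom.map_zpowers, eq_top_iff]
        exact fun y _ => mem_sup_right (hq y)
      have : H i.castSucc ⊔ zpowers (x : G) = H i.succ := by
        have := congrArg (Subgroup.map (H i.succ).subtype) htop
        rwa [Subgroup.map_sup, map_subtype_subgroupOf hle, MonoidHom.map_zpowers,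
          map_subtype_top] at this
      rw [← this]
      exact ih.step (le_normalizer_of_normal_subgroupOf hle x.2)
  exact hm ▸ this _

theorem of_isPolycyclic_quotient {K H : Subgroup G} (hKH : K ≤ H) [(K.subgroupOf H).Normal]
    (h : IsPolycyclic (H ⧸ K.subgroupOf H)) : PolycyclicChain K H := by
  have := ((of_isPolycyclic h).comap (QuotientGroup.mk'_surjective (K.subgroupOf H))).map H.subtype
  rwa [MonoidHom.comap_bot, QuotientGroup.ker_mk', map_subtype_subgroupOf hKH, comap_top,
    map_subtype_top] at this

theorem of_commutator_le {K : Subgroup G} {S : Set G} (hS : S.Finite)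
    (h : ⁅K ⊔ closure S, K ⊔ closure S⁆ ≤ K) : PolycyclicChain K (K ⊔ closure S) := by
  induction S, hS using Set.Finite.induction_on with
  | empty => simpa using PolycyclicChain.refl
  | @insert t S _ hS ih =>
    have hle : K ⊔ closure S ≤ K ⊔ closure (insert t S) :=
      sup_le_sup_left (Subgroup.closure_mono (Set.subset_insert _ _)) _
    have ht : t ∈ K ⊔ closure (insert t S) :=
      le_sup_right (a := K) (subset_closure (Set.mem_insert _ _))
    have : K ⊔ closure (insert t S) = K ⊔ closure S ⊔ zpowers t := by
      rw [Set.insert_eq, Subgroup.closure_union, ← zpowers_eq_closure,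
        sup_comm (zpowers t), sup_assoc]
    have hn : t ∈ normalizer ((K ⊔ closure S : Subgroup G) : Set G) := by
      refine zpowers_le.1 (le_normalizer_iff_commutator_le_right.2 ?_)
      exact (commutator_mono (zpowers_le.2 ht) hle).trans (h.trans le_sup_left)
    rw [this]
    exact (ih ((commutator_mono hle hle).trans h)).step hn

end PolycyclicChain

end Extensions

section PolycyclicChains

open Subgroup
open scoped commutatorElement

variable {G : Type*} [Group G]

namespace PolycyclicChain

theorem fg_of_le {H : Subgroup G} (h : PolycyclicChain ⊥ H) : ∀ J ≤ H, J.FG := by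
  induction h with
  | refl =>
    intro J hJ
    rw [le_bot_iff.1 hJ]
    exact ⟨∅, by simp⟩
  | @step L t _ ht ih =>
    intro J hJ
    have hR : zpowers t ≤ normalizer (L : Set G) := zpowers_le.2 ht
    have hJL : J ≤ normalizer (L : Set G) := hJ.trans (sup_le le_normalizer hR)
    obtain ⟨⟨⟨z, hzt⟩, hz⟩, hgen⟩ := (((L ⊔ J).subgroupOf (zpowers t)).isCyclic).exists_generator
    obtain ⟨l, hl, j, hj, rfl⟩ := (mem_sup_iff_of_le_normalizer hJL).1 (mem_subgroupOf.1 hz)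
    have hjL : zpowers j ≤ normalizer (L : Set G) := zpowers_le.2 (hJL hj)
    have : J = (J ⊓ L) ⊔ zpowers j := by
      refine le_antisymm (fun x hx => ?_) (sup_le inf_le_left (zpowers_le.2 hj))
      obtain ⟨l', hl', r, hr, rfl⟩ := (mem_sup_iff_of_le_normalizer hR).1 (hJ hx)
      have hrLJ : r ∈ L ⊔ J := by
        simpa using mul_mem (mem_sup_left (T := J) (inv_mem hl')) (mem_sup_right hx)
      obtain ⟨k, hk⟩ := hgen ⟨⟨r, hr⟩, hrLJ⟩
      have hk : (l * j) ^ k = r := by simpa using congrArg (fun a => (a.1.1 : G)) hk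
      have hmem : l' * r ∈ L ⊔ zpowers j := by
        rw [← hk]
        exact mul_mem (mem_sup_left hl') (zpow_mem (mul_mem (mem_sup_left hl)
          (mem_sup_right (mem_zpowers j))) k)
      obtain ⟨l₃, hl₃, s, hs, h⟩ := (mem_sup_iff_of_le_normalizer hjL).1 hmem
      rw [← h] at hx ⊢
      have hsJ : s ∈ J := zpowers_le.2 hj hs
      exact mul_mem (mem_sup_left ⟨(mul_mem_cancel_right hsJ).1 hx, hl₃⟩) (mem_sup_right hs)
    rw [this]
    exact (ih _ inf_le_right).sup
      ((fg_iff _).2 ⟨_, (zpowers_eq_closure j).symm, Set.finite_singleton _⟩)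

theorem commutator_sup_zpowers_le {L : Subgroup G} {t : G} (ht : t ∈ normalizer (L : Set G)) :
    ⁅L ⊔ zpowers t, L ⊔ zpowers t⁆ ≤ L := by
  have hR : zpowers t ≤ normalizer (L : Set G) := zpowers_le.2 ht
  have hconj := le_normalizer_iff.1 hR
  refine commutator_le.2 fun x hx y hy => ?_
  obtain ⟨l₁, hl₁, r₁, hr₁, rfl⟩ := (mem_sup_iff_of_le_normalizer hR).1 hx
  obtain ⟨l₂, hl₂, r₂, hr₂, rfl⟩ := (mem_sup_iff_of_le_normalizer hR).1 hy
  have hcomm : r₁ * r₂ * r₁⁻¹ = r₂ := by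
    obtain ⟨a, rfl⟩ := hr₁
    obtain ⟨b, rfl⟩ := hr₂
    simp [zpow_mul_comm t a b]
  have : ⁅l₁ * r₁, l₂ * r₂⁆ = l₁ * (r₁ * l₂ * r₁⁻¹) * (r₂ * l₁⁻¹ * r₂⁻¹) * l₂⁻¹ :=
    calc ⁅l₁ * r₁, l₂ * r₂⁆ =
          l₁ * (r₁ * l₂ * r₁⁻¹) * (r₁ * r₂ * r₁⁻¹ * l₁⁻¹ * r₂⁻¹) * l₂⁻¹ := by
            rw [commutatorElement_def]; group
      _ = _ := by rw [hcomm]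
  rw [this]
  exact mul_mem (mul_mem (mul_mem hl₁ (hconj _ hr₁ _ hl₂)) (hconj _ hr₂ _ (inv_mem hl₁)))
    (inv_mem hl₂)

theorem exists_iterate_commutator_eq_bot {H : Subgroup G} (h : PolycyclicChain ⊥ H) :
    ∃ n : ℕ, (fun J : Subgroup G => ⁅J, J⁆)^[n] H = ⊥ := by
  induction h with
  | refl => exact ⟨0, rfl⟩
  | step _ ht ih =>
    obtain ⟨n, hn⟩ := ih
    have hmono : Monotone fun J : Subgroup G => ⁅J, J⁆ := fun _ _ h => commutator_mono h h
    refine ⟨n + 1, le_bot_iff.1 ?_⟩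
    rw [Function.iterate_succ_apply, ← hn]
    exact hmono.iterate n (commutator_sup_zpowers_le ht)

end PolycyclicChain

end PolycyclicChains

section SeparatesOrbits

open Subgroup

variable {G : Type*} [Group G]

/-- The `φ`-orbit of each element of `H` avoids some finite-index subgroup of `H` outside `K`. -/
def SeparatesOrbits (φ : G →* G) (K H : Subgroup G) : Prop :=
  ∀ g ∈ H, ∃ N : Subgroup G, N.relIndex H ≠ 0 ∧ ∀ i : ℕ, (⇑φ)^[i] g ∈ N → (⇑φ)^[i] g ∈ K

theorem iterate_mem {φ : G →* G} {H : Subgroup G} (hφ : H.map φ ≤ H) {g : G} (hg : g ∈ H) (i : ℕ) :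
    (⇑φ)^[i] g ∈ H := by
  induction i with
  | zero => exact hg
  | succ i ih =>
    rw [Function.iterate_succ_apply']
    exact hφ (mem_map_of_mem φ ih)

theorem map_id_le (H : Subgroup G) : H.map (MonoidHom.id G) ≤ H := (map_id H).le

theorem iterate_id_apply (i : ℕ) (g : G) : (⇑(MonoidHom.id G))^[i] g = g := by
  rw [MonoidHom.coe_id, Function.iterate_id, id]

theorem SeparatesOrbits.exists_of_eventually {φ : G →* G} {H : Subgroup G}
    (hid : SeparatesOrbits (MonoidHom.id G) ⊥ H) (hφ : H.map φ ≤ H) {g : G} (hg : g ∈ H) (n : ℕ)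
    {N : Subgroup G} (hN : N.relIndex H ≠ 0)
    (h : ∀ i, n ≤ i → (⇑φ)^[i] g ∈ N → (⇑φ)^[i] g ∈ (⊥ : Subgroup G)) :
    ∃ N : Subgroup G, N.relIndex H ≠ 0 ∧ ∀ i, (⇑φ)^[i] g ∈ N → (⇑φ)^[i] g ∈ (⊥ : Subgroup G) := by
  induction n generalizing N with
  | zero => exact ⟨N, hN, fun i => h i (Nat.zero_le i)⟩
  | succ n ih =>
    obtain ⟨N', hN', h'⟩ := hid _ (iterate_mem hφ hg n)
    refine ih (relIndex_inf_ne_zero hN hN') fun i hi hmem => ?_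
    rcases hi.eq_or_lt with rfl | hi
    · simpa only [iterate_id_apply] using h' 0 hmem.2
    · exact h i hi hmem.1

theorem SeparatesOrbits.of_extension_id {K H : Subgroup G} (hS : InducesProfinite K H)
    (hK : SeparatesOrbits (MonoidHom.id G) ⊥ K) (hKH : SeparatesOrbits (MonoidHom.id G) K H) :
    SeparatesOrbits (MonoidHom.id G) ⊥ H := by
  intro g hg
  simp only [iterate_id_apply]
  by_cases hgK : g ∈ K
  · obtain ⟨N, hN, h⟩ := hK g hgK
    obtain ⟨M, hM, hMN⟩ := hS N hN
    refine ⟨M, hM, fun _ hgM => ?_⟩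
    simpa only [iterate_id_apply] using h 0 (hMN ⟨hgM, hgK⟩)
  · obtain ⟨N, hN, h⟩ := hKH g hg
    simp only [iterate_id_apply] at h
    exact ⟨N, hN, fun i hgN => (hgK (h i hgN)).elim⟩

theorem SeparatesOrbits.of_extension {φ : G →* G} {K H : Subgroup G} (hφK : K.map φ ≤ K)
    (hφH : H.map φ ≤ H) (hS : InducesProfinite K H) (hK : SeparatesOrbits φ ⊥ K)
    (hKid : SeparatesOrbits (MonoidHom.id G) ⊥ K) (hKH : SeparatesOrbits φ K H)
    (hKHid : SeparatesOrbits (MonoidHom.id G) K H) : SeparatesOrbits φ ⊥ H := by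
  intro g hg
  have hid := of_extension_id hS hKid hKHid
  by_cases h : ∃ n, (⇑φ)^[n] g ∈ K
  · obtain ⟨n, hn⟩ := h
    obtain ⟨N, hN, h⟩ := hK _ hn
    obtain ⟨M, hM, hMN⟩ := hS N hN
    refine hid.exists_of_eventually hφH hg n hM fun i hi hiM => ?_
    obtain ⟨j, rfl⟩ := Nat.exists_eq_add_of_le' hi
    rw [Function.iterate_add_apply] at hiM ⊢
    exact h j (hMN ⟨hiM, iterate_mem hφK hn j⟩)
  · push Not at h
    obtain ⟨N, hN, h'⟩ := hKH g hg
    exact ⟨N, hN, fun i hi => (h i (h' i hi)).elim⟩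

/-- Every endomorphism of `Q` has orbits separated from `1` by finite-index subgroups. -/
def AllSeparateOrbits (Q : Type*) [Group Q] : Prop :=
  ∀ ψ : Q →* Q, SeparatesOrbits ψ ⊥ ⊤

theorem AllSeparateOrbits.of_finite (Q : Type*) [Group Q] [Finite Q] : AllSeparateOrbits Q :=
  fun _ _ _ => ⟨⊥, by rw [relIndex_top_right]; exact index_ne_zero_of_finite, fun _ h => h⟩

theorem AllSeparateOrbits.of_forall {Q : Type*} [Group Q]
    (h : ∀ (ψ : Q →* Q) (g : Q), (∀ i, (⇑ψ)^[i] g ≠ 1) →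
      ∃ N : Subgroup Q, N.FiniteIndex ∧ ∀ i, (⇑ψ)^[i] g ∉ N) : AllSeparateOrbits Q := by
  have hid : SeparatesOrbits (MonoidHom.id Q) ⊥ ⊤ := by
    intro g _
    simp only [iterate_id_apply, mem_bot, relIndex_top_right]
    by_cases hg : g = 1
    · exact ⟨⊤, by simp, fun _ _ => hg⟩
    · obtain ⟨N, hN, hgN⟩ := h (MonoidHom.id Q) g
        (by simpa only [iterate_id_apply] using fun _ => hg)
      simp only [iterate_id_apply] at hgN
      exact ⟨N, hN.index_ne_zero, fun i hi => (hgN i hi).elim⟩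
  intro ψ g hg
  by_cases hg1 : ∃ n, (⇑ψ)^[n] g = 1
  · obtain ⟨n, hn⟩ := hg1
    refine hid.exists_of_eventually le_top hg n (N := ⊤) (by simp) fun i hi _ => ?_
    obtain ⟨j, rfl⟩ := Nat.exists_eq_add_of_le' hi
    rw [Function.iterate_add_apply, hn, mem_bot, iterate_map_one]
  · push Not at hg1
    obtain ⟨N, hN, h⟩ := h ψ g hg1
    exact ⟨N, by rw [relIndex_top_right]; exact hN.index_ne_zero, fun i hi => (h i hi).elim⟩

theorem AllSeparateOrbits.of_mulEquiv {Q Q' : Type*} [Group Q] [Group Q'] (e : Q ≃* Q')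
    (h : AllSeparateOrbits Q') : AllSeparateOrbits Q := by
  intro ψ g _
  obtain ⟨N, hN, hNg⟩ := h (e.toMonoidHom.comp (ψ.comp e.symm.toMonoidHom)) (e g) (mem_top _)
  have hsemi : Function.Semiconj e ψ (e.toMonoidHom.comp (ψ.comp e.symm.toMonoidHom)) :=
    fun x => by simp
  refine ⟨N.comap e.toMonoidHom, ?_, fun i hi => ?_⟩
  · rw [relIndex_top_right] at hN ⊢
    rwa [index_comap_of_surjective _ e.surjective]
  · have := (hsemi.iterate_right i).eq g
    have h1 := hNg i (by rw [← this]; exact hi)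
    rw [← this] at h1
    simpa using h1

theorem AllSeparateOrbits.freeGroup (n : ℕ) : AllSeparateOrbits (FreeGroup (Fin n)) :=
  .of_forall fun ψ _ hg => exists_finiteIndex_iterate_notMem_freeGroup ψ hg

theorem SeparatesOrbits.of_quotient {φ : G →* G} {K H : Subgroup G}
    [(K.subgroupOf H).Normal] (hφK : K.map φ ≤ K) (hφH : H.map φ ≤ H)
    (h : AllSeparateOrbits (H ⧸ K.subgroupOf H)) : SeparatesOrbits φ K H := by
  intro g hg
  let φH : H →* H := (φ.comp H.subtype).codRestrict H fun x => hφH (mem_map_of_mem φ x.2)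
  let ψ : H ⧸ K.subgroupOf H →* H ⧸ K.subgroupOf H :=
    QuotientGroup.map _ _ φH fun x hx => hφK (mem_map_of_mem φ hx)
  have h1 : ∀ i, ((⇑φH)^[i] ⟨g, hg⟩ : G) = (⇑φ)^[i] g := fun i =>
    (Function.Semiconj.iterate_right (f := H.subtype) (ga := φH) (gb := φ) (fun _ => rfl) i).eq _
  have h2 : ∀ i, (((⇑φH)^[i] ⟨g, hg⟩ : H) : H ⧸ K.subgroupOf H) = (⇑ψ)^[i] (⟨g, hg⟩ : H) := fun i =>
    (Function.Semiconj.iterate_right (f := QuotientGroup.mk' (K.subgroupOf H)) (ga := φH) (gb := ψ)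
      (fun _ => rfl) i).eq _
  obtain ⟨N, hN, hNg⟩ := h ψ (⟨g, hg⟩ : H) (mem_top _)
  refine ⟨(N.comap (QuotientGroup.mk' _)).map H.subtype, ?_, fun i hi => ?_⟩
  · rw [relIndex, subgroupOf, comap_map_eq_self_of_injective H.subtype_injective,
      index_comap_of_surjective _ (QuotientGroup.mk'_surjective _)]
    rwa [relIndex_top_right] at hN
  · obtain ⟨x, hx, hxi⟩ := hi
    obtain rfl : x = (⇑φH)^[i] ⟨g, hg⟩ := Subtype.ext (hxi.trans (h1 i).symm)
    have := hNg i ((h2 i) ▸ hx)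
    rw [← h2, mem_bot, QuotientGroup.eq_one_iff] at this
    rw [← h1]
    exact this

end SeparatesOrbits

section CommutativeGroups

open Subgroup

/-- Orbits of an endomorphism of a free abelian group of finite rank that do not reach `0` avoid
the multiples of some positive integer. -/
theorem exists_iterate_ne_smul {M : Type*} [AddCommGroup M] [Module.Free ℤ M] [Module.Finite ℤ M]
    (f : M →ₗ[ℤ] M) (g : M) (hg : ∀ i : ℕ, (f ^ i) g ≠ 0) :
    ∃ p : ℕ, p ≠ 0 ∧ ∀ (i : ℕ) (x : M), (f ^ i) g ≠ (p : ℤ) • x := by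
  obtain ⟨q, hq, hqf⟩ := LinearMap.exists_monic_and_aeval_eq_zero ℤ f
  obtain ⟨r, hqr, hr⟩ := Polynomial.exists_eq_pow_rootMultiplicity_mul_and_not_dvd q hq.ne_zero 0
  generalize q.rootMultiplicity 0 = k at hqr
  rw [Polynomial.C_0, sub_zero] at hqr hr
  rw [Polynomial.X_dvd_iff] at hr
  let b := Module.Free.chooseBasis ℤ M
  obtain ⟨c, hc⟩ : ∃ c, b.repr ((f ^ k) g) c ≠ 0 := by
    by_contra! h
    exact hg k ((LinearEquiv.map_eq_zero_iff b.repr).1 (Finsupp.ext h))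
  obtain ⟨p, hp, hprime⟩ := Nat.exists_infinite_primes
    (1 + (r.coeff 0).natAbs + (b.repr ((f ^ k) g) c).natAbs)
  have hdvd : ∀ z : ℤ, z ≠ 0 → z.natAbs < p → ¬ (p : ℤ) ∣ z := fun z hz hlt h =>
    hz (Int.eq_zero_of_dvd_of_natAbs_lt_natAbs h (by simpa using hlt))
  have hk : ∀ x : M, (f ^ k) g ≠ (p : ℤ) • x := fun x hx =>
    hdvd _ hc (by omega) ⟨b.repr x c, by rw [hx]; simp⟩
  obtain ⟨u, v, huv⟩ := (Int.isCoprime_iff_gcd_eq_one.2 <| by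
    have := (Nat.Prime.coprime_iff_not_dvd hprime).2 fun h =>
      hdvd _ hr (by omega) (Int.natCast_dvd.2 h)
    simpa [Int.gcd, Nat.Coprime] using this : IsCoprime (p : ℤ) (r.coeff 0))
  have hstep : ∀ z x : M, f ((f ^ k) z) = (p : ℤ) • x → ∃ y : M, (f ^ k) z = (p : ℤ) • y := by
    intro z x hx
    have hz : Polynomial.aeval f r ((f ^ k) z) = 0 := by
      have := LinearMap.congr_fun hqf z
      rwa [hqr, mul_comm, map_mul, map_pow, Polynomial.aeval_X] at this
    rw [← Polynomial.divX_mul_X_add r, map_add, map_mul, Polynomial.aeval_X, Polynomial.aeval_C,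
      LinearMap.add_apply, Module.End.mul_apply, hx, map_smul, Module.algebraMap_end_apply] at hz
    refine ⟨u • (f ^ k) z - v • Polynomial.aeval f r.divX x, ?_⟩
    generalize (f ^ k) z = w, Polynomial.aeval f r.divX x = y at hz
    calc w = (u * p + v * r.coeff 0) • w := by rw [huv, one_smul]
      _ = (p : ℤ) • u • w + v • r.coeff 0 • w := by module
      _ = (p : ℤ) • u • w + v • -((p : ℤ) • y) := by rw [eq_neg_of_add_eq_zero_right hz]
      _ = (p : ℤ) • (u • w - v • y) := by module
  refine ⟨p, hprime.ne_zero, fun i => ?_⟩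
  rcases le_total i k with hik | hki
  · intro x hx
    obtain ⟨j, rfl⟩ := Nat.exists_eq_add_of_le' hik
    refine hk ((f ^ j) x) ?_
    rw [pow_add, Module.End.mul_apply, hx, map_smul]
  · induction i, hki using Nat.le_induction with
    | base => exact hk
    | succ i hki ih =>
      intro x hx
      obtain ⟨j, rfl⟩ := Nat.exists_eq_add_of_le hki
      rw [pow_add] at ih
      rw [pow_succ', pow_add] at hx
      obtain ⟨y, hy⟩ := hstep _ _ hx
      exact ih y hy

theorem AllSeparateOrbits.of_torsionFree (A : Type*) [CommGroup A] [Group.FG A]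
    [IsMulTorsionFree A] : AllSeparateOrbits A := by
  refine .of_forall fun ψ g hg => ?_
  let f : Additive A →ₗ[ℤ] Additive A := ψ.toAdditive.toIntLinearMap
  have hf : ∀ i : ℕ, (f ^ i) (Additive.ofMul g) = Additive.ofMul ((⇑ψ)^[i] g) := by
    intro i
    induction i with
    | zero => rfl
    | succ i ih =>
      rw [pow_succ', Module.End.mul_apply, ih, Function.iterate_succ_apply']
      rfl
  have : Module.Finite ℤ (Additive A) := Module.Finite.iff_addGroup_fg.2 inferInstance
  have : Module.Free ℤ (Additive A) := inferInstance
  obtain ⟨p, hp, h⟩ := exists_iterate_ne_smul f (Additive.ofMul g) fun i h0 => hg i (by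
    rw [hf] at h0
    exact h0)
  refine ⟨(powMonoidHom p).range, finiteIndex_range_powMonoidHom_of_fg A hp, ?_⟩
  rintro i ⟨x, hx⟩
  refine h i (Additive.ofMul x) ?_
  rw [hf, ← hx]
  simp

theorem SeparatesOrbits.of_allSeparateOrbits_quotient {G : Type*} [Group G] {φ : G →* G}
    {K H : Subgroup G} [(K.subgroupOf H).Normal] (hφK : K.map φ ≤ K) (hφH : H.map φ ≤ H)
    (hS : InducesProfinite K H)
    (hK : ∀ ψ : G →* G, K.map ψ ≤ K → SeparatesOrbits ψ ⊥ K)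
    (h : AllSeparateOrbits (H ⧸ K.subgroupOf H)) : SeparatesOrbits φ ⊥ H :=
  .of_extension hφK hφH hS (hK φ hφK) (hK _ (map_id_le K)) (.of_quotient hφK hφH h)
    (.of_quotient (map_id_le K) (map_id_le H) h)

theorem PolycyclicChain.of_commutator_le_of_fg {G : Type*} [Group G] {K H : Subgroup G}
    (hKH : K ≤ H) [(K.subgroupOf H).Normal] [Group.FG (H ⧸ K.subgroupOf H)] (h : ⁅H, H⁆ ≤ K) :
    PolycyclicChain K H := by
  obtain ⟨S, hS, rfl⟩ := exists_sup_closure_eq hKH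
  exact .of_commutator_le hS h

theorem AllSeparateOrbits.of_commGroup (A : Type*) [CommGroup A] [Group.FG A] :
    AllSeparateOrbits A := by
  intro ψ
  have hcomm : ⁅(⊤ : Subgroup A), (⊤ : Subgroup A)⁆ = ⊥ := by
    simp [commutator_eq_bot_iff_le_centralizer, CommGroup.center_eq_top]
  let T := CommGroup.torsion A
  have hT : T.FG := (PolycyclicChain.of_commutator_le_of_fg bot_le hcomm.le).fg_of_le T le_top
  have : Group.FG T := (Group.fg_iff_subgroup_fg T).2 hT
  have : Finite T := CommGroup.finite_of_fg_isMulTorsion T CommMonoid.torsion.isMulTorsion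
  have e : ((⊤ : Subgroup A) ⧸ T.subgroupOf ⊤) ≃* A ⧸ T :=
    QuotientGroup.congr _ _ Subgroup.topEquiv (map_subtype_subgroupOf le_top)
  refine .of_allSeparateOrbits_quotient (K := T) (CommGroup.map_torsion_le ψ) le_top
    ((PolycyclicChain.of_commutator_le_of_fg le_top (hcomm.trans_le bot_le)
      : PolycyclicChain T ⊤).inducesProfinite hT)
    (fun _ _ _ _ => ⟨(⊥ : Subgroup A), ?_, fun _ h => h⟩)
    (.of_mulEquiv e (.of_torsionFree (A ⧸ T)))
  rw [relIndex_bot_left]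
  exact Nat.card_pos.ne'

end CommutativeGroups

section PolycyclicGroups

open Subgroup

theorem AllSeparateOrbits.of_isPolycyclic {Q : Type*} [Group Q] (hQ : IsPolycyclic Q) :
    AllSeparateOrbits Q := by
  have hchain := PolycyclicChain.of_isPolycyclic hQ
  have key : ∀ (n : ℕ) (J : Subgroup Q), (fun J : Subgroup Q => ⁅J, J⁆)^[n] J = ⊥ →
      ∀ ψ : Q →* Q, J.map ψ ≤ J → SeparatesOrbits ψ ⊥ J := by
    intro n
    induction n with
    | zero =>
      rintro J rfl ψ hψ g hg
      exact ⟨⊤, by simp, fun i _ => iterate_mem hψ hg i⟩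
    | succ n ih =>
      intro J hJ ψ hψ
      have hle : ⁅J, J⁆ ≤ J := commutator_le_self J
      have : (⁅J, J⁆.subgroupOf J).Normal :=
        normal_subgroupOf_of_le_normalizer (normalizer_commutator_ge_left J J)
      have : Group.FG J := (Group.fg_iff_subgroup_fg J).2 (hchain.fg_of_le J le_top)
      let _ : CommGroup (J ⧸ ⁅J, J⁆.subgroupOf J) :=
        { (inferInstance : Group (J ⧸ ⁅J, J⁆.subgroupOf J)) with
          mul_comm := by
            rintro ⟨a⟩ ⟨b⟩
            refine QuotientGroup.eq.2 ?_
            rw [mem_subgroupOf]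
            have := commutator_mem_commutator (inv_mem b.2) (inv_mem a.2)
            simpa [commutatorElement_def, mul_assoc] using this }
      refine .of_allSeparateOrbits_quotient ((map_commutator _ _ _).trans_le
        (commutator_mono hψ hψ)) hψ
        ((PolycyclicChain.of_commutator_le_of_fg hle le_rfl).inducesProfinite
          (hchain.fg_of_le _ le_top)) (ih _ hJ) (.of_commGroup _)
  obtain ⟨n, hn⟩ := hchain.exists_iterate_commutator_eq_bot
  exact fun ψ => key n ⊤ hn ψ le_top

end PolycyclicGroups

section NiceFactors

open Subgroup

theorem NiceFactor.fg_and_inducesProfinite {G : Type*} [Group G] {K H : Subgroup G}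
    (h : NiceFactor K H) (hK : K.FG) : H.FG ∧ InducesProfinite K H := by
  obtain ⟨hKH, hn, hfin | ⟨n, ⟨e⟩⟩ | hpoly⟩ := h
  · exact ⟨hK.of_quotient hKH, .of_relIndex_ne_zero index_ne_zero_of_finite⟩
  · have : Group.FG (H ⧸ K.subgroupOf H) :=
      Group.fg_of_surjective (f := e.symm.toMonoidHom) e.symm.surjective
    exact ⟨hK.of_quotient hKH, .of_free_quotient hK hKH e⟩
  · have := PolycyclicChain.of_isPolycyclic_quotient hKH hpoly
    exact ⟨this.fg hK, this.inducesProfinite hK⟩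

theorem NiceFactor.separatesOrbits {G : Type*} [Group G] {K H : Subgroup G} {φ : G →* G}
    (h : NiceFactor K H) (hφK : K.map φ ≤ K) (hφH : H.map φ ≤ H) : SeparatesOrbits φ K H := by
  obtain ⟨hKH, hn, hfin | ⟨n, ⟨e⟩⟩ | hpoly⟩ := h
  · exact .of_quotient hφK hφH (.of_finite _)
  · exact .of_quotient hφK hφH (.of_mulEquiv e (.freeGroup n))
  · exact .of_quotient hφK hφH (.of_isPolycyclic hpoly)

theorem SeparatesOrbits.propertyP {G : Type*} [Group G] {φ : G →* G}
    (h : SeparatesOrbits φ ⊥ ⊤) : PropertyP φ := by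
  intro g
  obtain ⟨N, hN, hg⟩ := h g (mem_top g)
  rw [relIndex_top_right] at hN
  have : N.FiniteIndex := ⟨hN⟩
  exact ⟨N.normalCore, inferInstance, inferInstance,
    fun i => ⟨fun hi => mem_bot.1 (hg i (normalCore_le N hi)), fun hi => hi ▸ one_mem _⟩⟩

end NiceFactors

/-- If `G` has a normal series `1 = G₀ ⊴ G₁ ⊴ ⋯ ⊴ G_r = G` whose factors are each
finite, free of finite rank, or polycyclic, and `φ : G → G` is a homomorphism with
`φ(Gᵢ) ≤ Gᵢ` for all `i`, then `φ` has property 𝔓. -/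
theorem statement18 {G : Type*} [Group G] (r : ℕ) (Gs : Fin (r + 1) → Subgroup G)
    (h0 : Gs 0 = ⊥) (htop : Gs (Fin.last r) = ⊤)
    (hnorm : ∀ i, (Gs i).Normal)
    (hfac : ∀ i : Fin r, NiceFactor (Gs i.castSucc) (Gs i.succ))
    (φ : G →* G) (hinv : ∀ i, (Gs i).map φ ≤ Gs i) :
    PropertyP φ := by
  have key : ∀ i, (Gs i).FG ∧ ∀ ψ : G →* G, (∀ i, (Gs i).map ψ ≤ Gs i) →
      SeparatesOrbits ψ ⊥ (Gs i) := by
    intro i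
    induction i using Fin.induction with
    | zero =>
      refine ⟨h0 ▸ Subgroup.FG.bot, fun ψ hψ g hg => ⟨⊤, by simp, fun i _ => ?_⟩⟩
      rw [← h0]
      exact iterate_mem (hψ 0) hg i
    | succ i ih =>
      obtain ⟨hfg, hS⟩ := (hfac i).fg_and_inducesProfinite ih.1
      have hid : ∀ i, (Gs i).map (MonoidHom.id G) ≤ Gs i := fun i => map_id_le (Gs i)
      exact ⟨hfg, fun ψ hψ => .of_extension (hψ _) (hψ _) hS (ih.2 ψ hψ) (ih.2 _ hid)
        ((hfac i).separatesOrbits (hψ _) (hψ _)) ((hfac i).separatesOrbits (hid _) (hid _))⟩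
  exact (htop ▸ (key (Fin.last r)).2 φ hinv : SeparatesOrbits φ ⊥ ⊤).propertyP
end

section
/- Let 1 = G₀ ⊴ G₁ ⊴ G₂ ⊴ ⋯ ⊴ G_{r-1} ⊴ G_r = G be a normal series in a group G such that each factor group G_i/G_{i-1} is either finite, free of finite rank, or polycyclic. If φ : G → G is an injective homomorphism such that φ(G_i) ≤ G_i for 1 ≤ i ≤ r, then the ascending HNN extension G_φ is highly residually finite. -/
/-- A group `G` is residually finite if every nontrivial element avoids some
finite-index normal subgroup. -/
def ResiduallyFinite (G : Type*) [Group G] : Prop :=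
  ∀ g : G, g ≠ 1 → ∃ N : Subgroup G, N.Normal ∧ N.FiniteIndex ∧ g ∉ N

/-- A group `Q` is highly residually finite if for every group extension
`1 → F → E → Q → 1` with `F` finite, the group `E` is residually finite. -/
def HighlyResiduallyFinite (Q : Type*) [Group Q] : Prop :=
  ∀ (E F : Type*) [Group E] [Group F], Finite F →
    ∀ (ι : F →* E) (π : E →* Q), Function.Injective ι → Function.Surjective π →
      π.ker = ι.range → ResiduallyFinite E

/-- The ascending HNN extension of `G` with respect to an injective endomorphism `φ`:
the group `⟨G, t | t⁻¹ g t = φ(g) for all g ∈ G⟩`, realized as the HNN extension of `G`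
with associated subgroups `φ.range` and `⊤` (so that `t⁻¹ (of g) t = of (φ g)`). -/
noncomputable abbrev AscendingHNNExtension {G : Type*} [Group G] (φ : G →* G)
    (hφ : Function.Injective φ) : Type _ :=
  HNNExtension G φ.range ⊤ ((MonoidHom.ofInjective hφ).symm.trans Subgroup.topEquiv.symm)

namespace MvPolynomial

variable {ι R : Type*} [CommRing R]

/-- The polynomial `p` is the monic monomial `α` up to terms of smaller total degree. -/
def HasLeadingMonomial (p : MvPolynomial ι R) (α : ι →₀ ℕ) : Prop :=
  p - monomial α 1 ∈ restrictSupport R {m : ι →₀ ℕ | m.degree < α.degree}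

theorem mul_mem_restrictSupport_degree {a b : ℕ} {p q : MvPolynomial ι R}
    (hp : p ∈ restrictSupport R {m : ι →₀ ℕ | m.degree < a})
    (hq : q ∈ restrictSupport R {m : ι →₀ ℕ | m.degree < b + 1}) :
    p * q ∈ restrictSupport R {m : ι →₀ ℕ | m.degree < a + b} := by
  classical
  rw [mem_restrictSupport_iff] at *
  intro m hm
  obtain ⟨x, hx, y, hy, rfl⟩ := Finset.mem_add.1 (support_mul p q hm)
  have h1 : x.degree < a := hp hx
  have h2 : y.degree < b + 1 := hq hy
  simp only [Set.mem_ofPred_eq, map_add]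
  omega

theorem HasLeadingMonomial.mem {p : MvPolynomial ι R} {α : ι →₀ ℕ}
    (hp : p.HasLeadingMonomial α) :
    p ∈ restrictSupport R {m : ι →₀ ℕ | m.degree < α.degree + 1} := by
  have h1 := restrictSupport_mono R (t := {m : ι →₀ ℕ | m.degree < α.degree + 1})
    (fun m (hm : m.degree < α.degree) => Nat.lt_succ_of_lt hm) hp
  have h2 : monomial α (1 : R) ∈ restrictSupport R {m : ι →₀ ℕ | m.degree < α.degree + 1} :=
    (monomial_mem_restrictSupport R).2 (.inl (Nat.lt_succ_self _))
  simpa using add_mem h1 h2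

theorem HasLeadingMonomial.one : (1 : MvPolynomial ι R).HasLeadingMonomial 0 := by
  have : (1 : MvPolynomial ι R) - monomial 0 1 = 0 := by simp
  rw [HasLeadingMonomial, this]
  exact zero_mem _

theorem HasLeadingMonomial.mul {p q : MvPolynomial ι R} {α β : ι →₀ ℕ}
    (hp : p.HasLeadingMonomial α) (hq : q.HasLeadingMonomial β) :
    (p * q).HasLeadingMonomial (α + β) := by
  have e : p * q - monomial (α + β) 1 =
      (p - monomial α 1) * q + (q - monomial β 1) * monomial α 1 := by
    rw [show monomial (α + β) (1 : R) = monomial α 1 * monomial β 1 by simp [monomial_mul]]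
    ring
  have h : monomial α (1 : R) ∈ restrictSupport R {m : ι →₀ ℕ | m.degree < α.degree + 1} :=
    (monomial_mem_restrictSupport R).2 (.inl (Nat.lt_succ_self _))
  rw [HasLeadingMonomial, e, map_add]
  refine add_mem (mul_mem_restrictSupport_degree hp hq.mem) ?_
  rw [add_comm]
  exact mul_mem_restrictSupport_degree hq h

theorem HasLeadingMonomial.pow {p : MvPolynomial ι R} {α : ι →₀ ℕ}
    (hp : p.HasLeadingMonomial α) (n : ℕ) : (p ^ n).HasLeadingMonomial (n • α) := by
  induction n with
  | zero => simpa using HasLeadingMonomial.one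
  | succ n ih => rw [pow_succ, succ_nsmul]; exact ih.mul hp

theorem HasLeadingMonomial.prod {κ : Type*} (s : Finset κ) {p : κ → MvPolynomial ι R}
    {α : κ → ι →₀ ℕ} (h : ∀ i ∈ s, (p i).HasLeadingMonomial (α i)) :
    (∏ i ∈ s, p i).HasLeadingMonomial (∑ i ∈ s, α i) := by
  classical
  induction s using Finset.induction_on with
  | empty => simpa using HasLeadingMonomial.one
  | insert a s ha ih =>
    rw [Finset.prod_insert ha, Finset.sum_insert ha]
    exact (h a (by simp)).mul (ih fun i hi => h i (by simp [hi]))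

theorem HasLeadingMonomial.X (i : ι) :
    (MvPolynomial.X i : MvPolynomial ι R).HasLeadingMonomial (Finsupp.single i 1) := by
  have : (MvPolynomial.X i : MvPolynomial ι R) - monomial (Finsupp.single i 1) 1 = 0 :=
    sub_self _
  rw [HasLeadingMonomial, this]
  exact zero_mem _

theorem HasLeadingMonomial.sub {p q : MvPolynomial ι R} {α : ι →₀ ℕ}
    (hp : p.HasLeadingMonomial α) (hq : q.totalDegree < α.degree) :
    (p - q).HasLeadingMonomial α := by
  have : q ∈ restrictSupport R {m : ι →₀ ℕ | m.degree < α.degree} := by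
    rw [mem_restrictSupport_iff]
    intro m hm
    exact (le_totalDegree hm).trans_lt hq
  rw [HasLeadingMonomial, sub_right_comm]
  exact sub_mem hp this

variable [Fintype ι] (f : ι → MvPolynomial ι R) (Q : ℕ)

/-- The product of powers of the `X i ^ Q - f i` and of the `X i` with leading monomial `γ`,
using as many factors of the first kind as possible. -/
noncomputable def adicMonomial (γ : ι →₀ ℕ) : MvPolynomial ι R :=
  ∏ i, (X i ^ Q - f i) ^ (γ i / Q) * X i ^ (γ i % Q)

/-- The linear endomorphism of the polynomial ring that sends the monomial `γ` to
`adicMonomial f Q γ`. -/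
noncomputable def adicMap : MvPolynomial ι R →ₗ[R] MvPolynomial ι R :=
  (basisMonomials ι R).constr R (adicMonomial f Q)

theorem adicMap_monomial (γ : ι →₀ ℕ) : adicMap f Q (monomial γ 1) = adicMonomial f Q γ := by
  have := (basisMonomials ι R).constr_basis R (adicMonomial f Q) γ
  rwa [coe_basisMonomials] at this

variable {f Q}

theorem hasLeadingMonomial_adicMonomial (hf : ∀ i, (f i).totalDegree < Q) (γ : ι →₀ ℕ) :
    (adicMonomial f Q γ).HasLeadingMonomial γ := by
  classical
  have key : γ = ∑ i, ((γ i / Q) • Q • Finsupp.single i 1 + (γ i % Q) • Finsupp.single i 1) := by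
    ext j
    simp only [Finsupp.finsetSum_apply, Finsupp.add_apply, Finsupp.smul_apply,
      Finsupp.single_apply, smul_eq_mul, mul_ite, mul_one, mul_zero, Finset.sum_add_distrib,
      Finset.sum_ite_eq', Finset.mem_univ, if_true, Nat.div_add_mod']
  conv => arg 2; rw [key]
  refine HasLeadingMonomial.prod _ fun i _ => ?_
  refine HasLeadingMonomial.mul (HasLeadingMonomial.pow ?_ _) ((HasLeadingMonomial.X i).pow _)
  exact ((HasLeadingMonomial.X i).pow Q).sub (by simpa using hf i)

theorem adicMap_surjective (hf : ∀ i, (f i).totalDegree < Q) :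
    Function.Surjective (adicMap f Q) := by
  have key : ∀ d : ℕ, restrictSupport R {m : ι →₀ ℕ | m.degree < d} ≤ (adicMap f Q).range := by
    intro d
    induction d with
    | zero =>
      intro p hp
      rw [mem_restrictSupport_iff] at hp
      have : p.support = ∅ := Finset.eq_empty_of_forall_notMem fun m hm => by simpa using hp hm
      rw [support_eq_empty.1 this]
      exact zero_mem _
    | succ d ih =>
      rw [restrictSupport_eq_span, Submodule.span_le]
      rintro _ ⟨γ, hγ, rfl⟩
      have h1 : adicMonomial f Q γ ∈ (adicMap f Q).range := ⟨_, adicMap_monomial f Q γ⟩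
      have h2 := ih (restrictSupport_mono R (fun m (hm : m.degree < γ.degree) =>
        hm.trans_le (Nat.lt_succ_iff.1 hγ)) (hasLeadingMonomial_adicMonomial hf γ))
      simpa using sub_mem h1 h2
  intro p
  refine key (p.totalDegree + 1) ?_
  rw [mem_restrictSupport_iff]
  exact fun m hm => Nat.lt_succ_of_le (le_totalDegree hm)

theorem adicMap_eq_sum (h : MvPolynomial ι R) :
    adicMap f Q h = ∑ γ ∈ h.support, coeff γ h • adicMonomial f Q γ := by
  conv_lhs => rw [h.as_sum]
  rw [map_sum]
  refine Finset.sum_congr rfl fun γ _ => ?_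
  rw [← adicMap_monomial, ← map_smul, smul_monomial, smul_eq_mul, mul_one]

theorem coeff_adicMap (hf : ∀ i, (f i).totalDegree < Q) {h : MvPolynomial ι R} {γ : ι →₀ ℕ}
    (hmax : ∀ δ ∈ h.support, δ.degree ≤ γ.degree) :
    coeff γ (adicMap f Q h) = coeff γ h := by
  classical
  have hc : ∀ δ ∈ h.support, coeff γ (adicMonomial f Q δ) = if γ = δ then 1 else 0 := by
    intro δ hδ
    have h1 := hasLeadingMonomial_adicMonomial hf δ
    have h2 : coeff γ (adicMonomial f Q δ - monomial δ 1) = 0 := by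
      by_contra hne
      have : γ.degree < δ.degree := h1 (mem_support_iff.2 hne)
      exact absurd (hmax δ hδ) (by omega)
    rw [coeff_sub, sub_eq_zero, coeff_monomial] at h2
    rw [h2]
    simp only [eq_comm]
  rw [adicMap_eq_sum, coeff_sum]
  have : ∀ δ ∈ h.support, coeff γ (coeff δ h • adicMonomial f Q δ) =
      if γ = δ then coeff δ h else 0 := by
    intro δ hδ
    rw [coeff_smul, hc δ hδ]
    simp
  rw [Finset.sum_congr rfl this, Finset.sum_ite_eq]
  split_ifs with hmem
  · rfl
  · exact (notMem_support_iff.1 hmem).symm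

variable (f Q) in
/-- The ideal of the polynomial ring generated by the `X i ^ Q - f i`. -/
noncomputable def quasiFixedIdeal : Ideal (MvPolynomial ι R) :=
  Ideal.span (Set.range fun i => X i ^ Q - f i)

theorem adicMonomial_add (hQ : 0 < Q) (i : ι) (γ : ι →₀ ℕ) :
    adicMonomial f Q (γ + Finsupp.single i Q) = (X i ^ Q - f i) * adicMonomial f Q γ := by
  classical
  rw [adicMonomial, adicMonomial, ← Finset.mul_prod_erase _ _ (Finset.mem_univ i),
    ← Finset.mul_prod_erase (a := i) _ (fun i => _ ^ (γ i / Q) * _) (Finset.mem_univ i)]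
  have : ∀ j ∈ Finset.univ.erase i,
      (X j ^ Q - f j) ^ ((γ + Finsupp.single i Q) j / Q) * X j ^ ((γ + Finsupp.single i Q) j % Q) =
      (X j ^ Q - f j) ^ (γ j / Q) * X j ^ (γ j % Q) := by
    intro j hj
    have : j ≠ i := Finset.ne_of_mem_erase hj
    simp [this.symm]
  rw [Finset.prod_congr rfl this]
  simp only [Finsupp.add_apply, Finsupp.single_eq_same, Nat.add_div_right _ hQ, Nat.add_mod_right]
  ring

theorem mem_map_adicMap (hf : ∀ i, (f i).totalDegree < Q) {g : MvPolynomial ι R}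
    (hg : g ∈ quasiFixedIdeal f Q) :
    g ∈ (restrictSupport R {m : ι →₀ ℕ | Q ≤ m.degree}).map (adicMap f Q) := by
  obtain ⟨c, rfl⟩ := Ideal.mem_span_range_iff_exists_fun.1 hg
  refine Submodule.sum_mem _ fun i _ => ?_
  obtain ⟨h, hh⟩ := adicMap_surjective hf (c i)
  have hQ : 0 < Q := (Nat.zero_le _).trans_lt (hf i)
  refine ⟨∑ γ ∈ h.support, coeff γ h • monomial (γ + Finsupp.single i Q) 1, ?_, ?_⟩
  · refine Submodule.sum_mem _ fun γ _ => Submodule.smul_mem _ _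
      ((monomial_mem_restrictSupport R).2 (.inl ?_))
    simp
  · rw [map_sum, ← hh, adicMap_eq_sum, Finset.sum_mul]
    refine Finset.sum_congr rfl fun γ _ => ?_
    rw [map_smul, adicMap_monomial, adicMonomial_add hQ, smul_mul_assoc, mul_comm]

theorem eq_zero_of_mem_quasiFixedIdeal (hf : ∀ i, (f i).totalDegree < Q) {g : MvPolynomial ι R}
    (hg : g ∈ quasiFixedIdeal f Q) (hdeg : g.totalDegree < Q) : g = 0 := by
  obtain ⟨h, hh, rfl⟩ := mem_map_adicMap hf hg
  by_contra hne
  have h0 : h.support.Nonempty := by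
    rw [Finset.nonempty_iff_ne_empty, Ne, support_eq_empty]
    rintro rfl
    exact hne (map_zero _)
  obtain ⟨γ, hγ, hmax⟩ := h.support.exists_max_image (fun m => m.degree) h0
  have hc : γ ∈ (adicMap f Q h).support := by
    rw [mem_support_iff, coeff_adicMap hf hmax]
    exact mem_support_iff.1 hγ
  have h1 : Q ≤ γ.degree := hh hγ
  have h2 : γ.degree ≤ _ := le_totalDegree hc
  omega

theorem span_mk_monomial_eq_top (hQ : 0 < Q) (hf : ∀ i, (f i).totalDegree < Q) :
    Submodule.span R (Set.range fun a : ι → Fin Q =>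
      Ideal.Quotient.mk (quasiFixedIdeal f Q) (∏ i, X i ^ (a i : ℕ))) = ⊤ := by
  classical
  rw [eq_top_iff]
  rintro x -
  obtain ⟨g, rfl⟩ := Ideal.Quotient.mk_surjective x
  obtain ⟨h, rfl⟩ := adicMap_surjective hf g
  rw [adicMap_eq_sum, map_sum]
  refine Submodule.sum_mem _ fun γ _ => ?_
  have hs : Ideal.Quotient.mk (quasiFixedIdeal f Q) (coeff γ h • adicMonomial f Q γ) =
      coeff γ h • Ideal.Quotient.mk (quasiFixedIdeal f Q) (adicMonomial f Q γ) := rfl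
  rw [hs]
  refine Submodule.smul_mem _ _ ?_
  by_cases hγ : ∀ i, γ i < Q
  · refine Submodule.subset_span ⟨fun i => ⟨γ i, hγ i⟩, ?_⟩
    simp [adicMonomial, Nat.div_eq_of_lt (hγ _), Nat.mod_eq_of_lt (hγ _)]
  · push Not at hγ
    obtain ⟨i, hi⟩ := hγ
    have : γ = (γ - Finsupp.single i Q) + Finsupp.single i Q :=
      (tsub_add_cancel_of_le (Finsupp.single_le_iff.2 hi)).symm
    have hmem : X i ^ Q - f i ∈ quasiFixedIdeal f Q := Ideal.subset_span ⟨i, rfl⟩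
    rw [this, adicMonomial_add hQ, map_mul, Ideal.Quotient.eq_zero_iff_mem.2 hmem, zero_mul]
    exact zero_mem _

end MvPolynomial

open MvPolynomial in
/-- A pointwise form of the Borisov–Sapir theorem on quasi-fixed points: if `D` does not vanish
identically after composing `card ι` times with the polynomial map `σ`, then `D` is nonzero at
some point over a finite field at which `σ` agrees with a power of Frobenius. -/
theorem exists_quasiFixed_point {ι : Type*} [Fintype ι] (p : ℕ) [Fact p.Prime]
    (σ : MvPolynomial ι (ZMod p) →ₐ[ZMod p] MvPolynomial ι (ZMod p))
    (D : MvPolynomial ι (ZMod p)) (hD : σ^[Fintype.card ι] D ≠ 0) :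
    ∃ (M : Ideal (MvPolynomial ι (ZMod p))) (Q : ℕ), M.IsMaximal ∧
      Finite (MvPolynomial ι (ZMod p) ⧸ M) ∧ D ∉ M ∧
      ∀ h, Ideal.Quotient.mk M (σ h) = Ideal.Quotient.mk M h ^ Q := by
  classical
  set f : ι → MvPolynomial ι (ZMod p) := fun i => σ (X i) with hfdef
  obtain ⟨m, hm⟩ : ∃ m : ℕ, (∑ i, (f i).totalDegree) + (σ^[Fintype.card ι] D).totalDegree < p ^ m :=
    ⟨_, Nat.lt_pow_self (Fact.out : p.Prime).one_lt⟩
  set Q := p ^ m with hQdef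
  have hQ : 0 < Q := by omega
  have hf : ∀ i, (f i).totalDegree < Q := fun i => by
    have := Finset.single_le_sum (f := fun i => (f i).totalDegree) (fun _ _ => Nat.zero_le _)
      (Finset.mem_univ i)
    omega
  set I := quasiFixedIdeal f Q with hI
  have hfrob : ∀ h, Ideal.Quotient.mk I (σ h) = Ideal.Quotient.mk I h ^ Q := by
    have hchar : CharP (MvPolynomial ι (ZMod p)) p := inferInstance
    intro h
    have e1 : (Ideal.Quotient.mk I).comp (σ : MvPolynomial ι (ZMod p) →+* _) =
        (Ideal.Quotient.mk I).comp (iterateFrobenius (MvPolynomial ι (ZMod p)) p m) := by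
      refine MvPolynomial.ringHom_ext (fun c => ?_) fun i => ?_
      · simp only [RingHom.comp_apply, RingHom.coe_coe, iterateFrobenius_def]
        rw [← map_pow, ← iterateFrobenius_def (R := ZMod p)]
        have : iterateFrobenius (ZMod p) p m c = c := by
          rw [iterateFrobenius_def]; exact ZMod.pow_card_pow c
        rw [this]
        congr 1
        exact σ.commutes c
      · simp only [RingHom.comp_apply, RingHom.coe_coe, iterateFrobenius_def]
        refine (Ideal.Quotient.eq.2 ?_).symm
        exact Ideal.subset_span ⟨i, rfl⟩
    have := RingHom.congr_fun e1 h
    simpa [iterateFrobenius_def] using this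
  have hiter : ∀ n, Ideal.Quotient.mk I (σ^[n] D) = Ideal.Quotient.mk I D ^ Q ^ n := by
    intro n
    induction n with
    | zero => simp
    | succ n ih => rw [Function.iterate_succ_apply', hfrob, ih, ← pow_mul, pow_succ]
  have hspan := span_mk_monomial_eq_top (R := ZMod p) hQ hf
  have hfin : Module.Finite (ZMod p) (MvPolynomial ι (ZMod p) ⧸ I) :=
    ⟨Submodule.fg_def.2 ⟨_, Set.finite_range (fun a : ι → Fin Q =>
      Ideal.Quotient.mk (quasiFixedIdeal f Q) (∏ i, X i ^ (a i : ℕ))), hspan⟩⟩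
  have hrank : Module.finrank (ZMod p) (MvPolynomial ι (ZMod p) ⧸ I) ≤ Q ^ Fintype.card ι := by
    have := finrank_range_le_card (R := ZMod p) (fun a : ι → Fin Q =>
      Ideal.Quotient.mk (quasiFixedIdeal f Q) (∏ i, X i ^ (a i : ℕ)))
    rw [Set.finrank, hspan, finrank_top] at this
    simpa using this
  have hnil : ¬ IsNilpotent (Ideal.Quotient.mk I D) := by
    rintro ⟨n, hn⟩
    have h1 := Module.End.ker_pow_le_ker_pow_finrank
      (LinearMap.mulLeft (ZMod p) (Ideal.Quotient.mk I D)) n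
    have h2 : Ideal.Quotient.mk I D ^ Module.finrank (ZMod p) (MvPolynomial ι (ZMod p) ⧸ I) = 0 := by
      have := @h1 1 (by simp [LinearMap.pow_mulLeft, hn])
      simpa [LinearMap.mem_ker, LinearMap.pow_mulLeft] using this
    have h3 := hiter (Fintype.card ι)
    rw [pow_eq_zero_of_le hrank h2, Ideal.Quotient.eq_zero_iff_mem] at h3
    exact hD (eq_zero_of_mem_quasiFixedIdeal hf h3 (by omega))
  rw [nilpotent_iff_mem_prime] at hnil
  push Not at hnil
  obtain ⟨J, hJ, hDJ⟩ := hnil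
  have hfinA : Finite (MvPolynomial ι (ZMod p) ⧸ I) := Module.finite_of_finite (ZMod p)
  refine ⟨J.comap (Ideal.Quotient.mk I), Q, ?_, ?_, hDJ, ?_⟩
  · have : J.IsMaximal := IsArtinianRing.isMaximal_of_isPrime J
    exact Ideal.comap_isMaximal_of_surjective _ Ideal.Quotient.mk_surjective
  · refine Finite.of_surjective (α := MvPolynomial ι (ZMod p) ⧸ I)
      (Ideal.Quotient.lift I (Ideal.Quotient.mk (J.comap (Ideal.Quotient.mk I))) ?_) ?_
    · intro a ha
      rw [Ideal.Quotient.eq_zero_iff_mem, Ideal.mem_comap, Ideal.Quotient.eq_zero_iff_mem.2 ha]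
      exact zero_mem _
    · exact Ideal.Quotient.lift_surjective_of_surjective _ _ Ideal.Quotient.mk_surjective
  · intro h
    rw [← map_pow, Ideal.Quotient.eq, Ideal.mem_comap, map_sub, hfrob, map_pow, sub_self]
    exact zero_mem _

/-- Every element with no trivial `φ`-iterate has infinitely many iterates outside some
finite-index normal subgroup. -/
def SeparatesIterates {G : Type*} [Group G] (φ : G →* G) : Prop :=
  ∀ w : G, (∀ n, φ^[n] w ≠ 1) →
    ∃ N : Subgroup G, N.Normal ∧ N.FiniteIndex ∧ ∀ m, ∃ n ≥ m, φ^[n] w ∉ N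

namespace FreeGroup

open Matrix

variable {α R S : Type*} [CommRing R] [CommRing S]

/-- The matrix of a letter: generators go to the given `2 × 2` matrices, their inverses to the
adjugates. -/
def letterMatrix (A : α → Matrix (Fin 2) (Fin 2) R) (x : α × Bool) : Matrix (Fin 2) (Fin 2) R :=
  bif x.2 then A x.1 else (A x.1).adjugate

/-- The product of the matrices of the letters of a word. -/
def wordMatrix (A : α → Matrix (Fin 2) (Fin 2) R) (L : List (α × Bool)) :
    Matrix (Fin 2) (Fin 2) R :=
  (L.map (letterMatrix A)).prod

@[simp] theorem wordMatrix_nil (A : α → Matrix (Fin 2) (Fin 2) R) : wordMatrix A [] = 1 := rfl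

@[simp] theorem wordMatrix_cons (A : α → Matrix (Fin 2) (Fin 2) R) (x : α × Bool)
    (L : List (α × Bool)) : wordMatrix A (x :: L) = letterMatrix A x * wordMatrix A L := by
  simp [wordMatrix]

@[simp] theorem wordMatrix_append (A : α → Matrix (Fin 2) (Fin 2) R) (L L' : List (α × Bool)) :
    wordMatrix A (L ++ L') = wordMatrix A L * wordMatrix A L' := by
  simp [wordMatrix]

theorem adjugate_adjugate_two (M : Matrix (Fin 2) (Fin 2) R) : M.adjugate.adjugate = M := by
  rw [adjugate_fin_two, adjugate_fin_two]
  ext i j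
  fin_cases i <;> fin_cases j <;> simp

theorem wordMatrix_invRev (A : α → Matrix (Fin 2) (Fin 2) R) (L : List (α × Bool)) :
    wordMatrix A (invRev L) = (wordMatrix A L).adjugate := by
  induction L with
  | nil => simp
  | cons x L ih =>
    have h : invRev (x :: L) = invRev L ++ [(x.1, !x.2)] := by simp [invRev]
    rw [h, wordMatrix_append, wordMatrix_cons A x L, adjugate_mul_distrib, ih]
    congr 1
    rcases x with ⟨a, _ | _⟩ <;> simp [letterMatrix, adjugate_adjugate_two]

theorem mapMatrix_wordMatrix (f : R →+* S) (A : α → Matrix (Fin 2) (Fin 2) R)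
    (L : List (α × Bool)) :
    f.mapMatrix (wordMatrix A L) = wordMatrix (fun a => f.mapMatrix (A a)) L := by
  induction L with
  | nil => simp
  | cons x L ih =>
    rw [wordMatrix_cons, wordMatrix_cons, _root_.map_mul, ih]
    congr 1
    rcases x with ⟨a, _ | _⟩
    · exact RingHom.map_adjugate f (A a)
    · rfl

/-- The substitution on words induced by an endomorphism of the free group. -/
def substWord [DecidableEq α] (φ : FreeGroup α →* FreeGroup α) (L : List (α × Bool)) :
    List (α × Bool) :=
  L.flatMap fun x => bif x.2 then (φ (of x.1)).toWord else invRev (φ (of x.1)).toWord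

theorem mk_substWord [DecidableEq α] (φ : FreeGroup α →* FreeGroup α) (L : List (α × Bool)) :
    mk (substWord φ L) = φ (mk L) := by
  induction L with
  | nil => simp [substWord, ← one_eq_mk]
  | cons x L ih =>
    have h1 : substWord φ (x :: L) =
      (bif x.2 then (φ (of x.1)).toWord else invRev (φ (of x.1)).toWord) ++ substWord φ L := rfl
    have h2 : (mk (x :: L) : FreeGroup α) = mk [x] * mk L := by simp [mul_mk]
    rw [h1, ← mul_mk, ih, h2, _root_.map_mul]
    congr 1
    rcases x with ⟨a, _ | _⟩
    · have : (mk [(a, false)] : FreeGroup α) = (of a)⁻¹ := rfl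
      rw [this, _root_.map_inv, cond_false, ← inv_mk, mk_toWord]
    · exact mk_toWord

theorem wordMatrix_substWord [DecidableEq α] (φ : FreeGroup α →* FreeGroup α)
    (A : α → Matrix (Fin 2) (Fin 2) R) (L : List (α × Bool)) :
    wordMatrix A (substWord φ L) = wordMatrix (fun a => wordMatrix A (φ (of a)).toWord) L := by
  induction L with
  | nil => simp [substWord]
  | cons x L ih =>
    have h1 : substWord φ (x :: L) =
      (bif x.2 then (φ (of x.1)).toWord else invRev (φ (of x.1)).toWord) ++ substWord φ L := rfl
    rw [h1, wordMatrix_append, wordMatrix_cons, ih]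
    rcases x with ⟨a, _ | _⟩ <;> simp [letterMatrix, wordMatrix_invRev]

theorem det_wordMatrix_ne_zero [IsDomain R] {A : α → Matrix (Fin 2) (Fin 2) R}
    (hA : ∀ a, (A a).det ≠ 0) (L : List (α × Bool)) : (wordMatrix A L).det ≠ 0 := by
  induction L with
  | nil => simp
  | cons x L ih =>
    rw [wordMatrix_cons, det_mul]
    refine mul_ne_zero ?_ ih
    rcases x with ⟨a, _ | _⟩ <;> simp [letterMatrix, det_adjugate, hA]

theorem exists_wordMatrix_eq_smul_of_red [IsDomain R] {A : α → Matrix (Fin 2) (Fin 2) R}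
    (hA : ∀ a, (A a).det ≠ 0) {L L' : List (α × Bool)} (h : Red L L') :
    ∃ c : R, c ≠ 0 ∧ wordMatrix A L = c • wordMatrix A L' := by
  induction h with
  | refl => exact ⟨1, one_ne_zero, by simp⟩
  | tail _ hs ih =>
    obtain ⟨c, hc, h⟩ := ih
    cases hs with
    | @not L₁ L₂ a b =>
      refine ⟨c * (A a).det, mul_ne_zero hc (hA a), ?_⟩
      rw [h, mul_smul]
      congr 1
      rcases b with _ | _ <;>
        simp [letterMatrix, ← mul_assoc (adjugate _), ← mul_assoc (A a), mul_adjugate,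
          adjugate_mul]

/-- The three linear forms on `2 × 2` matrices that cut out the scalar matrices. -/
def scalarDefect (t : Fin 3) (M : Matrix (Fin 2) (Fin 2) R) : R :=
  ![M 0 1, M 1 0, M 0 0 - M 1 1] t

theorem scalarDefect_smul (t : Fin 3) (c : R) (M : Matrix (Fin 2) (Fin 2) R) :
    scalarDefect t (c • M) = c * scalarDefect t M := by
  fin_cases t <;> simp [scalarDefect, mul_sub]

theorem scalarDefect_one (t : Fin 3) : scalarDefect t (1 : Matrix (Fin 2) (Fin 2) R) = 0 := by
  fin_cases t <;> simp [scalarDefect]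

theorem scalarDefect_mapMatrix (f : R →+* S) (t : Fin 3) (M : Matrix (Fin 2) (Fin 2) R) :
    scalarDefect t (f.mapMatrix M) = f (scalarDefect t M) := by
  fin_cases t <;> simp [scalarDefect]

theorem exists_scalarDefect_ne_zero [IsDomain R] {M : Matrix (Fin 2) (Fin 2) R} (hM : M ≠ 0)
    (hdet : M.det = 0) : ∃ t, scalarDefect t M ≠ 0 := by
  by_contra! h
  have h0 : M 0 1 = 0 := h 0
  have h1 : M 1 0 = 0 := h 1
  have h2 : M 0 0 = M 1 1 := sub_eq_zero.1 (h 2)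
  rw [det_fin_two, h0, zero_mul, sub_zero, h2, mul_self_eq_zero] at hdet
  apply hM
  ext i j
  fin_cases i <;> fin_cases j <;> simp [h0, h1, h2, hdet]

/-- A vector spanning the range of the rank one matrix attached to a letter. -/
def letterVec (c : α → R) (x : α × Bool) : Fin 2 → R :=
  bif x.2 then ![1, c x.1] else ![-c x.1, 1]

theorem letterMatrix_vecMulVec (c : α → R) (x : α × Bool) :
    letterMatrix (fun a => vecMulVec ![1, c a] ![1, c a]) x =
      vecMulVec (letterVec c x) (letterVec c x) := by
  rcases x with ⟨a, _ | _⟩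
  · simp only [letterMatrix, letterVec, cond_false, adjugate_fin_two]
    ext i j
    fin_cases i <;> fin_cases j <;> simp [vecMulVec]
  · rfl

theorem wordMatrix_vecMulVec_eq [IsDomain R] {c : α → R} (hc : Function.Injective c)
    (hc' : ∀ a b, 1 + c a * c b ≠ 0) {x : α × Bool} {L : List (α × Bool)}
    (h : IsReduced (x :: L)) :
    ∃ v ≠ 0, wordMatrix (fun a => vecMulVec ![1, c a] ![1, c a]) (x :: L) =
      vecMulVec (letterVec c x) v := by
  have hne : ∀ x, letterVec c x ≠ 0 := by
    rintro ⟨a, _ | _⟩ h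
    · simpa [letterVec] using congr_fun h 1
    · simpa [letterVec] using congr_fun h 0
  induction L generalizing x with
  | nil => exact ⟨letterVec c x, hne x, by
    rw [wordMatrix_cons, letterMatrix_vecMulVec, wordMatrix_nil, mul_one]⟩
  | cons y L ih =>
    rw [isReduced_cons_cons] at h
    obtain ⟨v, hv, hvL⟩ := ih h.2
    refine ⟨(letterVec c x ⬝ᵥ letterVec c y) • v, smul_ne_zero ?_ hv, ?_⟩
    · have h1 := h.1
      rcases x with ⟨a, _ | _⟩ <;> rcases y with ⟨b, _ | _⟩
      · have := hc' a b
        simpa [letterVec, add_comm] using this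
      · have : a ≠ b := fun h => by simpa using h1 h
        have : c a ≠ c b := fun h => this (hc h)
        simpa [letterVec, neg_add_eq_zero] using this
      · have : a ≠ b := fun h => by simpa using h1 h
        have : c a ≠ c b := fun h => this (hc h)
        simpa [letterVec, neg_add_eq_zero] using this.symm
      · simpa [letterVec] using hc' a b
    · rw [wordMatrix_cons, hvL, letterMatrix_vecMulVec, vecMulVec_mul_vecMulVec]

theorem exists_scalarDefect_vecMulVec_ne_zero [IsDomain R] {c : α → R}
    (hc : Function.Injective c) (hc' : ∀ a b, 1 + c a * c b ≠ 0) {L : List (α × Bool)}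
    (h : IsReduced L) (hL : L ≠ []) :
    ∃ t, scalarDefect t (wordMatrix (fun a => vecMulVec ![1, c a] ![1, c a]) L) ≠ 0 := by
  cases L with
  | nil => exact absurd rfl hL
  | cons x L =>
    obtain ⟨v, hv, hvL⟩ := wordMatrix_vecMulVec_eq hc hc' h
    rw [hvL]
    refine exists_scalarDefect_ne_zero (fun h0 => hv ?_) (by simp [det_fin_two, vecMulVec]; ring)
    ext j
    rcases x with ⟨a, _ | _⟩
    · simpa [vecMulVec, letterVec] using congr_fun (congr_fun h0 1) j
    · simpa [vecMulVec, letterVec] using congr_fun (congr_fun h0 0) j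

/-- The `2 × 2` matrices whose entries are independent variables. -/
noncomputable def genericMatrix (R : Type*) [CommRing R] (a : α) :
    Matrix (Fin 2) (Fin 2) (MvPolynomial (α × Fin 2 × Fin 2) R) :=
  .of fun i j => MvPolynomial.X (a, i, j)

theorem mapMatrix_genericMatrix {T : Type*} [CommRing T] [Algebra R T]
    (A : α → Matrix (Fin 2) (Fin 2) T) (a : α) :
    ((MvPolynomial.aeval fun x : α × Fin 2 × Fin 2 => A x.1 x.2.1 x.2.2 :
      MvPolynomial (α × Fin 2 × Fin 2) R →ₐ[R] T) : _ →+* T).mapMatrix (genericMatrix R a) =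
      A a := by
  ext i j
  simp [genericMatrix]

theorem det_genericMatrix_ne_zero [Nontrivial R] (a : α) : (genericMatrix R a).det ≠ 0 := by
  intro h
  have := congr_arg (MvPolynomial.aeval fun x : α × Fin 2 × Fin 2 =>
    (1 : Matrix (Fin 2) (Fin 2) R) x.2.1 x.2.2 : MvPolynomial (α × Fin 2 × Fin 2) R →ₐ[R] R) h
  simp [det_fin_two, genericMatrix] at this

theorem exists_scalarDefect_genericMatrix_ne_zero [IsDomain R] {n : ℕ}
    {L : List (Fin n × Bool)} (hL : (mk L : FreeGroup (Fin n)) ≠ 1) :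
    ∃ t, scalarDefect t (wordMatrix (genericMatrix R) L) ≠ 0 := by
  obtain ⟨c, hc, h⟩ := exists_wordMatrix_eq_smul_of_red
    (fun a => det_genericMatrix_ne_zero (R := R) a) (reduce.red (L := L))
  have hred : IsReduced (reduce L) := by
    rw [isReduced_iff_reduce_eq, reduce.idem]
  have hne : reduce L ≠ [] := by
    intro h0
    exact hL (by rw [← reduce.self (L := L), h0, one_eq_mk])
  set d : Fin n → Polynomial R := fun a => Polynomial.X ^ ((a : ℕ) + 1) with hd
  obtain ⟨t, ht⟩ := exists_scalarDefect_vecMulVec_ne_zero (c := d)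
    (fun a b hab => Fin.ext (by simpa [hd] using congr_arg Polynomial.natDegree hab))
    (fun a b h => by
      have := congr_arg (Polynomial.coeff · 0) h
      simp [hd] at this) hred hne
  refine ⟨t, ?_⟩
  rw [h, scalarDefect_smul]
  refine mul_ne_zero hc fun h0 => ht ?_
  have := mapMatrix_wordMatrix ((MvPolynomial.aeval fun x : Fin n × Fin 2 × Fin 2 =>
    (vecMulVec ![1, d x.1] ![1, d x.1]) x.2.1 x.2.2 :
      MvPolynomial (Fin n × Fin 2 × Fin 2) R →ₐ[R] Polynomial R) : _ →+* Polynomial R)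
    (genericMatrix R) (reduce L)
  simp only [mapMatrix_genericMatrix (fun a => vecMulVec ![1, d a] ![1, d a])] at this
  rw [← this, scalarDefect_mapMatrix, h0, map_zero]

theorem exists_wordMatrix_eq_smul_lift {A : α → Matrix (Fin 2) (Fin 2) R}
    {u : α → (Matrix (Fin 2) (Fin 2) R)ˣ} (hu : ∀ a, (u a : Matrix (Fin 2) (Fin 2) R) = A a)
    (L : List (α × Bool)) :
    ∃ c : R, wordMatrix A L = c • (lift u (mk L) : Matrix (Fin 2) (Fin 2) R) := by
  induction L with
  | nil => exact ⟨1, by simp [← one_eq_mk]⟩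
  | cons x L ih =>
    obtain ⟨c, hc⟩ := ih
    have h2 : (mk (x :: L) : FreeGroup α) = mk [x] * mk L := by simp [mul_mk]
    obtain ⟨d, hd⟩ : ∃ d : R, letterMatrix A x =
        d • (lift u (mk [x]) : Matrix (Fin 2) (Fin 2) R) := by
      rcases x with ⟨a, _ | _⟩
      · refine ⟨(A a).det, ?_⟩
        have : (mk [(a, false)] : FreeGroup α) = (of a)⁻¹ := rfl
        rw [this, _root_.map_inv, lift_apply_of]
        calc (A a).adjugate = (A a).adjugate * (u a * (u a)⁻¹ : (Matrix (Fin 2) (Fin 2) R)ˣ) := by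
              simp
          _ = (A a).det • ((u a)⁻¹ : (Matrix (Fin 2) (Fin 2) R)ˣ) := by
              rw [Units.val_mul, hu, ← mul_assoc, adjugate_mul, smul_mul_assoc, one_mul]
      · refine ⟨1, ?_⟩
        have : (mk [(a, true)] : FreeGroup α) = of a := rfl
        rw [this, lift_apply_of, hu, one_smul]
        rfl
    refine ⟨d * c, ?_⟩
    rw [wordMatrix_cons, hc, hd, h2, _root_.map_mul, Units.val_mul, smul_mul_smul_comm]

theorem separatesIterates {n : ℕ} (φ : FreeGroup (Fin n) →* FreeGroup (Fin n)) :
    SeparatesIterates φ := by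
  intro w hw
  set X := genericMatrix (α := Fin n) (ZMod 2) with hX
  set σ : MvPolynomial (Fin n × Fin 2 × Fin 2) (ZMod 2) →ₐ[ZMod 2] _ :=
    MvPolynomial.aeval fun x : Fin n × Fin 2 × Fin 2 =>
      (wordMatrix X (φ (of x.1)).toWord) x.2.1 x.2.2 with hσ
  have hstep : ∀ L, (σ : _ →+* _).mapMatrix (wordMatrix X L) = wordMatrix X (substWord φ L) := by
    intro L
    rw [mapMatrix_wordMatrix, wordMatrix_substWord]
    congr 1
    funext a
    exact mapMatrix_genericMatrix (fun a => wordMatrix X (φ (of a)).toWord) a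
  have hdefect : ∀ m t L, σ^[m] (scalarDefect t (wordMatrix X L)) =
      scalarDefect t (wordMatrix X ((substWord φ)^[m] L)) := by
    intro m t
    induction m with
    | zero => intro L; rfl
    | succ m ih =>
      intro L
      rw [Function.iterate_succ_apply, Function.iterate_succ_apply, ← ih, ← hstep,
        scalarDefect_mapMatrix]
      rfl
  have hdet : ∀ m L, σ^[m] (wordMatrix X L).det = (wordMatrix X ((substWord φ)^[m] L)).det := by
    intro m
    induction m with
    | zero => intro L; rfl
    | succ m ih =>
      intro L
      rw [Function.iterate_succ_apply, Function.iterate_succ_apply, ← ih, ← hstep,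
        ← RingHom.map_det]
      rfl
  have hmk : ∀ m L, (mk ((substWord φ)^[m] L) : FreeGroup (Fin n)) = φ^[m] (mk L) := by
    intro m
    induction m with
    | zero => intro L; rfl
    | succ m ih =>
      intro L
      rw [Function.iterate_succ_apply, Function.iterate_succ_apply, ih, mk_substWord]
  set N := Fintype.card (Fin n × Fin 2 × Fin 2)
  obtain ⟨t, ht⟩ := exists_scalarDefect_genericMatrix_ne_zero (R := ZMod 2)
    (L := (substWord φ)^[N] w.toWord) (by rw [hmk, mk_toWord]; exact hw N)
  set D := (∏ a, (wordMatrix X [(a, true)]).det) * scalarDefect t (wordMatrix X w.toWord) with hD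
  have hD0 : σ^[N] D ≠ 0 := by
    rw [hD, ← AlgHom.coe_pow, _root_.map_mul, map_prod, AlgHom.coe_pow, hdefect]
    refine mul_ne_zero (Finset.prod_ne_zero_iff.2 fun a _ => ?_) ht
    rw [hdet]
    exact det_wordMatrix_ne_zero det_genericMatrix_ne_zero _
  obtain ⟨M, Q, hM, hfin, hDM, hfrob⟩ := exists_quasiFixed_point 2 σ D hD0
  set e := Ideal.Quotient.mk M with he
  have hiter : ∀ m h, e (σ^[m] h) = e h ^ Q ^ m := by
    intro m h
    induction m with
    | zero => simp
    | succ m ih => rw [Function.iterate_succ_apply', hfrob, ih, ← pow_mul, pow_succ]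
  have hDM' : e D ≠ 0 := fun h => hDM (Ideal.Quotient.eq_zero_iff_mem.1 h)
  rw [hD, _root_.map_mul, map_prod] at hDM'
  have hunit : ∀ a, IsUnit (e.mapMatrix (X a)) := by
    intro a
    rw [isUnit_iff_isUnit_det, ← RingHom.map_det]
    let := Ideal.Quotient.field M
    refine IsUnit.mk0 _ ?_
    have := Finset.prod_ne_zero_iff.1 (left_ne_zero_of_mul hDM') a (Finset.mem_univ a)
    simpa [letterMatrix] using this
  choose u hu using hunit
  refine ⟨(lift u).ker, inferInstance, inferInstance, fun m => ⟨m, le_rfl, fun hmem => ?_⟩⟩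
  obtain ⟨c, hc⟩ := exists_wordMatrix_eq_smul_lift hu ((substWord φ)^[m] w.toWord)
  rw [hmk, mk_toWord, MonoidHom.mem_ker.1 hmem, ← mapMatrix_wordMatrix] at hc
  have h0 := congr_arg (scalarDefect t) hc
  rw [scalarDefect_smul, Units.val_one, scalarDefect_one, mul_zero, scalarDefect_mapMatrix,
    ← hdefect, hiter] at h0
  let := Ideal.Quotient.field M
  exact right_ne_zero_of_mul hDM' (eq_zero_of_pow_eq_zero h0)

end FreeGroup

/-- Every extension of `Q` with finite kernel is residually finite. -/
def FiniteExtensionsRF.{u, v} (Q : Type u) [Group Q] : Prop :=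
  ∀ (E : Type v) [Group E] (π : E →* Q), Function.Surjective π → Finite π.ker →
    ResiduallyFinite E

section GroupExtensions

universe u u' u'' v

variable {A : Type u} {G : Type u'} {Q : Type u''} [Group A] [Group G] [Group Q]

theorem MonoidHom.exists_lift_of_injective {X : Type*} [Group X] {ι : A →* G}
    (hι : Function.Injective ι) (f : X →* G) (hf : ∀ x, f x ∈ ι.range) :
    ∃ ψ : X →* A, ∀ x, ι (ψ x) = f x := by
  refine ⟨(MonoidHom.ofInjective hι).symm.toMonoidHom.comp (f.codRestrict ι.range hf), fun x => ?_⟩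
  exact congr_arg Subtype.val ((MonoidHom.ofInjective hι).apply_symm_apply ⟨f x, hf x⟩)

theorem Group.fg_of_exact (ι : A →* G) {π : G →* Q} (hπ : Function.Surjective π)
    (h : π.ker ≤ ι.range) [Group.FG A] [Group.FG Q] : Group.FG G := by
  obtain ⟨S, hS, hSf⟩ := Group.fg_iff.1 (inferInstance : Group.FG A)
  obtain ⟨T, hT, hTf⟩ := Group.fg_iff.1 (inferInstance : Group.FG Q)
  set s := Function.surjInv hπ
  set H := Subgroup.closure (ι '' S ∪ s '' T) with hH
  have hA : ι.range ≤ H := by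
    rw [MonoidHom.range_eq_map, ← hS, MonoidHom.map_closure]
    exact Subgroup.closure_mono Set.subset_union_left
  have hQ : H.map π = ⊤ := by
    rw [eq_top_iff, ← hT, Subgroup.closure_le]
    exact fun t ht => ⟨s t, Subgroup.subset_closure (Or.inr ⟨t, ht, rfl⟩),
      Function.surjInv_eq hπ t⟩
  refine Group.fg_iff.2 ⟨_, eq_top_iff.2 fun g _ => ?_, (hSf.image ι).union (hTf.image s)⟩
  obtain ⟨x, hx, hxg⟩ := hQ.ge (Subgroup.mem_top (π g))
  rw [← inv_mul_cancel_right g x, ← hH]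
  refine H.mul_mem (hA (h ?_)) hx
  simp [MonoidHom.mem_ker, hxg]

instance MonoidHom.finite_of_fg [Group.FG G] [Finite Q] : Finite (G →* Q) := by
  obtain ⟨S, hS, hSf⟩ := Group.fg_iff.1 (inferInstance : Group.FG G)
  have := hSf.to_subtype
  refine Finite.of_injective (fun (f : G →* Q) (s : S) => f s) fun f g h => ?_
  exact MonoidHom.eq_of_eqOn_dense hS fun s hs => congr_fun h ⟨s, hs⟩

instance Subgroup.finiteIndex_comap (f : G →* Q) (N : Subgroup Q) [N.FiniteIndex] :
    (N.comap f).FiniteIndex := by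
  refine ⟨?_⟩
  rw [Subgroup.index_comap]
  exact Subgroup.FiniteIndex.index_ne_zero

/-- The intersection of the kernels of all homomorphisms from `A` to `H`. -/
def commonKernel (A H : Type*) [Group A] [Group H] : Subgroup A :=
  ⨅ f : A →* H, f.ker

theorem mem_commonKernel {a : A} : a ∈ commonKernel A Q ↔ ∀ f : A →* Q, f a = 1 := by
  simp [commonKernel, Subgroup.mem_iInf, MonoidHom.mem_ker]

instance commonKernel.finiteIndex [Group.FG A] [Finite Q] : (commonKernel A Q).FiniteIndex :=
  Subgroup.finiteIndex_iInf fun _ => inferInstance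

instance commonKernel.normal : (commonKernel A Q).Normal :=
  Subgroup.normal_iInf_normal fun _ => inferInstance

theorem commonKernel_perm_le (L : Subgroup A) :
    commonKernel A (Equiv.Perm (A ⧸ L)) ≤ L := by
  intro a ha
  have h := mem_commonKernel.1 ha (MulAction.toPermHom A (A ⧸ L))
  have := congr_arg (fun σ : Equiv.Perm (A ⧸ L) => σ ((1 : A) : A ⧸ L)) h
  simpa [MulAction.Quotient.smul_mk, QuotientGroup.eq_one_iff, eq_comm, QuotientGroup.eq] using this

theorem ResiduallyFinite.of_injective {f : A →* G} (hG : ResiduallyFinite G)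
    (hf : Function.Injective f) : ResiduallyFinite A := by
  intro a ha
  obtain ⟨N, hN, hfin, haN⟩ := hG (f a) (by rwa [Ne, map_eq_one_iff f hf])
  exact ⟨N.comap f, inferInstance, inferInstance, haN⟩

theorem ResiduallyFinite.exists_normal_of_finite (hG : ResiduallyFinite G) (F : Set G)
    (hF : F.Finite) :
    ∃ N : Subgroup G, N.Normal ∧ N.FiniteIndex ∧ ∀ x ∈ F, x ∈ N → x = 1 := by
  have h : ∀ x : G, ∃ N : Subgroup G, N.Normal ∧ N.FiniteIndex ∧ (x ∈ N → x = 1) := by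
    intro x
    by_cases hx : x = 1
    · exact ⟨⊤, inferInstance, inferInstance, fun _ => hx⟩
    · obtain ⟨N, hN, hfin, hxN⟩ := hG x hx
      exact ⟨N, hN, hfin, fun h => absurd h hxN⟩
  choose N hN hfin hx using h
  have := hF.to_subtype
  exact ⟨⨅ x : F, N x, Subgroup.normal_iInf_normal fun x => hN x,
    Subgroup.finiteIndex_iInf fun x => hfin x,
    fun x hxF hmem => hx x (Subgroup.mem_iInf.1 hmem ⟨x, hxF⟩)⟩

theorem FiniteExtensionsRF.residuallyFinite (hQ : FiniteExtensionsRF.{u'', u''} Q) :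
    ResiduallyFinite Q :=
  hQ Q (MonoidHom.id Q) Function.surjective_id
    (by rw [(MonoidHom.ker_eq_bot_iff _).2 Function.injective_id]; infer_instance)

theorem FiniteExtensionsRF.exists_normal_notMem (hQ : FiniteExtensionsRF.{u'', u'} Q)
    {π : G →* Q} (hπ : Function.Surjective π) {w : G} (hw : π w ≠ 1) :
    ∃ N : Subgroup G, N.Normal ∧ N.FiniteIndex ∧ w ∉ N := by
  have hinj := QuotientGroup.kerLift_injective π
  obtain ⟨N, hN, hfin, hwN⟩ := hQ (G ⧸ π.ker) (QuotientGroup.kerLift π)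
    (fun q => (hπ q).imp' _ fun g hg => (QuotientGroup.kerLift_mk π g).trans hg)
    (by rw [(MonoidHom.ker_eq_bot_iff _).2 hinj]; infer_instance)
    (w : G ⧸ π.ker) (by rwa [Ne, QuotientGroup.eq_one_iff, MonoidHom.mem_ker])
  exact ⟨N.comap (QuotientGroup.mk' _), inferInstance, inferInstance, hwN⟩

theorem FiniteExtensionsRF.of_mulEquiv {Q' : Type*} [Group Q'] (e : Q ≃* Q')
    (hQ : FiniteExtensionsRF.{_, v} Q) : FiniteExtensionsRF.{_, v} Q' := by
  intro E _ π hπ hfin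
  refine hQ E (e.symm.toMonoidHom.comp π) (e.symm.surjective.comp hπ) ?_
  rwa [show (e.symm.toMonoidHom.comp π).ker = π.ker from MonoidHom.ker_mulEquiv_comp π e.symm]

theorem FiniteExtensionsRF.of_finite [Finite Q] : FiniteExtensionsRF.{_, v} Q := by
  intro E _ π hπ hfin
  have := Finite.of_surjective _ (QuotientGroup.quotientKerEquivOfSurjective π hπ).symm.surjective
  have : Finite E := .of_subgroup_quotient π.ker
  exact fun g hg => ⟨⊥, inferInstance, inferInstance, by simpa using hg⟩

theorem FiniteExtensionsRF.of_splits (hQ : ResiduallyFinite Q)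
    (hs : ∀ (E : Type v) [Group E] (π : E →* Q), Function.Surjective π →
      ∃ s : Q →* E, ∀ q, π (s q) = q) : FiniteExtensionsRF.{_, v} Q := by
  intro E _ π hπ hfin w hw
  by_cases hπw : π w = 1
  · obtain ⟨s, hs⟩ := hs E π hπ
    have : Finite (E ⧸ s.range) := by
      refine Finite.of_surjective (fun x : π.ker => ((x : E) : E ⧸ s.range)) fun y => ?_
      obtain ⟨e, rfl⟩ := QuotientGroup.mk_surjective y
      refine ⟨⟨e * (s (π e))⁻¹, by simp [MonoidHom.mem_ker, hs]⟩, ?_⟩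
      rw [QuotientGroup.eq]
      exact ⟨π e, by simp⟩
    have : s.range.FiniteIndex := Subgroup.finiteIndex_of_finite_quotient
    refine ⟨s.range.normalCore, inferInstance, inferInstance, fun h => hw ?_⟩
    obtain ⟨q, rfl⟩ := s.range.normalCore_le h
    rw [hs] at hπw
    rw [hπw, map_one]
  · obtain ⟨N, hN, hfin, hwN⟩ := hQ _ hπw
    exact ⟨N.comap π, inferInstance, inferInstance, hwN⟩

theorem FiniteExtensionsRF.freeGroup (n : ℕ) :
    FiniteExtensionsRF.{_, v} (FreeGroup (Fin n)) := by
  refine .of_splits (fun w hw => ?_) fun E _ π hπ =>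
    ⟨FreeGroup.lift fun a => Function.surjInv hπ (FreeGroup.of a), fun q => ?_⟩
  · obtain ⟨N, hN, hfin, h⟩ := FreeGroup.separatesIterates (MonoidHom.id _) w (by simpa using hw)
    obtain ⟨n, -, h⟩ := h 0
    exact ⟨N, hN, hfin, by simpa using h⟩
  · refine DFunLike.congr_fun (FreeGroup.ext_hom (f := π.comp _) (g := MonoidHom.id _) fun a => ?_) q
    simp [Function.surjInv_eq]

theorem FiniteExtensionsRF.of_isCyclic [IsCyclic Q] : FiniteExtensionsRF.{_, v} Q := by
  cases finite_or_infinite Q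
  · exact .of_finite
  · obtain ⟨g, hg⟩ := IsCyclic.exists_generator (α := Q)
    exact .of_mulEquiv ((FreeGroup.mulEquivIntOfUnique (α := Fin 1)).trans
      (intEquivOfZPowersEqTop g ((Subgroup.eq_top_iff' _).2 hg))) (.freeGroup 1)

theorem FiniteExtensionsRF.exists_normal_comap_le [Group.FG A]
    (hQ : FiniteExtensionsRF.{u'', u'} Q)
    {ι : A →* G} (hι : Function.Injective ι) {π : G →* Q} (hπ : Function.Surjective π)
    (hex : π.ker = ι.range) (L : Subgroup A) [L.FiniteIndex] :
    ∃ N : Subgroup G, N.Normal ∧ N.FiniteIndex ∧ N.comap ι ≤ L := by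
  set K := commonKernel A (Equiv.Perm (A ⧸ L)) with hK
  have hnormal : (K.map ι).Normal := by
    refine ⟨?_⟩
    rintro _ ⟨a, ha, rfl⟩ g
    obtain ⟨ψ, hψ⟩ := MonoidHom.exists_lift_of_injective hι
      ((MulAut.conj g).toMonoidHom.comp ι) fun x => by
        rw [← hex]
        exact (inferInstance : π.ker.Normal).conj_mem _ (hex ▸ ⟨x, rfl⟩) g
    refine ⟨ψ a, mem_commonKernel.2 fun f => mem_commonKernel.1 ha (f.comp ψ), ?_⟩
    exact hψ a
  have hle : K.map ι ≤ π.ker := hex ▸ Subgroup.map_le_range ι K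
  set ρ := QuotientGroup.lift (K.map ι) π hle
  have hfin : (ρ.ker : Set (G ⧸ K.map ι)).Finite := by
    refine (Set.finite_range (QuotientGroup.map K (K.map ι) ι (Subgroup.le_comap_map ι K))).subset ?_
    intro y hy
    obtain ⟨g, rfl⟩ := QuotientGroup.mk_surjective y
    obtain ⟨a, rfl⟩ : g ∈ ι.range := hex ▸ hy
    exact ⟨a, rfl⟩
  obtain ⟨N, hN, hNfin, h⟩ := (hQ (G ⧸ K.map ι) ρ
    (QuotientGroup.lift_surjective_of_surjective _ _ hπ _) hfin.to_subtype).exists_normal_of_finite _ hfin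
  refine ⟨N.comap (QuotientGroup.mk' _), inferInstance, inferInstance, fun a ha => ?_⟩
  have h1 := h (ι a : G ⧸ K.map ι) (show π (ι a) = 1 from MonoidHom.mem_ker.1 (hex ▸ ⟨a, rfl⟩)) ha
  rw [QuotientGroup.eq_one_iff] at h1
  obtain ⟨b, hb, hab⟩ := h1
  exact commonKernel_perm_le L (hι hab ▸ hb)

theorem ResiduallyFinite.of_exact [Group.FG A] (hA : ResiduallyFinite A)
    (hQ : FiniteExtensionsRF.{u'', u'} Q)
    {ι : A →* G} (hι : Function.Injective ι) {π : G →* Q} (hπ : Function.Surjective π)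
    (hex : π.ker = ι.range) : ResiduallyFinite G := by
  intro w hw
  by_cases hπw : π w = 1
  · obtain ⟨a, rfl⟩ : w ∈ ι.range := hex ▸ hπw
    obtain ⟨L, hL, hLfin, haL⟩ := hA a (by rintro rfl; exact hw (map_one ι))
    obtain ⟨N, hN, hNfin, hNL⟩ := hQ.exists_normal_comap_le hι hπ hex L
    exact ⟨N, hN, hNfin, fun h => haL (hNL h)⟩
  · exact hQ.exists_normal_notMem hπ hπw

theorem FiniteExtensionsRF.of_exact [Group.FG A] (hA : FiniteExtensionsRF.{u, v} A)
    (hQ : FiniteExtensionsRF.{u'', v} Q)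
    {ι : A →* G} (hι : Function.Injective ι) {π : G →* Q} (hπ : Function.Surjective π)
    (hex : π.ker = ι.range) : FiniteExtensionsRF.{u', v} G := by
  intro E _ ρ hρ hfin
  have hmem : ∀ x : (π.comp ρ).ker, ρ x ∈ ι.range := fun x => hex ▸ x.2
  obtain ⟨ψ, hψ⟩ := MonoidHom.exists_lift_of_injective hι (ρ.comp (π.comp ρ).ker.subtype) hmem
  have hψsurj : Function.Surjective ψ := by
    intro a
    obtain ⟨e, he⟩ := hρ (ι a)
    have : e ∈ (π.comp ρ).ker := by
      show π (ρ e) = 1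
      rw [he]
      exact MonoidHom.mem_ker.1 (hex ▸ ⟨a, rfl⟩)
    exact ⟨⟨e, this⟩, hι ((hψ _).trans he)⟩
  have hψker : Finite ψ.ker := by
    refine Finite.of_injective (fun x : ψ.ker => (⟨x.1.1, ?_⟩ : ρ.ker)) fun x y h => ?_
    · have := hψ x.1
      rw [MonoidHom.mem_ker.1 x.2, map_one] at this
      exact this.symm
    · exact Subtype.ext (Subtype.ext (congr_arg (fun z : ρ.ker => (z : E)) h))
  have : Group.FG (π.comp ρ).ker := Group.fg_of_exact ψ.ker.subtype hψsurj (by simp)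
  exact (hA _ ψ hψsurj hψker).of_exact hQ (Subgroup.subtype_injective _)
    (π := π.comp ρ) (hπ.comp hρ) (by simp)

end GroupExtensions

section SeparatesIterates

universe u u' u''

variable {A : Type u} {G : Type u'} {Q : Type u''} [Group A] [Group G] [Group Q]

theorem SeparatesIterates.of_iterate_eq {φ : G →* G} {w : G} {k : ℕ} {N : Subgroup G}
    (h : ∀ m, ∃ n ≥ m, φ^[n] (φ^[k] w) ∉ N) : ∀ m, ∃ n ≥ m, φ^[n] w ∉ N := by
  intro m
  obtain ⟨n, hn, h⟩ := h m
  exact ⟨n + k, by omega, by rwa [Function.iterate_add_apply]⟩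

theorem SeparatesIterates.of_finite [Finite G] (φ : G →* G) : SeparatesIterates φ :=
  fun _ hw => ⟨⊥, inferInstance, inferInstance, fun m => ⟨m, le_rfl, by simpa using hw m⟩⟩

theorem SeparatesIterates.of_exact [Group.FG A] (hQ : FiniteExtensionsRF.{u'', u'} Q)
    {ι : A →* G} (hι : Function.Injective ι) {π : G →* Q} (hπ : Function.Surjective π)
    (hex : π.ker = ι.range) {φA : A →* A} {φ : G →* G} {φQ : Q →* Q}
    (hφA : ∀ a, ι (φA a) = φ (ι a)) (hφQ : ∀ g, π (φ g) = φQ (π g))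
    (hA : SeparatesIterates φA) (hQs : SeparatesIterates φQ) : SeparatesIterates φ := by
  have hιn : ∀ n a, ι (φA^[n] a) = φ^[n] (ι a) := fun n => Function.Semiconj.iterate_right hφA n
  have hπn : ∀ n g, π (φ^[n] g) = φQ^[n] (π g) := fun n => Function.Semiconj.iterate_right hφQ n
  intro w hw
  by_cases h : ∀ n, φQ^[n] (π w) ≠ 1
  · obtain ⟨N, hN, hfin, h⟩ := hQs _ h
    exact ⟨N.comap π, inferInstance, inferInstance, fun m => by
      simpa [Subgroup.mem_comap, hπn] using h m⟩
  · push Not at h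
    obtain ⟨k, hk⟩ := h
    obtain ⟨a, ha⟩ : φ^[k] w ∈ ι.range := by
      rw [← hex, MonoidHom.mem_ker, hπn, hk]
    obtain ⟨L, hL, hLfin, hLa⟩ := hA a fun n hn => hw (n + k) (by
      rw [Function.iterate_add_apply, ← ha, ← hιn, hn, map_one])
    obtain ⟨N, hN, hNfin, hNL⟩ := hQ.exists_normal_comap_le hι hπ hex L
    refine ⟨N, hN, hNfin, of_iterate_eq (k := k) fun m => ?_⟩
    obtain ⟨n, hn, hnL⟩ := hLa m
    exact ⟨n, hn, fun hmem => hnL (hNL (by rwa [Subgroup.mem_comap, hιn, ha]))⟩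

theorem SeparatesIterates.of_semiconj {φ : G →* G} {ψ : Q →* Q} (h : SeparatesIterates ψ)
    (e : Q ≃* G) (he : ∀ q, e (ψ q) = φ (e q)) : SeparatesIterates φ := by
  have hn : ∀ n g, e.symm (φ^[n] g) = ψ^[n] (e.symm g) := fun n =>
    Function.Semiconj.iterate_right (fun g => by
      rw [MulEquiv.symm_apply_eq, he, MulEquiv.apply_symm_apply]) n
  intro w hw
  obtain ⟨N, hN, hfin, h⟩ := h (e.symm w) fun n => by
    rw [← hn, Ne, map_eq_one_iff e.symm e.symm.injective]
    exact hw n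
  exact ⟨N.comap e.symm.toMonoidHom, inferInstance, inferInstance, fun m => by
    simpa [Subgroup.mem_comap, hn] using h m⟩

theorem SeparatesIterates.of_mulEquiv (e : G ≃* Q)
    (h : ∀ ψ : Q →* Q, SeparatesIterates ψ) (φ : G →* G) : SeparatesIterates φ :=
  (h ((e.toMonoidHom.comp φ).comp e.symm.toMonoidHom)).of_semiconj e.symm fun q => by simp

theorem SeparatesIterates.exists_comap_eq [Group.FG G] {φ : G →* G} (h : SeparatesIterates φ)
    (hφ : Function.Injective φ) {w : G} (hw : w ≠ 1) :
    ∃ K : Subgroup G, K.Normal ∧ K.FiniteIndex ∧ K.comap φ = K ∧ w ∉ K := by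
  obtain ⟨N, hN, hNfin, h⟩ := h w fun n hn =>
    hw (hφ.iterate n (hn.trans (Function.iterate_fixed (map_one φ) n).symm))
  set c : (G →* G ⧸ N) → (G →* G ⧸ N) := fun f => f.comp φ with hc
  have hcn : ∀ n f g, (c^[n] f) g = f (φ^[n] g) := by
    intro n
    induction n with
    | zero => intro f g; rfl
    | succ n ih =>
      intro f g
      rw [Function.iterate_succ_apply, ih, Function.iterate_succ_apply']
      rfl
  refine ⟨⨅ f : Function.periodicPts c, (f : G →* G ⧸ N).ker,
    Subgroup.normal_iInf_normal fun _ => inferInstance,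
    Subgroup.finiteIndex_iInf fun _ => inferInstance, ?_, fun hmem => ?_⟩
  · ext g
    simp only [Subgroup.mem_comap, Subgroup.mem_iInf, MonoidHom.mem_ker, Subtype.forall]
    refine ⟨fun hg f hf => ?_, fun hg f hf => hg _ ((Function.bijOn_periodicPts c).mapsTo hf)⟩
    obtain ⟨f', hf', rfl⟩ := (Function.bijOn_periodicPts c).surjOn hf
    exact hg f' hf'
  · obtain ⟨i, j, hij, heq⟩ : ∃ i j, i < j ∧
        c^[i] (QuotientGroup.mk' N) = c^[j] (QuotientGroup.mk' N) := by
      obtain ⟨i, j, hne, heq⟩ := Finite.exists_ne_map_eq_of_infinite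
        fun n : ℕ => c^[n] (QuotientGroup.mk' N)
      rcases hne.lt_or_gt with hlt | hlt
      exacts [⟨i, j, hlt, heq⟩, ⟨j, i, hlt, heq.symm⟩]
    have hper : ∀ n ≥ i, c^[n] (QuotientGroup.mk' N) ∈ Function.periodicPts c := by
      intro n hn
      obtain ⟨k, rfl⟩ := Nat.exists_eq_add_of_le' hn
      rw [Function.iterate_add_apply]
      refine ((Function.bijOn_periodicPts c).mapsTo.iterate k)
        (Function.mk_mem_periodicPts (Nat.sub_pos_of_lt hij) ?_)
      rw [Function.IsPeriodicPt, Function.IsFixedPt, ← Function.iterate_add_apply,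
        Nat.sub_add_cancel hij.le, heq]
    obtain ⟨n, hn, hnN⟩ := h i
    refine hnN ?_
    have := Subgroup.mem_iInf.1 hmem ⟨_, hper n hn⟩
    rw [MonoidHom.mem_ker, hcn] at this
    exact (QuotientGroup.eq_one_iff _).1 this

end SeparatesIterates

section Abelian

theorem FiniteExtensionsRF.of_comm.{u, v} (B : Type u) [CommGroup B] [Group.FG B] :
    FiniteExtensionsRF.{u, v} B := by
  classical
  suffices h : ∀ (n : ℕ) (B : Type u) [CommGroup B] (S : Finset B),
      Subgroup.closure (S : Set B) = ⊤ → S.card ≤ n → FiniteExtensionsRF.{u, v} B by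
    obtain ⟨S, hS⟩ := Group.fg_def.1 (inferInstance : Group.FG B)
    exact h _ B S hS le_rfl
  intro n
  induction n with
  | zero =>
    intro B _ S hS hn
    rw [Finset.card_eq_zero.1 (Nat.le_zero.1 hn), Finset.coe_empty, Subgroup.closure_empty] at hS
    have : Subsingleton B := Subgroup.subsingleton_iff.1 (subsingleton_of_bot_eq_top hS)
    exact .of_finite
  | succ n ih =>
    intro B _ S hS hn
    obtain rfl | ⟨b, hb⟩ := S.eq_empty_or_nonempty
    · exact ih B ∅ hS (by simp)
    set Z := Subgroup.zpowers b with hZ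
    have : Group.FG Z := (Group.fg_iff_subgroup_fg Z).2 ⟨{b}, by simp [hZ, Subgroup.zpowers_eq_closure]⟩
    refine .of_exact (ι := Z.subtype) (π := QuotientGroup.mk' Z) (.of_isCyclic)
      (ih (B ⧸ Z) ((S.erase b).image (QuotientGroup.mk' Z)) ?_ ?_)
      Z.subtype_injective (QuotientGroup.mk'_surjective Z) (by simp)
    · have h := congr_arg (Subgroup.map (QuotientGroup.mk' Z)) hS
      rw [MonoidHom.map_closure, ← MonoidHom.range_eq_map, QuotientGroup.range_mk'] at h
      rw [eq_top_iff, ← h, Subgroup.closure_le]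
      rintro _ ⟨x, hx, rfl⟩
      by_cases hxb : x = b
      · rw [hxb, show QuotientGroup.mk' Z b = 1 from
          (QuotientGroup.eq_one_iff _).2 (Subgroup.mem_zpowers b)]
        exact one_mem _
      · exact Subgroup.subset_closure (Finset.mem_coe.2 (Finset.mem_image_of_mem _
          (Finset.mem_erase.2 ⟨hxb, hx⟩)))
    · have := Finset.card_erase_of_mem hb
      exact Finset.card_image_le.trans (by omega)

open Polynomial in
theorem exists_notMem_smul_of_not_torsion {M : Type*} [AddCommGroup M] [Module.Finite ℤ M]
    (ψ : M →ₗ[ℤ] M) (w : M) (hw : ∀ n, (ψ ^ n) w ∉ Submodule.torsion ℤ M) :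
    ∃ p : ℕ, p ≠ 0 ∧ ∀ m, ∃ n ≥ m, ∀ x, (ψ ^ n) w ≠ p • x := by
  obtain ⟨χ, hχ, hχψ⟩ := LinearMap.exists_monic_and_aeval_eq_zero ℤ ψ
  obtain ⟨g, hg, hdvd⟩ := exists_eq_pow_rootMultiplicity_mul_and_not_dvd χ hχ.ne_zero 0
  rw [C_0, sub_zero] at hg hdvd
  rw [X_dvd_iff] at hdvd
  set a := χ.rootMultiplicity 0
  set v := (ψ ^ a) w with hv
  have hgv : aeval ψ g v = 0 := by
    have := LinearMap.congr_fun hχψ w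
    rwa [hg, mul_comm, map_mul, map_pow, aeval_X] at this
  obtain ⟨h, hh⟩ : ∃ h, g = X * h + C (g.coeff 0) := ⟨g.divX, (X_mul_divX_add g).symm⟩
  set c := g.coeff 0
  have hcv : c • v = ψ (-(aeval ψ h) v) := by
    rw [hh, map_add, map_mul, aeval_X, aeval_C] at hgv
    have h1 : ψ (aeval ψ h v) + c • v = 0 := by simpa using hgv
    rw [map_neg]
    exact eq_neg_of_add_eq_zero_right h1
  have hcomm : Commute (-(aeval ψ h)) ψ := by
    have h1 := congr_arg (aeval ψ) (mul_comm h X)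
    simp only [map_mul, aeval_X] at h1
    exact Commute.neg_left h1
  have hcn : ∀ n, c ^ n • v = ((-(aeval ψ h)) ^ n) ((ψ ^ n) v) := by
    intro n
    rw [← Module.End.mul_apply, ← hcomm.mul_pow]
    induction n with
    | zero => simp
    | succ n ih =>
      rw [pow_succ, mul_smul, hcv, pow_succ', Module.End.mul_apply, ← ih, map_smul, hcomm.eq]
      rfl
  obtain ⟨f, hf⟩ : ∃ f : M →ₗ[ℤ] ℤ, f v ≠ 0 := by
    obtain ⟨f, hf⟩ := Module.Projective.exists_dual_ne_zero ℤ
      (x := (Submodule.torsion ℤ M).mkQ v) (by simpa using hw a)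
    exact ⟨f.comp (Submodule.torsion ℤ M).mkQ, hf⟩
  obtain ⟨p, hpgt, hp⟩ := Nat.exists_infinite_primes ((c * f v).natAbs + 1)
  have hpf : ¬ (p : ℤ) ∣ c * f v := fun hd => by
    have := Nat.le_of_dvd (Int.natAbs_pos.2 (mul_ne_zero hdvd hf)) (Int.natCast_dvd.1 hd)
    omega
  refine ⟨p, hp.ne_zero, fun m => ⟨m + a, by omega, fun x hx => hpf ?_⟩⟩
  rw [pow_add, Module.End.mul_apply, ← hv] at hx
  have h1 := congr_arg f (hcn m)
  rw [hx, map_nsmul, map_nsmul, map_smul, smul_eq_mul, nsmul_eq_mul] at h1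
  have h2 : (p : ℤ) ∣ c ^ m * f v := ⟨_, h1⟩
  rcases (Nat.prime_iff_prime_int.1 hp).dvd_mul.1 h2 with h3 | h3
  · exact ((Nat.prime_iff_prime_int.1 hp).dvd_of_dvd_pow h3).mul_right _
  · exact h3.mul_left _

theorem SeparatesIterates.of_comm {B : Type*} [CommGroup B] [Group.FG B] (φ : B →* B) :
    SeparatesIterates φ := by
  intro w hw
  set ψ : Additive B →ₗ[ℤ] Additive B := φ.toAdditive.toIntLinearMap with hψ
  have : Module.Finite ℤ (Additive B) := Module.Finite.iff_addGroup_fg.2 inferInstance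
  have hψn : ∀ n x, (ψ ^ n) (Additive.ofMul x) = Additive.ofMul (φ^[n] x) := by
    intro n
    induction n with
    | zero => intro x; rfl
    | succ n ih => intro x; rw [pow_succ, Module.End.mul_apply, Function.iterate_succ_apply, ← ih]; rfl
  by_cases h : ∀ n, (ψ ^ n) (Additive.ofMul w) ∉ Submodule.torsion ℤ (Additive B)
  · obtain ⟨p, hp, h⟩ := exists_notMem_smul_of_not_torsion ψ _ h
    refine ⟨(powMonoidHom p : B →* B).range, inferInstance, ?_, fun m => ?_⟩
    · have : Finite (B ⧸ (powMonoidHom p : B →* B).range) := by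
        refine CommGroup.finite_of_fg_isMulTorsion _ fun x => ?_
        obtain ⟨b, rfl⟩ := QuotientGroup.mk_surjective x
        refine isOfFinOrder_iff_pow_eq_one.2 ⟨p, Nat.pos_of_ne_zero hp, ?_⟩
        exact (QuotientGroup.eq_one_iff _).2 ⟨b, rfl⟩
      exact Subgroup.finiteIndex_of_finite_quotient
    · obtain ⟨n, hn, h⟩ := h m
      refine ⟨n, hn, ?_⟩
      rintro ⟨x, hx⟩
      refine h (Additive.ofMul x) ?_
      rw [hψn, ← hx]
      rfl
  · push Not at h
    obtain ⟨k, hk⟩ := h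
    have hT : (Submodule.torsion ℤ (Additive B) : Set (Additive B)).Finite := by
      have : Finite (Submodule.torsion ℤ (Additive B)) :=
        Module.finite_of_fg_torsion _ Submodule.torsion_isTorsion
      exact Set.toFinite _
    obtain ⟨N, hN, hNfin, hNT⟩ := (FiniteExtensionsRF.of_comm B).residuallyFinite.exists_normal_of_finite
      (Additive.toMul '' (Submodule.torsion ℤ (Additive B) : Set (Additive B))) (hT.image _)
    refine ⟨N, hN, hNfin, of_iterate_eq (k := k) fun m => ⟨m, le_rfl, fun hmem => hw (m + k) ?_⟩⟩
    rw [Function.iterate_add_apply]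
    refine hNT _ ⟨(ψ ^ (m + k)) (Additive.ofMul w), ?_, ?_⟩ hmem
    · obtain ⟨r, hr⟩ := hk
      refine ⟨r, ?_⟩
      rw [pow_add, Module.End.mul_apply]
      exact (map_smul (ψ ^ m) (r : ℤ) _).symm.trans ((congr_arg _ hr).trans (map_zero _))
    · rw [hψn, Function.iterate_add_apply]
      rfl

end Abelian

section Polycyclic

theorem IsPolycyclic.subgroup_fg_and_isSolvable {G : Type*} [Group G] (hG : IsPolycyclic G) :
    (∀ K : Subgroup G, K.FG) ∧ Group.IsSolvable G := by
  obtain ⟨m, H, h0, htop, hH⟩ := hG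
  suffices h : ∀ i, (∀ K ≤ H i, K.FG) ∧ Group.IsSolvable (H i) by
    obtain ⟨h1, h2⟩ := h (Fin.last m)
    rw [htop] at h1 h2
    exact ⟨fun K => h1 K le_top,
      Group.isSolvable_of_surjective (f := (Subgroup.topEquiv (G := G)).toMonoidHom)
        Subgroup.topEquiv.surjective⟩
  intro i
  induction i using Fin.induction with
  | zero =>
    rw [h0]
    refine ⟨fun K hK => ?_, inferInstance⟩
    rw [le_bot_iff.1 hK]
    exact Subgroup.FG.bot
  | succ i ih =>
    obtain ⟨hle, hn, hcyc⟩ := hH i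
    obtain ⟨hfg, hsol⟩ := ih
    have hcyc : IsCyclic (H i.succ ⧸ (H i.castSucc).subgroupOf (H i.succ)) := hcyc
    set q := QuotientGroup.mk' ((H i.castSucc).subgroupOf (H i.succ))
    have hq : ∀ x, q x = 1 → (x : G) ∈ H i.castSucc := fun x hx =>
      (QuotientGroup.eq_one_iff (N := (H i.castSucc).subgroupOf (H i.succ)) x).1 hx
    refine ⟨fun K hK => ?_, ?_⟩
    · set f := (q.comp (Subgroup.inclusion hK)).rangeRestrict
      have h1 : Group.FG (K ⊓ H i.castSucc : Subgroup G) :=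
        (Group.fg_iff_subgroup_fg _).2 (hfg _ inf_le_right)
      obtain ⟨g, hg⟩ := IsCyclic.exists_generator (α := (q.comp (Subgroup.inclusion hK)).range)
      have h2 : Group.FG (q.comp (Subgroup.inclusion hK)).range :=
        Group.fg_def.2 ⟨{g}, by
          simpa [← Subgroup.zpowers_eq_closure] using (Subgroup.eq_top_iff' _).2 hg⟩
      rw [← Group.fg_iff_subgroup_fg]
      exact Group.fg_of_exact (Subgroup.inclusion (inf_le_left : K ⊓ H i.castSucc ≤ K)) (π := f)
        (MonoidHom.rangeRestrict_surjective _) fun x hx =>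
          ⟨⟨x, x.2, hq _ (congr_arg Subtype.val (MonoidHom.mem_ker.1 hx))⟩, rfl⟩
    · have : Group.IsSolvable (H i.succ ⧸ (H i.castSucc).subgroupOf (H i.succ)) :=
        Group.isSolvable_of_comm IsCyclic.isMulCommutative.is_comm.comm
      exact Group.isSolvable_of_ker_le_range (Subgroup.inclusion hle) q fun x hx =>
        ⟨⟨x, hq x hx⟩, rfl⟩

theorem map_derivedSeries_commutator (G : Type*) [Group G] (n : ℕ) :
    (derivedSeries (commutator G) n).map (commutator G).subtype = derivedSeries G (n + 1) := by
  induction n with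
  | zero =>
    rw [derivedSeries_zero, ← MonoidHom.range_eq_map, Subgroup.range_subtype, derivedSeries_one]
  | succ n ih => rw [derivedSeries_succ, Subgroup.map_commutator, ih, derivedSeries_succ G (n + 1)]

theorem Group.IsSolvable.finiteExtensionsRF_and_separatesIterates.{u, v} {G : Type u} [Group G]
    [hs : Group.IsSolvable G] (hG : ∀ K : Subgroup G, K.FG) :
    FiniteExtensionsRF.{u, v} G ∧ ∀ φ : G →* G, SeparatesIterates φ := by
  obtain ⟨n, hn⟩ := hs.solvable
  clear hs
  induction n generalizing G with
  | zero =>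
    have : Subsingleton G := Subgroup.subsingleton_iff.1 (subsingleton_of_bot_eq_top hn.symm)
    exact ⟨.of_finite, fun φ => .of_finite φ⟩
  | succ n ih =>
    set A := commutator G with hAdef
    have hAfg : Group.FG A := (Group.fg_iff_subgroup_fg A).2 (hG A)
    have : Group.FG G := Group.fg_def.2 (hG ⊤)
    have hA := ih (G := A) (fun K => ?_) ?_
    · have hinj := A.subtype_injective
      have hsurj : Function.Surjective (Abelianization.of (G := G)) := QuotientGroup.mk'_surjective A
      have hker : (Abelianization.of (G := G)).ker = A.subtype.range := by
        rw [Abelianization.ker_of, Subgroup.range_subtype]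
      have : Group.FG (Abelianization G) := QuotientGroup.fg A
      refine ⟨.of_exact hA.1 (FiniteExtensionsRF.of_comm (Abelianization G)) hinj hsurj hker,
        fun φ => ?_⟩
      obtain ⟨φA, hφA⟩ := MonoidHom.exists_lift_of_injective hinj (φ.comp A.subtype) fun x => by
        rw [← hker, MonoidHom.mem_ker]
        have hx : Abelianization.of (x : G) = 1 := MonoidHom.mem_ker.1 (hker ▸ ⟨x, rfl⟩)
        have := congr_arg (Abelianization.map φ) hx
        rwa [Abelianization.map_of, map_one] at this
      exact .of_exact (FiniteExtensionsRF.of_comm (Abelianization G)) hinj hsurj hker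
        hφA (φQ := Abelianization.map φ) (fun g => rfl) (hA.2 φA) (.of_comm _)
    · rw [← Group.fg_iff_subgroup_fg]
      have := (Group.fg_iff_subgroup_fg _).2 (hG (K.map A.subtype))
      exact Group.fg_of_surjective
        (f := (K.equivMapOfInjective A.subtype A.subtype_injective).symm.toMonoidHom)
        (MulEquiv.surjective _)
    · rw [← map_derivedSeries_commutator] at hn
      exact (Subgroup.map_eq_bot_iff_of_injective _ A.subtype_injective).1 hn

end Polycyclic

section AscendingHNN

variable {E : Type*} [Group E]

/-- The elements which a power of the automorphism `c` moves into a `c`-stable subgroup. -/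
def Subgroup.iteratedPreimage (c : E →* E) (K : Subgroup E) (hK : ∀ x ∈ K, c x ∈ K) :
    Subgroup E where
  carrier := {e | ∃ n, c^[n] e ∈ K}
  one_mem' := ⟨0, K.one_mem⟩
  mul_mem' := by
    rintro a b ⟨m, hm⟩ ⟨n, hn⟩
    have hiter : ∀ k, Set.MapsTo c^[k] K K := fun k => Set.MapsTo.iterate hK k
    refine ⟨m + n, ?_⟩
    rw [iterate_map_mul, Function.iterate_add_apply c m n b, add_comm m n,
      Function.iterate_add_apply]
    exact K.mul_mem (hiter n hm) (hiter m hn)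
  inv_mem' := by
    rintro a ⟨m, hm⟩
    exact ⟨m, by rw [iterate_map_inv]; exact K.inv_mem hm⟩

theorem Subgroup.mem_of_iterate_mem {H : Subgroup E} {K : Subgroup H} {c : E →* E} {φ : H →* H}
    (hφ : ∀ x : H, (φ x : E) = c x) (hK : K.comap φ = K) (n : ℕ) (x : H)
    (h : c^[n] x ∈ K.map H.subtype) : x ∈ K := by
  induction n generalizing x with
  | zero =>
    obtain ⟨y, hy, hyx⟩ := h
    exact Subtype.ext hyx ▸ hy
  | succ n ih =>
    rw [Function.iterate_succ_apply, ← hφ] at h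
    rw [← hK]
    exact ih _ h

theorem residuallyFinite_of_ascending {H : Subgroup E} {t : E} {φ : H →* H}
    (hφ : ∀ x : H, (φ x : E) = t⁻¹ * x * t)
    (hE : ∀ e, ∃ (n m : ℕ) (x : H), e = t ^ n * x * (t ^ m)⁻¹)
    {ε : E →* Multiplicative ℤ} (hεt : ε t = Multiplicative.ofAdd 1) (hεH : ∀ x : H, ε x = 1)
    (hsep : ∀ w : H, w ≠ 1 → ∃ K : Subgroup H, K.Normal ∧ K.FiniteIndex ∧ K.comap φ = K ∧ w ∉ K) :
    ResiduallyFinite E := by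
  have hεsurj : Function.Surjective ε := fun k => ⟨t ^ (Multiplicative.toAdd k), by
    rw [map_zpow, hεt, ← ofAdd_zsmul]; simp⟩
  have hker : ∀ e, ε e = 1 → ∃ (n : ℕ) (x : H), e = t ^ n * x * (t ^ n)⁻¹ := by
    intro e he
    obtain ⟨n, m, x, rfl⟩ := hE e
    have : n = m := by
      simpa [hεH, hεt, mul_inv_eq_one, ← ofAdd_nsmul] using he
    exact ⟨n, x, by rw [this]⟩
  have hZ : FiniteExtensionsRF (Multiplicative ℤ) := .of_isCyclic
  intro w hw
  by_cases hεw : ε w = 1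
  swap
  · exact hZ.exists_normal_notMem hεsurj hεw
  obtain ⟨k, x, rfl⟩ := hker w hεw
  obtain ⟨K, hKn, hKfin, hK, hxK⟩ := hsep x (by rintro rfl; simp at hw)
  set c : E →* E := (MulAut.conj t⁻¹).toMonoidHom with hc
  have hcapp : ∀ e, c e = t⁻¹ * e * t := fun e => by simp [hc]
  have hφc : ∀ x : H, (φ x : E) = c x := fun x => (hφ x).trans (hcapp x).symm
  have hcinj : Function.Injective c := (MulAut.conj t⁻¹).injective
  have hcH : ∀ x ∈ H, c x ∈ H := fun x hx => hφc ⟨x, hx⟩ ▸ (φ ⟨x, hx⟩).2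
  have hcK : ∀ x ∈ K.map H.subtype, c x ∈ K.map H.subtype := by
    rintro _ ⟨x, hx, rfl⟩
    refine ⟨φ x, ?_, hφc x⟩
    rw [← hK] at hx
    exact hx
  have hcn : ∀ (n : ℕ) (e : E), c^[n] (t ^ n * e * (t ^ n)⁻¹) = e := by
    intro n
    induction n with
    | zero => intro e; simp
    | succ n ih =>
      intro e
      rw [Function.iterate_succ_apply, hcapp]
      convert ih e using 2
      rw [pow_succ']
      group
  set N := Subgroup.iteratedPreimage c (K.map H.subtype) hcK with hN
  have hmemN : ∀ e, e ∈ N ↔ ∃ n, c^[n] e ∈ K.map H.subtype := fun _ => Iff.rfl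
  have hcN : ∀ e, c e ∈ N ↔ e ∈ N := by
    intro e
    rw [hmemN, hmemN]
    constructor
    · rintro ⟨n, hn⟩
      exact ⟨n + 1, hn⟩
    · rintro ⟨n, hn⟩
      refine ⟨n, ?_⟩
      rw [← Function.iterate_succ_apply, Function.iterate_succ_apply']
      exact hcK _ hn
  have hHN : ∀ (x : H) (e : E), e ∈ N → x * e * (x : E)⁻¹ ∈ N := by
    rintro x e ⟨n, y, hy, hye⟩
    refine ⟨n, ?_⟩
    have hx : c^[n] x ∈ H := Set.MapsTo.iterate (s := (H : Set E)) hcH n x.2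
    rw [iterate_map_mul, iterate_map_mul, iterate_map_inv, ← hye]
    exact ⟨_, hKn.conj_mem y hy ⟨_, hx⟩, rfl⟩
  have htN : ∀ (n : ℕ) (e : E), e ∈ N → t ^ n * e * (t ^ n)⁻¹ ∈ N := by
    intro n
    induction n with
    | zero => intro e he; simpa using he
    | succ n ih =>
      intro e he
      rw [← hcN, hcapp]
      convert ih e he using 1
      rw [pow_succ']
      group
  have htN' : ∀ (n : ℕ) (e : E), e ∈ N → (t ^ n)⁻¹ * e * t ^ n ∈ N := by
    intro n
    induction n with
    | zero => intro e he; simpa using he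
    | succ n ih =>
      intro e he
      convert ih _ ((hcN e).2 he) using 1
      rw [hcapp, pow_succ']
      group
  have hNnormal : N.Normal := by
    refine ⟨fun e he g => ?_⟩
    obtain ⟨n, m, x, rfl⟩ := hE g
    convert htN n _ (hHN x _ (htN' m e he)) using 1
    group
  have hεN : N ≤ ε.ker := by
    rintro e ⟨n, y, -, hye⟩
    have hεc : ∀ n, ε (c^[n] e) = ε e := by
      intro n
      induction n with
      | zero => rfl
      | succ n ih => rw [Function.iterate_succ_apply', hcapp, map_mul, map_mul, map_inv, ih]; simp
    rw [MonoidHom.mem_ker, ← hεc n, ← hye]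
    exact hεH y
  set V : Set (E ⧸ N) := QuotientGroup.mk' N '' H
  have hV : V.Finite := by
    have hle : K ≤ N.comap H.subtype := fun y hy => ⟨0, y, hy, rfl⟩
    refine (Set.finite_range (QuotientGroup.map K N H.subtype hle)).subset ?_
    rintro _ ⟨y, hy, rfl⟩
    exact ⟨((⟨y, hy⟩ : H) : H ⧸ K), rfl⟩
  set cN : E ⧸ N →* E ⧸ N := QuotientGroup.map N N c fun e he => (hcN e).2 he
  have hcNn : ∀ (n : ℕ) (e : E), cN^[n] (e : E ⧸ N) = (c^[n] e : E) := fun n e =>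
    (Function.Semiconj.iterate_right (f := QuotientGroup.mk' N) (fun _ => rfl) n e).symm
  have hcNinj : Function.Injective cN := by
    rw [injective_iff_map_eq_one]
    intro y hy
    obtain ⟨e, rfl⟩ := QuotientGroup.mk_surjective y
    exact (QuotientGroup.eq_one_iff _).2 ((hcN e).1 ((QuotientGroup.eq_one_iff _).1 hy))
  have hcNV : Set.SurjOn cN V V := by
    refine (hV.injOn_iff_bijOn_of_mapsTo ?_).1 hcNinj.injOn |>.surjOn
    rintro _ ⟨y, hy, rfl⟩
    exact ⟨c y, hcH y hy, rfl⟩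
  have hfin : Finite (QuotientGroup.lift N ε hεN).ker := by
    refine (hV.subset fun y hy => ?_).to_subtype
    obtain ⟨e, rfl⟩ := QuotientGroup.mk_surjective y
    obtain ⟨n, x, rfl⟩ := hker e hy
    obtain ⟨v, hv, hvx⟩ := (hcNV.iterate n) ⟨x, x.2, rfl⟩
    rw [QuotientGroup.mk'_apply, ← hcn n x, ← hcNn] at hvx
    exact hcNinj.iterate n hvx ▸ hv
  obtain ⟨N', hN', hN'fin, h⟩ := hZ _ (QuotientGroup.lift N ε hεN)
    (QuotientGroup.lift_surjective_of_surjective _ _ hεsurj _) hfin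
    ((t ^ k * x * (t ^ k)⁻¹ : E) : E ⧸ N) fun h1 => by
      obtain ⟨n, hn⟩ := (QuotientGroup.eq_one_iff _).1 (by
        have := hcNn k (t ^ k * x * (t ^ k)⁻¹)
        rwa [h1, hcn, iterate_map_one, eq_comm] at this : ((x : E) : E ⧸ N) = 1)
      exact hxK (Subgroup.mem_of_iterate_mem hφc hK n x hn)
  exact ⟨N'.comap (QuotientGroup.mk' N), inferInstance, inferInstance, h⟩

theorem AscendingHNNExtension.inv_t_mul_of_mul_t {G : Type*} [Group G] {φ : G →* G}
    (hφ : Function.Injective φ) (g : G) :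
    (HNNExtension.t⁻¹ * HNNExtension.of g * HNNExtension.t : AscendingHNNExtension φ hφ) =
      HNNExtension.of (φ g) :=
  (HNNExtension.equiv_symm_eq_conj
    (φ := (MonoidHom.ofInjective hφ).symm.trans Subgroup.topEquiv.symm)
    ⟨g, Subgroup.mem_top g⟩).symm

theorem AscendingHNNExtension.of_mul_t_pow {G : Type*} [Group G] {φ : G →* G}
    (hφ : Function.Injective φ) (k : ℕ) (g : G) :
    (HNNExtension.of g * HNNExtension.t ^ k : AscendingHNNExtension φ hφ) =
      HNNExtension.t ^ k * HNNExtension.of (φ^[k] g) := by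
  induction k generalizing g with
  | zero => simp
  | succ k ih =>
    have h : (HNNExtension.of g * HNNExtension.t : AscendingHNNExtension φ hφ) =
        HNNExtension.t * HNNExtension.of (φ g) := by
      rw [← inv_t_mul_of_mul_t hφ]
      group
    rw [pow_succ', ← mul_assoc, h, mul_assoc, ih, Function.iterate_succ_apply, mul_assoc]

theorem AscendingHNNExtension.exists_eq {G : Type*} [Group G] {φ : G →* G}
    (hφ : Function.Injective φ) (γ : AscendingHNNExtension φ hφ) :
    ∃ (n m : ℕ) (g : G), γ = HNNExtension.t ^ n * HNNExtension.of g * (HNNExtension.t ^ m)⁻¹ := by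
  induction γ using HNNExtension.induction_on with
  | of g => exact ⟨0, 0, g, by simp⟩
  | t => exact ⟨1, 0, 1, by simp⟩
  | mul x y hx hy =>
    obtain ⟨n, m, g, rfl⟩ := hx
    obtain ⟨n', m', g', rfl⟩ := hy
    rcases le_total m n' with h | h
    · obtain ⟨k, rfl⟩ := Nat.exists_eq_add_of_le h
      refine ⟨n + k, m', φ^[k] g * g', ?_⟩
      rw [map_mul, pow_add, pow_add, mul_assoc (HNNExtension.t ^ n) (HNNExtension.t ^ k),
        ← mul_assoc (HNNExtension.t ^ k), ← of_mul_t_pow hφ]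
      group
    · obtain ⟨k, rfl⟩ := Nat.exists_eq_add_of_le h
      refine ⟨n, m' + k, g * φ^[k] g', ?_⟩
      rw [map_mul, eq_inv_mul_of_mul_eq (of_mul_t_pow hφ k g').symm]
      simp only [pow_add, mul_inv_rev, mul_assoc, inv_mul_cancel_left]
      congr 4
      group
  | inv x hx =>
    obtain ⟨n, m, g, rfl⟩ := hx
    exact ⟨m, n, g⁻¹, by simp [mul_assoc]⟩

theorem FiniteExtensionsRF.ascendingHNNExtension.{u, v} {G : Type u} [Group G] [Group.FG G]
    (hG : FiniteExtensionsRF.{u, v} G) {φ : G →* G} (hφ : Function.Injective φ)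
    (hsep : SeparatesIterates φ) : FiniteExtensionsRF.{u, v} (AscendingHNNExtension φ hφ) := by
  intro E _ π hπ hfin
  obtain ⟨t, ht⟩ := hπ HNNExtension.t
  have hof : Function.Injective (HNNExtension.of : G →* AscendingHNNExtension φ hφ) :=
    HNNExtension.of_injective _
  set H : Subgroup E := (HNNExtension.of : G →* AscendingHNNExtension φ hφ).range.comap π
  obtain ⟨ψ, hψ⟩ := MonoidHom.exists_lift_of_injective hof (π.comp H.subtype) fun x => x.2
  replace hψ : ∀ x : H, HNNExtension.of (ψ x) = π x := hψ
  have hψsurj : Function.Surjective ψ := by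
    intro g
    obtain ⟨e, he⟩ := hπ (HNNExtension.of g)
    exact ⟨⟨e, g, he.symm⟩, hof ((hψ _).trans he)⟩
  have hψker : Finite ψ.ker := by
    refine Finite.of_injective (fun x : ψ.ker => (⟨x.1.1, ?_⟩ : π.ker)) fun x y h => ?_
    · rw [MonoidHom.mem_ker, ← hψ, MonoidHom.mem_ker.1 x.2, map_one]
    · exact Subtype.ext (Subtype.ext (congr_arg (fun z : π.ker => (z : E)) h))
  have hconj : ∀ x : H, π (t⁻¹ * x * t) = HNNExtension.of (φ (ψ x)) := by
    intro x
    rw [map_mul, map_mul, map_inv, ht, ← hψ, AscendingHNNExtension.inv_t_mul_of_mul_t]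
  obtain ⟨φH, hφH⟩ := MonoidHom.exists_lift_of_injective H.subtype_injective
    ((MulAut.conj t⁻¹).toMonoidHom.comp H.subtype) fun x => by
      rw [Subgroup.range_subtype]
      refine ⟨φ (ψ x), ?_⟩
      rw [← hconj]
      simp
  replace hφH : ∀ x : H, (φH x : E) = t⁻¹ * x * t := fun x => by
    simpa using hφH x
  have hψφ : ∀ x, ψ (φH x) = φ (ψ x) := fun x => hof (by rw [hψ, hφH, hconj])
  have hφHinj : Function.Injective φH := by
    intro x y h
    have h1 := congr_arg Subtype.val h
    rw [hφH, hφH] at h1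
    exact Subtype.ext (mul_left_cancel (mul_right_cancel h1))
  obtain ⟨φA, hφA⟩ := MonoidHom.exists_lift_of_injective ψ.ker.subtype_injective
    (φH.comp ψ.ker.subtype) fun x => by
      rw [Subgroup.range_subtype, MonoidHom.mem_ker, MonoidHom.comp_apply, hψφ]
      exact (congr_arg φ (MonoidHom.mem_ker.1 x.2)).trans (map_one φ)
  have hsepH : SeparatesIterates φH := .of_exact hG ψ.ker.subtype_injective hψsurj (by simp)
    hφA hψφ (.of_finite φA) hsep
  have hHfg : Group.FG H := Group.fg_of_exact ψ.ker.subtype hψsurj (by simp)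
  set ε : AscendingHNNExtension φ hφ →* Multiplicative ℤ :=
    HNNExtension.lift 1 (Multiplicative.ofAdd 1) (by simp)
  refine residuallyFinite_of_ascending hφH (ε := ε.comp π) (fun e => ?_) ?_ (fun x => ?_)
    fun w hw => hsepH.exists_comap_eq hφHinj hw
  · obtain ⟨n, m, g, h⟩ := AscendingHNNExtension.exists_eq hφ (π e)
    refine ⟨n, m, ⟨(t ^ n)⁻¹ * e * t ^ m, g, ?_⟩, by simp [mul_assoc]⟩
    rw [map_mul, map_mul, map_inv, map_pow, map_pow, ht, h]
    group
  · simp [ht, ε]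
  · simp [← hψ, ε]

end AscendingHNN

section NormalSeries

theorem NiceFactor.finiteExtensionsRF.{u, v} {Q : Type u} [Group Q]
    (hQ : Finite Q ∨ (∃ n : ℕ, Nonempty (Q ≃* FreeGroup (Fin n))) ∨ IsPolycyclic Q) :
    Group.FG Q ∧ FiniteExtensionsRF.{u, v} Q ∧ ∀ φ : Q →* Q, SeparatesIterates φ := by
  rcases hQ with hQ | ⟨n, ⟨e⟩⟩ | hQ
  · exact ⟨inferInstance, .of_finite, .of_finite⟩
  · exact ⟨Group.fg_of_surjective (f := e.symm.toMonoidHom) e.symm.surjective,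
      .of_mulEquiv e.symm (.freeGroup n), .of_mulEquiv e FreeGroup.separatesIterates⟩
  · obtain ⟨hfg, hsol⟩ := hQ.subgroup_fg_and_isSolvable
    exact ⟨Group.fg_def.2 (hfg ⊤),
      Group.IsSolvable.finiteExtensionsRF_and_separatesIterates hfg⟩

theorem finiteExtensionsRF_of_series.{u, v} {G : Type u} [Group G] {r : ℕ}
    {Gs : Fin (r + 1) → Subgroup G} (h0 : Gs 0 = ⊥)
    (hfac : ∀ i : Fin r, NiceFactor (Gs i.castSucc) (Gs i.succ)) {φ : G →* G}
    (hinv : ∀ i, (Gs i).map φ ≤ Gs i) (i : Fin (r + 1)) :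
    Group.FG (Gs i) ∧ FiniteExtensionsRF.{u, v} (Gs i) ∧
      ∃ φi : Gs i →* Gs i, (∀ x, (φi x : G) = φ x) ∧ SeparatesIterates φi := by
  have hres : ∀ i, ∃ φi : Gs i →* Gs i, ∀ x, (φi x : G) = φ x := fun i =>
    MonoidHom.exists_lift_of_injective (Gs i).subtype_injective (φ.comp (Gs i).subtype) fun x => by
      rw [Subgroup.range_subtype]
      exact hinv i ⟨x, x.2, rfl⟩
  obtain ⟨φi, hφi⟩ := hres i
  suffices h : Group.FG (Gs i) ∧ FiniteExtensionsRF.{u, v} (Gs i) ∧ SeparatesIterates φi from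
    ⟨h.1, h.2.1, φi, hφi, h.2.2⟩
  induction i using Fin.induction with
  | zero =>
    have : Finite (Gs 0) := by rw [h0]; infer_instance
    exact ⟨inferInstance, .of_finite, .of_finite φi⟩
  | succ i ih =>
    obtain ⟨φA, hφA⟩ := hres i.castSucc
    obtain ⟨hAfg, hA, hAsep⟩ := ih φA hφA
    obtain ⟨hle, hn, hfac⟩ := hfac i
    set N := (Gs i.castSucc).subgroupOf (Gs i.succ)
    obtain ⟨hQfg, hQ, hQsep⟩ := NiceFactor.finiteExtensionsRF.{u, v} hfac
    have hQ' := (NiceFactor.finiteExtensionsRF.{u, u} hfac).2.1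
    have hinj : Function.Injective (Subgroup.inclusion hle) := Subgroup.inclusion_injective hle
    have hsurj := QuotientGroup.mk'_surjective N
    have hex : (QuotientGroup.mk' N).ker = (Subgroup.inclusion hle).range := by
      rw [QuotientGroup.ker_mk', Subgroup.inclusion_range]
    have hcomm : ∀ a, Subgroup.inclusion hle (φA a) = φi (Subgroup.inclusion hle a) :=
      fun a => Subtype.ext ((hφA a).trans (hφi (Subgroup.inclusion hle a)).symm)
    have hNφ : N ≤ N.comap φi := by
      intro x hx
      show ((φi x : Gs i.succ) : G) ∈ Gs i.castSucc
      rw [hφi]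
      exact hinv _ ⟨x, hx, rfl⟩
    exact ⟨Group.fg_of_exact _ hsurj hex.le, .of_exact hA hQ hinj hsurj hex,
      .of_exact hQ' hinj hsurj hex hcomm (φQ := QuotientGroup.map N N φi hNφ) (fun _ => rfl)
        hAsep (hQsep _)⟩

end NormalSeries

/-- If `G` has a normal series `1 = G₀ ⊴ G₁ ⊴ ⋯ ⊴ G_r = G` whose factors are each
finite, free of finite rank, or polycyclic, and `φ : G → G` is a monomorphism with
`φ(Gᵢ) ≤ Gᵢ` for all `i`, then the ascending HNN extension `G_φ` is highly residually
finite. -/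
theorem statement19 {G : Type*} [Group G] (r : ℕ) (Gs : Fin (r + 1) → Subgroup G)
    (h0 : Gs 0 = ⊥) (htop : Gs (Fin.last r) = ⊤)
    (hnorm : ∀ i, (Gs i).Normal)
    (hfac : ∀ i : Fin r, NiceFactor (Gs i.castSucc) (Gs i.succ))
    (φ : G →* G) (hφ : Function.Injective φ) (hinv : ∀ i, (Gs i).map φ ≤ Gs i) :
    HighlyResiduallyFinite (AscendingHNNExtension φ hφ) := by
  intro E F _ _ hF ι π hι hπ hex
  obtain ⟨hfg, hG, φi, hφi, hsep⟩ := finiteExtensionsRF_of_series h0 hfac hinv (Fin.last r)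
  set e : Gs (Fin.last r) ≃* G := (MulEquiv.subgroupCongr htop).trans Subgroup.topEquiv
  have : Group.FG G := Group.fg_of_surjective (f := e.toMonoidHom) e.surjective
  have hker : Finite π.ker := by
    rw [hex]
    exact Finite.of_surjective ι.rangeRestrict ι.rangeRestrict_surjective
  exact (hG.of_mulEquiv e).ascendingHNNExtension hφ (hsep.of_semiconj e hφi) E π hπ hker
end
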